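/- Let 0 < p ≤ ∞, 1 < q < ∞, 1 < s < 2, t = s/(1+s), and N > 0. There exists a constant C such that for every jump collection (N_k)_{k≥0}, every sequence (f_i)_{i∈ℤ} of measurable functions on ℝ, and every continuous Littlewood–Paley family (g_j)_{j∈ℤ} with band width N, one has ‖ (Σ_{k≥1} |Σ_{N_{k−1}(x) < i < j ≤ N_k(x)} f_i(x) g_j(x)|^t)^{1/t} ‖_{pq/(p+q)} ≤ C ‖(f_i)‖_{p,1} ‖(g_j)‖_{q,s}. -/

import Mathlib

open MeasureTheory ENNReal
open scoped FourierTransform NNReal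

noncomputable section

/-- A jump collection: a sequence of measurable integer-valued functions on `ℝ`,
nondecreasing in the index. -/
def IsJumpCollection (Nk : ℕ → ℝ → ℤ) : Prop :=
  (∀ k, Measurable (Nk k)) ∧ ∀ (k : ℕ) (x : ℝ), Nk k x ≤ Nk (k + 1) x

/-- A continuous Littlewood–Paley family with band width `Nb`. -/
def IsContLPFamily (Nb : ℝ) (g : ℤ → SchwartzMap ℝ ℂ) : Prop :=
  ∀ j : ℤ, ∀ ξ : ℝ, 𝓕 (⇑(g j)) ξ ≠ 0 →
    (2 : ℝ) ^ ((j : ℝ) - Nb) < |ξ| ∧ |ξ| < (2 : ℝ) ^ ((j : ℝ) + Nb)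

/-- The `L^u` quasi-norm on `ℝ≥0∞`-valued functions, for `u ∈ (0, ∞]`. -/
def eNorm (u : ℝ≥0∞) (h : ℝ → ℝ≥0∞) : ℝ≥0∞ :=
  if u = ⊤ then essSup h volume
  else (∫⁻ x : ℝ, (h x) ^ u.toReal) ^ (1 / u.toReal)

section
lemma geo_int_summable (β : ℝ) (hβ : 0 < β) :
    Summable (fun m : ℤ => ((2:ℝ) ^ (-β)) ^ m.natAbs) := by
  have h1 : (2:ℝ) ^ (-β) < 1 := Real.rpow_lt_one_of_one_lt_of_neg (by norm_num) (by linarith)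
  have h0 : 0 ≤ (2:ℝ) ^ (-β) := by positivity
  have hs := summable_geometric_of_lt_one h0 h1
  refine Summable.of_nat_of_neg ?_ ?_
  · simpa using hs
  · simpa using hs

lemma geo_min_le (a : ℝ) (h1 : 1 ≤ a) (h2 : a < 2) (m : ℤ) :
    min ((2:ℝ) ^ m * a) (((2:ℝ) ^ m * a)⁻¹) ≤ 2 * ((2:ℝ)⁻¹) ^ m.natAbs := by
  rcases le_total 0 m with hm | hm
  · refine (min_le_right _ _).trans ?_
    lift m to ℕ using hm
    simp only [zpow_natCast, Int.natAbs_natCast, mul_inv, inv_pow]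
    have : 0 < ((2:ℝ)^m)⁻¹ := by positivity
    have h3 : a⁻¹ ≤ 1 := inv_le_one_of_one_le₀ h1
    nlinarith
  · refine (min_le_left _ _).trans ?_
    obtain ⟨n, rfl⟩ : ∃ n : ℕ, m = -n := ⟨m.natAbs, by omega⟩
    simp only [zpow_neg, zpow_natCast, Int.natAbs_neg, Int.natAbs_natCast, inv_pow]
    have : 0 < ((2:ℝ)^n)⁻¹ := by positivity
    nlinarith

lemma geo_sum (β : ℝ) (hβ : 0 < β) : ∃ C : ℝ≥0, ∀ a : ℝ, 0 < a →
    ∑' m : ℤ, ENNReal.ofReal ((min ((2:ℝ) ^ m * a) (((2:ℝ) ^ m * a)⁻¹)) ^ β) ≤ C := by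
  have hs := (geo_int_summable β hβ).mul_left ((2:ℝ)^β)
  refine ⟨(∑' m : ℤ, (2:ℝ)^β * ((2:ℝ) ^ (-β)) ^ m.natAbs).toNNReal, fun a ha => ?_⟩
  obtain ⟨n, hn1, hn2⟩ := exists_mem_Ico_zpow ha (one_lt_two)
  have hre : ∑' m : ℤ, ENNReal.ofReal ((min ((2:ℝ) ^ m * a) (((2:ℝ) ^ m * a)⁻¹)) ^ β)
      = ∑' m : ℤ, ENNReal.ofReal ((min ((2:ℝ) ^ m * (a / 2^n)) (((2:ℝ) ^ m * (a/2^n))⁻¹)) ^ β) := by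
    symm
    rw [← (Equiv.addRight n).tsum_eq]
    congr 1
    ext m
    have : (2:ℝ) ^ m * a = (2:ℝ)^(m+n) * (a / 2^n) := by
      rw [zpow_add₀ (by norm_num)]; field_simp
    simp only [Equiv.coe_addRight]
    rw [this]
  rw [hre]
  have hp : (0:ℝ) < 2^n := by positivity
  have hb1 : 1 ≤ a / 2^n := by rw [le_div_iff₀ hp]; simpa using hn1
  have hb2 : a / 2^n < 2 := by
    rw [div_lt_iff₀ hp]; rw [zpow_add₀ (by norm_num)] at hn2; simp at hn2; linarith
  calc _ ≤ ∑' m : ℤ, ENNReal.ofReal ((2:ℝ)^β * ((2:ℝ) ^ (-β)) ^ m.natAbs) := by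
        refine ENNReal.tsum_le_tsum fun m => ENNReal.ofReal_le_ofReal ?_
        have h0 : 0 ≤ min ((2:ℝ) ^ m * (a / 2^n)) (((2:ℝ) ^ m * (a/2^n))⁻¹) := by positivity
        refine (Real.rpow_le_rpow h0 (geo_min_le _ hb1 hb2 m) hβ.le).trans (le_of_eq ?_)
        rw [Real.mul_rpow (by norm_num) (by positivity), ← Real.rpow_natCast, ← Real.rpow_natCast,
          Real.rpow_neg (by norm_num), Real.inv_rpow (by norm_num), Real.inv_rpow (by positivity),
          Real.inv_rpow (by positivity), ← Real.rpow_mul (by norm_num), ← Real.rpow_mul (by norm_num),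
          mul_comm β]
    _ = ENNReal.ofReal (∑' m : ℤ, (2:ℝ)^β * ((2:ℝ) ^ (-β)) ^ m.natAbs) := by
        rw [ENNReal.ofReal_tsum_of_nonneg (fun m => by positivity) hs]
    _ = _ := rfl
    _ ≤ _ := le_rfl

lemma geo_low (β : ℝ) (hβ : 0 < β) : ∃ C : ℝ≥0, ∀ a : ℝ, 0 ≤ a →
    ∑' m : ℤ, (if (2:ℝ)^m < a then ENNReal.ofReal (((2:ℝ)^m) ^ β) else 0)
      ≤ C * ENNReal.ofReal (a ^ β) := by
  obtain ⟨C, hC⟩ := geo_sum β hβ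
  refine ⟨C, fun a ha => ?_⟩
  rcases ha.eq_or_lt with rfl | ha
  · have : ∀ m : ℤ, ¬ ((2:ℝ)^m < 0) := fun m => not_lt.2 (by positivity)
    simp [this]
  calc _ ≤ ∑' m : ℤ, ENNReal.ofReal ((min ((2:ℝ) ^ m * a⁻¹) (((2:ℝ) ^ m * a⁻¹)⁻¹)) ^ β) *
            ENNReal.ofReal (a ^ β) := by
        refine ENNReal.tsum_le_tsum fun m => ?_
        split_ifs with h
        · rw [← ENNReal.ofReal_mul (by positivity)]
          refine ENNReal.ofReal_le_ofReal ?_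
          have hq : (2:ℝ)^m * a⁻¹ ≤ 1 := by
            rw [← div_eq_mul_inv, div_le_one ha]; exact h.le
          rw [min_eq_left (hq.trans (by rw [one_le_inv₀ (by positivity)]; exact hq)),
            ← Real.mul_rpow (by positivity) ha.le]
          apply le_of_eq; congr 1; field_simp
        · exact zero_le
    _ ≤ _ := by
        rw [ENNReal.tsum_mul_right]
        gcongr
        exact hC _ (by positivity)

lemma geo_high (β : ℝ) (hβ : 0 < β) : ∃ C : ℝ≥0, ∀ a : ℝ, 0 < a →
    ∑' m : ℤ, (if a ≤ (2:ℝ)^m then ENNReal.ofReal (((2:ℝ)^m) ^ (-β)) else 0)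
      ≤ C * ENNReal.ofReal (a ^ (-β)) := by
  obtain ⟨C, hC⟩ := geo_sum β hβ
  refine ⟨C, fun a ha => ?_⟩
  calc _ ≤ ∑' m : ℤ, ENNReal.ofReal ((min ((2:ℝ) ^ m * a⁻¹) (((2:ℝ) ^ m * a⁻¹)⁻¹)) ^ β) *
            ENNReal.ofReal (a ^ (-β)) := by
        refine ENNReal.tsum_le_tsum fun m => ?_
        split_ifs with h
        · rw [← ENNReal.ofReal_mul (by positivity)]
          refine ENNReal.ofReal_le_ofReal ?_
          have hq : 1 ≤ (2:ℝ)^m * a⁻¹ := by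
            rw [← div_eq_mul_inv, one_le_div ha]; exact h
          rw [min_eq_right ((inv_le_one_of_one_le₀ hq).trans hq), Real.inv_rpow (by positivity),
            ← Real.rpow_neg (by positivity),
            ← Real.mul_rpow (by positivity) ha.le]
          apply le_of_eq; congr 1; field_simp
        · exact zero_le
    _ ≤ _ := by
        rw [ENNReal.tsum_mul_right]
        gcongr
        exact hC _ (by positivity)

end

section
/-- The basic decaying profile. -/
def Phi (x : ℝ) : ℝ := (1 + x ^ 2)⁻¹

lemma Phi_pos (x : ℝ) : 0 < Phi x := by unfold Phi; positivity
lemma Phi_le_one (x : ℝ) : Phi x ≤ 1 := inv_le_one_of_one_le₀ (by nlinarith [sq_nonneg x])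
lemma Phi_neg (x : ℝ) : Phi (-x) = Phi x := by simp [Phi]
lemma Phi_cont : Continuous Phi := by
  unfold Phi
  exact Continuous.inv₀ (by fun_prop) (fun x => by positivity)
lemma Phi_near (u w : ℝ) (h : |w - u| ≤ 1) : Phi w ≤ 3 * Phi u := by
  unfold Phi
  rw [← div_eq_mul_inv, inv_eq_one_div, div_le_div_iff₀ (by positivity) (by positivity)]
  have := abs_le.1 h
  have h2 : (w-u)^2 ≤ 1 := by rw [← sq_abs]; nlinarith [abs_nonneg (w-u)]
  nlinarith [sq_nonneg (2*w-u), sq_nonneg (w+ (w-u))]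
lemma Phi_half (x w : ℝ) (h : |x| ≤ 2 * |w|) : Phi w ≤ 4 * Phi x := by
  unfold Phi
  rw [← div_eq_mul_inv, inv_eq_one_div, div_le_div_iff₀ (by positivity) (by positivity)]
  have : x^2 ≤ 4 * w^2 := by
    rw [← sq_abs x, ← sq_abs w]; nlinarith [abs_nonneg x, abs_nonneg w]
  nlinarith

/-- Assumptions on the kernel: `Ψ' = ψ`, everything decays. -/
structure Ker (Ψ ψ : ℝ → ℂ) (A : ℝ) : Prop where
  A_pos : 0 < A
  hΨ : ∀ x, HasDerivAt Ψ (ψ x) x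
  bΨ : ∀ x, ‖Ψ x‖ ≤ A * Phi x ^ 2
  bψ : ∀ x, ‖ψ x‖ ≤ A * Phi x ^ 2
  dψ : ∃ ψ' : ℝ → ℂ, (∀ x, HasDerivAt ψ (ψ' x) x) ∧ ∀ x, ‖ψ' x‖ ≤ A * Phi x ^ 2

variable {Ψ ψ : ℝ → ℂ} {A : ℝ}

lemma Ker.cont (hk : Ker Ψ ψ A) : Continuous ψ := by
  obtain ⟨ψ', h, -⟩ := hk.dψ
  exact continuous_iff_continuousAt.2 fun x => (h x).continuousAt

lemma Ker.contΨ (hk : Ker Ψ ψ A) : Continuous Ψ :=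
  continuous_iff_continuousAt.2 fun x => (hk.hΨ x).continuousAt

lemma Ker.mvt (hk : Ker Ψ ψ A) (u v B : ℝ) (hB : ∀ w ∈ segment ℝ u v, A * Phi w ^ 2 ≤ B) :
    ‖ψ v - ψ u‖ ≤ B * |v - u| := by
  obtain ⟨ψ', h, hb⟩ := hk.dψ
  have := Convex.norm_image_sub_le_of_norm_hasDerivWithin_le (f := ψ) (f' := ψ')
    (s := segment ℝ u v) (C := B) (fun x _ => (h x).hasDerivWithinAt)
    (fun x hx => (hb x).trans (hB x hx)) (convex_segment u v) (left_mem_segment ℝ u v)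
    (right_mem_segment ℝ u v)
  simpa [Real.norm_eq_abs] using this

lemma Phi_sq_le (x : ℝ) : Phi x ^ 2 ≤ Phi x := by
  nlinarith [Phi_pos x, Phi_le_one x]

lemma Ker.near (hk : Ker Ψ ψ A) (u v : ℝ) (h : |v - u| ≤ 1) :
    ‖ψ v - ψ u‖ ≤ 3 * A * Phi u * |v - u| := by
  refine hk.mvt u v _ fun w hw => ?_
  have hA := hk.A_pos
  have : |w - u| ≤ 1 := by
    rw [segment_eq_uIcc] at hw
    exact (Set.abs_sub_left_of_mem_uIcc hw).trans h
  have h1 := Phi_near u w this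
  nlinarith [Phi_sq_le w, Phi_pos u]

lemma Ker.horm_pt (hk : Ker Ψ ψ A) (x y : ℝ) (h : 2 * |y| ≤ |x|) :
    ‖ψ (x - y) - ψ x‖ ≤ 17 * A * Phi x ^ 2 * min 1 |y| := by
  have hA := hk.A_pos
  have hseg : ∀ w ∈ segment ℝ x (x-y), A * Phi w ^ 2 ≤ 16 * A * Phi x ^ 2 := by
    intro w hw
    have : |x| ≤ 2 * |w| := by
      rw [segment_eq_uIcc] at hw
      have h1 := Set.abs_sub_left_of_mem_uIcc hw
      have h2 : |x - y - x| = |y| := by rw [← abs_neg]; ring_nf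
      have h3 := abs_sub_abs_le_abs_sub x w
      rw [abs_sub_comm] at h3
      linarith
    have := Phi_half x w this
    have hh : Phi w ^ 2 ≤ (4 * Phi x)^2 := pow_le_pow_left₀ (Phi_pos w).le this 2
    nlinarith
  have h1 := hk.mvt x (x-y) _ hseg
  have h2 : |x - y - x| = |y| := by rw [← abs_neg]; ring_nf
  rw [h2] at h1
  have h3 : ‖ψ (x-y) - ψ x‖ ≤ 17 * A * Phi x ^ 2 := by
    refine (norm_sub_le _ _).trans ?_
    have := (hk.bψ (x-y)).trans (hseg _ (right_mem_segment ℝ _ _))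
    have := hk.bψ x
    linarith
  have hp : 0 ≤ A * Phi x ^ 2 := by positivity
  rcases min_cases 1 |y| with ⟨h, -⟩ | ⟨h, -⟩ <;> rw [h]
  · linarith
  · nlinarith [abs_nonneg y, mul_nonneg hp (abs_nonneg y)]

/-- The dilated kernels. -/
def dil (φ : ℝ → ℂ) (j : ℤ) (x : ℝ) : ℂ := ((2:ℝ) ^ j) • φ ((2:ℝ) ^ j * x)

lemma dil_cont {φ : ℝ → ℂ} (h : Continuous φ) (j : ℤ) : Continuous (dil φ j) := by
  unfold dil; fun_prop

lemma Phi_int : ∫⁻ x, ENNReal.ofReal (Phi x) = ENNReal.ofReal Real.pi := by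
  rw [← integral_univ_inv_one_add_sq, ofReal_integral_eq_lintegral_ofReal]
  · rfl
  · exact integrable_inv_one_add_sq
  · exact Filter.Eventually.of_forall fun x => (Phi_pos x).le

lemma Phi_scale_int (a : ℝ) (ha : 0 < a) :
    ∫⁻ x, ENNReal.ofReal (a * Phi (a * x)) = ENNReal.ofReal Real.pi := by
  have hi : Integrable (fun x => Phi (a * x)) :=
    (integrable_comp_mul_left_iff (g := Phi) ha.ne').2 integrable_inv_one_add_sq
  rw [← ofReal_integral_eq_lintegral_ofReal (hi.const_mul a)
    (Filter.Eventually.of_forall fun x => by have := Phi_pos (a*x); positivity),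
    integral_const_mul, Measure.integral_comp_mul_left (fun x => Phi x)]
  congr 1
  rw [abs_of_pos (by positivity), smul_eq_mul, ← mul_assoc, mul_inv_cancel₀ ha.ne', one_mul]
  exact integral_univ_inv_one_add_sq

lemma Phi_scale_shift (a z : ℝ) (ha : 0 < a) :
    ∫⁻ x, ENNReal.ofReal (a * Phi (a * (x - z))) = ENNReal.ofReal Real.pi := by
  rw [lintegral_sub_right_eq_self (fun x => ENNReal.ofReal (a * Phi (a * x))) z, Phi_scale_int a ha]

lemma Phi_scale_shift' (a z : ℝ) (ha : 0 < a) :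
    ∫⁻ x, ENNReal.ofReal (a * Phi (a * (z - x))) = ENNReal.ofReal Real.pi := by
  rw [← Phi_scale_shift a z ha]
  congr 1; ext x
  rw [← Phi_neg]; ring_nf

lemma Ker.horm_one (hk : Ker Ψ ψ A) (j : ℤ) (y : ℝ) (hy : y ≠ 0) :
    ∫⁻ x in {x : ℝ | 2 * |y| ≤ |x|}, ‖dil ψ j (x - y) - dil ψ j x‖ₑ ≤
      ENNReal.ofReal (17 * A * Real.pi) *
        ENNReal.ofReal ((min ((2:ℝ) ^ j * |y|) (((2:ℝ) ^ j * |y|)⁻¹)) ^ (1:ℝ)) := by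
  have hA := hk.A_pos
  set a : ℝ := (2:ℝ)^j with ha
  have hap : 0 < a := by positivity
  have hyp : 0 < |y| := abs_pos.2 hy
  have key : ∀ x ∈ {x : ℝ | 2 * |y| ≤ |x|}, ‖dil ψ j (x - y) - dil ψ j x‖ₑ ≤
      ENNReal.ofReal (17 * A * min (a * |y|) ((a * |y|)⁻¹)) * ENNReal.ofReal (a * Phi (a * x)) := by
    intro x hx
    rw [← ofReal_mul (by positivity), ← ofReal_norm_eq_enorm]
    refine ofReal_le_ofReal ?_
    unfold dil
    rw [← ha, ← smul_sub, norm_smul, Real.norm_of_nonneg hap.le, mul_sub]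
    have h1 := hk.horm_pt (a * x) (a * y) (by
      rw [abs_mul, abs_mul, abs_of_pos hap]; simp at hx; nlinarith)
    rw [abs_mul, abs_of_pos hap] at h1
    have h2 : Phi (a * x) * min 1 (a * |y|) ≤ min (a * |y|) ((a * |y|)⁻¹) := by
      have hb : 0 < a * |y| := by positivity
      refine le_min ?_ ?_
      · have := Phi_le_one (a*x)
        have := Phi_pos (a*x)
        have := min_le_right 1 (a * |y|)
        nlinarith
      · have h3 : Phi (a * x) ≤ (a*|y|)⁻¹ := by
          unfold Phi
          refine inv_anti₀ hb ?_
          have : a * |y| ≤ |a * x| := by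
            rw [abs_mul, abs_of_pos hap]; simp at hx; nlinarith
          rw [← sq_abs]
          nlinarith [sq_nonneg (|a*x| - 1), abs_nonneg (a*x)]
        have := min_le_left 1 (a * |y|)
        have := Phi_pos (a*x)
        have h0 : 0 ≤ min 1 (a * |y|) := by positivity
        nlinarith
    calc a * ‖ψ (a * x - a * y) - ψ (a * x)‖ 
        ≤ a * (17 * A * Phi (a*x) ^ 2 * min 1 (a*|y|)) := by gcongr
      _ = 17 * A * (Phi (a * x) * min 1 (a * |y|)) * (a * Phi (a * x)) := by ring
      _ ≤ _ := by
        have := Phi_pos (a*x)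
        gcongr
  calc _ ≤ ∫⁻ x in {x : ℝ | 2 * |y| ≤ |x|}, 
        ENNReal.ofReal (17 * A * min (a * |y|) ((a * |y|)⁻¹)) * ENNReal.ofReal (a * Phi (a * x)) := by
        refine setLIntegral_mono' ?_ key
        exact measurableSet_le (by fun_prop) (by fun_prop)
    _ ≤ ∫⁻ x, ENNReal.ofReal (17 * A * min (a * |y|) ((a * |y|)⁻¹)) * ENNReal.ofReal (a * Phi (a * x)) :=
        setLIntegral_le_lintegral _ _
    _ = ENNReal.ofReal (17 * A * min (a * |y|) ((a * |y|)⁻¹)) * ENNReal.ofReal Real.pi := by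
        rw [lintegral_const_mul' _ _ (by simp), Phi_scale_int a hap]
    _ = _ := by
        rw [← ofReal_mul (by positivity), ← ofReal_mul (by positivity), Real.rpow_one]
        ring_nf

lemma Ker.horm (hk : Ker Ψ ψ A) : ∃ B : ℝ≥0, ∀ y : ℝ,
    ∑' j : ℤ, ∫⁻ x in {x : ℝ | 2 * |y| ≤ |x|}, ‖dil ψ j (x - y) - dil ψ j x‖ₑ ≤ B := by
  obtain ⟨C, hC⟩ := geo_sum 1 one_pos
  refine ⟨(17 * A * Real.pi).toNNReal * C, fun y => ?_⟩
  by_cases hy : y = 0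
  · simp [hy]
  calc _ ≤ ∑' j : ℤ, ENNReal.ofReal (17 * A * Real.pi) *
        ENNReal.ofReal ((min ((2:ℝ) ^ j * |y|) (((2:ℝ) ^ j * |y|)⁻¹)) ^ (1:ℝ)) :=
        ENNReal.tsum_le_tsum fun j => hk.horm_one j y hy
    _ ≤ _ := by
        rw [ENNReal.tsum_mul_left, ENNReal.coe_mul]
        gcongr
        · rfl
        · exact hC _ (abs_pos.2 hy)

end

section
section nice
variable {E F G : Type*} [NormedAddCommGroup E] [NormedAddCommGroup F] [NormedAddCommGroup G]

/-- Bounded, integrable, strongly measurable functions. -/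
structure Nice (f : ℝ → E) : Prop where
  sm : StronglyMeasurable f
  int : Integrable f
  bdd : ∃ C : ℝ, ∀ x, ‖f x‖ ≤ C

lemma Nice.bdd' {f : ℝ → E} (h : Nice f) : ∃ C : ℝ, 0 ≤ C ∧ ∀ x, ‖f x‖ ≤ C := by
  obtain ⟨C, hC⟩ := h.bdd
  exact ⟨C, (norm_nonneg _).trans (hC 0), hC⟩

lemma Nice.add {f g : ℝ → E} (hf : Nice f) (hg : Nice g) : Nice (fun x => f x + g x) := by
  obtain ⟨C, hC⟩ := hf.bdd
  obtain ⟨D, hD⟩ := hg.bdd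
  exact ⟨hf.sm.add hg.sm, hf.int.add hg.int, C + D, fun x =>
    (norm_add_le _ _).trans (add_le_add (hC x) (hD x))⟩

lemma Nice.sub {f g : ℝ → E} (hf : Nice f) (hg : Nice g) : Nice (fun x => f x - g x) := by
  obtain ⟨C, hC⟩ := hf.bdd
  obtain ⟨D, hD⟩ := hg.bdd
  exact ⟨hf.sm.sub hg.sm, hf.int.sub hg.int, C + D, fun x =>
    (norm_sub_le _ _).trans (add_le_add (hC x) (hD x))⟩

lemma Nice.zero : Nice (fun _ : ℝ => (0:E)) :=
  ⟨stronglyMeasurable_const, integrable_zero _ _ _, 0, by simp⟩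

lemma Nice.sum {ι : Type*} (s : Finset ι) {f : ι → ℝ → E} (hf : ∀ i, Nice (f i)) :
    Nice (fun x => ∑ i ∈ s, f i x) := by
  classical
  induction s using Finset.induction_on with
  | empty => simpa using Nice.zero
  | insert a s ha ih => simpa [Finset.sum_insert ha] using (hf a).add ih

lemma Nice.mono {f : ℝ → E} {g : ℝ → F} (hf : Nice f) (hg : StronglyMeasurable g)
    (h : ∀ x, ‖g x‖ ≤ ‖f x‖) : Nice g := by
  obtain ⟨C, hC⟩ := hf.bdd
  exact ⟨hg, hf.int.mono hg.aestronglyMeasurable (Filter.Eventually.of_forall h), C,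
    fun x => (h x).trans (hC x)⟩

lemma Nice.indicator {f : ℝ → E} (hf : Nice f) {s : Set ℝ} (hs : MeasurableSet s) :
    Nice (s.indicator f) :=
  hf.mono (hf.sm.indicator hs) fun x => norm_indicator_le_norm_self f x

variable [NormedSpace ℂ E] [NormedSpace ℂ F] [NormedSpace ℂ G]

lemma Nice.conv_integrable {f : ℝ → E} {g : ℝ → F} (hf : Nice f) (hg : Nice g)
    (L : E →L[ℂ] F →L[ℂ] G) (x : ℝ) : Integrable (fun y => L (f y) (g (x - y))) := by
  obtain ⟨D, hD0, hD⟩ := hg.bdd'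
  have hm : StronglyMeasurable (fun y => L (f y) (g (x - y))) :=
    L.continuous₂.comp_stronglyMeasurable
      (hf.sm.prodMk (hg.sm.comp_measurable (g := fun y => x - y) (by fun_prop)))
  refine (hf.int.norm.const_mul (‖L‖ * D)).mono' hm.aestronglyMeasurable
    (Filter.Eventually.of_forall fun y => ?_)
  refine (L.le_opNorm₂ _ _).trans ?_
  have := hD (x - y)
  have h1 := norm_nonneg (f y)
  have h2 := norm_nonneg L
  calc ‖L‖ * ‖f y‖ * ‖g (x-y)‖ ≤ ‖L‖ * ‖f y‖ * D := by gcongr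
    _ = _ := by ring

lemma Nice.conv {f : ℝ → E} {g : ℝ → F} (hf : Nice f) (hg : Nice g)
    (L : E →L[ℂ] F →L[ℂ] G) : Nice (fun x => ∫ y, L (f y) (g (x - y))) := by
  obtain ⟨D, hD0, hD⟩ := hg.bdd'
  refine ⟨?_, hf.int.integrable_convolution L hg.int, ‖L‖ * D * ∫ y, ‖f y‖, fun x => ?_⟩
  · have hm : StronglyMeasurable (fun p : ℝ × ℝ => L (f p.2) (g (p.1 - p.2))) :=
      L.continuous₂.comp_stronglyMeasurable
        ((hf.sm.comp_measurable measurable_snd).prodMk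
          (hg.sm.comp_measurable (g := fun p : ℝ × ℝ => p.1 - p.2) (by fun_prop)))
    exact hm.integral_prod_right'
  · rw [← integral_const_mul]
    refine norm_integral_le_of_norm_le (hf.int.norm.const_mul _)
      (Filter.Eventually.of_forall fun y => ?_)
    refine (L.le_opNorm₂ _ _).trans ?_
    have := hD (x - y)
    have h1 := norm_nonneg (f y)
    have h2 := norm_nonneg L
    calc ‖L‖ * ‖f y‖ * ‖g (x-y)‖ ≤ ‖L‖ * ‖f y‖ * D := by gcongr
      _ = _ := by ring
end nice

/-- Scalar convolution. -/
def cv (φ h : ℝ → ℂ) (x : ℝ) : ℂ := ∫ y, h y * φ (x - y)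

lemma cv_nice {φ h : ℝ → ℂ} (hφ : Nice φ) (hh : Nice h) : Nice (cv φ h) :=
  hh.conv hφ (ContinuousLinearMap.mul ℂ ℂ)

lemma cv_integrable {φ h : ℝ → ℂ} (hφ : Nice φ) (hh : Nice h) (x : ℝ) :
    Integrable (fun y => h y * φ (x - y)) :=
  hh.conv_integrable hφ (ContinuousLinearMap.mul ℂ ℂ) x

lemma cv_add {φ h h' : ℝ → ℂ} (hφ : Nice φ) (hh : Nice h) (hh' : Nice h') (x : ℝ) :
    cv φ (fun y => h y + h' y) x = cv φ h x + cv φ h' x := by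
  unfold cv
  rw [← integral_add (cv_integrable hφ hh x) (cv_integrable hφ hh' x)]
  congr 1; ext y; ring

variable {Ψ ψ : ℝ → ℂ} {A : ℝ}

lemma Phi_integrable : Integrable Phi := integrable_inv_one_add_sq

lemma nice_of_Phi {φ : ℝ → ℂ} {B : ℝ} (hc : Continuous φ) (h : ∀ x, ‖φ x‖ ≤ B * Phi x ^ 2) :
    Nice φ := by
  have hB : 0 ≤ B := by
    have := (norm_nonneg _).trans (h 0)
    simpa [Phi] using this
  refine ⟨hc.stronglyMeasurable, (Phi_integrable.const_mul B).mono' hc.aestronglyMeasurable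
    (Filter.Eventually.of_forall fun x => (h x).trans ?_), B, fun x => (h x).trans ?_⟩
  · have := Phi_sq_le x; gcongr
  · have := Phi_sq_le x
    have := Phi_le_one x
    nlinarith

lemma dil_nice {φ : ℝ → ℂ} (h : Nice φ) (j : ℤ) : Nice (dil φ j) := by
  have hp : (0:ℝ) < 2 ^ j := by positivity
  obtain ⟨C, hC⟩ := h.bdd
  refine ⟨?_, ?_, (2:ℝ)^j * C, fun x => ?_⟩
  · exact (h.sm.comp_measurable (g := fun x => (2:ℝ)^j * x) (by fun_prop)).const_smul ((2:ℝ)^j)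
  · exact ((integrable_comp_mul_left_iff (g := φ) hp.ne').2 h.int).smul ((2:ℝ)^j)
  · unfold dil
    rw [norm_smul, Real.norm_of_nonneg hp.le]
    gcongr
    exact hC _

lemma Ker.nice (hk : Ker Ψ ψ A) : Nice ψ := nice_of_Phi hk.cont hk.bψ
lemma Ker.dnice (hk : Ker Ψ ψ A) (j : ℤ) : Nice (dil ψ j) := dil_nice hk.nice j

/-- Schur test in `L²`. -/
lemma schur_two {e h : ℝ → ℂ} {k : ℝ → ℝ → ℝ≥0∞} (hk : Measurable (Function.uncurry k))
    (hh : Measurable h) (a b : ℝ≥0∞)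
    (h1 : ∀ x, ‖e x‖ₑ ≤ ∫⁻ z, k x z * ‖h z‖ₑ) (h2 : ∀ x, ∫⁻ z, k x z ≤ a)
    (h3 : ∀ z, ∫⁻ x, k x z ≤ b) :
    ∫⁻ x, ‖e x‖ₑ ^ 2 ≤ a * b * ∫⁻ z, ‖h z‖ₑ ^ 2 := by
  have hkx : ∀ x, Measurable (k x) := fun x => hk.comp (by fun_prop : Measurable fun z => (x, z))
  have key : ∀ x, ‖e x‖ₑ ^ 2 ≤ a * ∫⁻ z, k x z * ‖h z‖ₑ ^ 2 := by
    intro x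
    have hcs := ENNReal.lintegral_mul_le_Lp_mul_Lq volume (p := 2) (q := 2)
      (by constructor <;> norm_num)
      (f := fun z => (k x z) ^ (1/2:ℝ)) (g := fun z => (k x z)^(1/2:ℝ) * ‖h z‖ₑ)
      ((hkx x).pow_const _).aemeasurable (((hkx x).pow_const _).mul hh.enorm).aemeasurable
    have e1 : ∀ z, ((k x z) ^ (1/2:ℝ)) ^ (2:ℝ) = k x z := fun z => by
      rw [← ENNReal.rpow_mul]; norm_num
    have e2 : ∀ z, (k x z) ^ (1/2:ℝ) * ((k x z)^(1/2:ℝ) * ‖h z‖ₑ) = k x z * ‖h z‖ₑ := fun z => by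
      rw [← mul_assoc, ← ENNReal.rpow_add_of_nonneg _ _ (by norm_num) (by norm_num)]; norm_num
    simp only [Pi.mul_apply] at hcs
    simp only [e2, ENNReal.mul_rpow_of_nonneg _ _ (by norm_num : (0:ℝ) ≤ 2), e1] at hcs
    have h4 := pow_le_pow_left' ((h1 x).trans hcs) 2
    rw [mul_pow] at h4
    simp only [← ENNReal.rpow_natCast, ← ENNReal.rpow_mul] at h4
    norm_num at h4
    refine h4.trans ?_
    gcongr
    exact h2 x
  have hm : Measurable (Function.uncurry fun x z => k x z * ‖h z‖ₑ ^ 2) :=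
    hk.mul ((hh.comp measurable_snd).enorm.pow_const 2)
  calc _ ≤ ∫⁻ x, a * ∫⁻ z, k x z * ‖h z‖ₑ ^ 2 := lintegral_mono key
    _ = a * ∫⁻ x, ∫⁻ z, k x z * ‖h z‖ₑ ^ 2 := lintegral_const_mul _ hm.lintegral_prod_right
    _ = a * ∫⁻ z, ∫⁻ x, k x z * ‖h z‖ₑ ^ 2 := by rw [lintegral_lintegral_swap hm.aemeasurable]
    _ ≤ a * ∫⁻ z, b * ‖h z‖ₑ ^ 2 := by
        gcongr with z
        have hkz : Measurable (fun x => k x z) :=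
          hk.comp (by fun_prop : Measurable fun x => (x, z))
        rw [lintegral_mul_const _ hkz]
        gcongr
        exact h3 z
    _ = _ := by rw [lintegral_const_mul _ (hh.enorm.pow_const 2), mul_assoc]

end

section
/-- Dyadic intervals of length `2^{-n}`. -/
def dI (n k : ℤ) : Set ℝ := Set.Ico ((k:ℝ) * (2:ℝ) ^ (-n)) (((k:ℝ) + 1) * (2:ℝ) ^ (-n))

/-- Index of the dyadic interval containing `x`. -/
def dix (n : ℤ) (x : ℝ) : ℤ := ⌊(2:ℝ) ^ n * x⌋

lemma mem_dI {n k : ℤ} {x : ℝ} : x ∈ dI n k ↔ dix n x = k := by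
  unfold dI dix
  have hp : (0:ℝ) < 2 ^ n := by positivity
  rw [Int.floor_eq_iff, Set.mem_Ico, zpow_neg, ← div_eq_mul_inv, ← div_eq_mul_inv,
    div_le_iff₀ hp, lt_div_iff₀ hp, mul_comm x]

lemma dix_meas (n : ℤ) : Measurable (dix n) := by unfold dix; fun_prop

lemma dI_meas (n k : ℤ) : MeasurableSet (dI n k) := measurableSet_Ico

lemma dI_vol (n k : ℤ) : volume (dI n k) = ENNReal.ofReal ((2:ℝ) ^ (-n)) := by
  unfold dI; rw [Real.volume_Ico]; congr 1; ring

lemma dI_real (n k : ℤ) : volume.real (dI n k) = (2:ℝ) ^ (-n) := by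
  rw [Measure.real, dI_vol, ENNReal.toReal_ofReal (by positivity)]

lemma dI_disj (n : ℤ) : Pairwise (Function.onFun Disjoint (dI n)) := by
  intro k l hkl
  refine Set.disjoint_left.2 fun x hx hy => hkl ?_
  rw [mem_dI] at hx hy
  rw [← hx, hy]

lemma dI_union (n : ℤ) : ⋃ k, dI n k = Set.univ := by
  ext x; simp [mem_dI]

lemma dix_succ (n : ℤ) (x : ℝ) : dix n x = dix (n+1) x / 2 := by
  unfold dix
  have h : (2:ℝ) ^ n * x = ((2:ℝ)^(n+1) * x) / ((2:ℕ):ℝ) := by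
    rw [zpow_add₀ (by norm_num)]; push_cast; ring
  rw [h, Int.floor_div_natCast]; rfl

section
variable {E : Type*} [NormedAddCommGroup E] [NormedSpace ℝ E]

/-- Dyadic conditional expectation. -/
def Ed (n : ℤ) (f : ℝ → E) (x : ℝ) : E := ((2:ℝ) ^ n) • ∫ y in dI n (dix n x), f y

lemma Ed_const (n : ℤ) (f : ℝ → E) {x y : ℝ} (h : dix n x = dix n y) : Ed n f x = Ed n f y := by
  unfold Ed; rw [h]

lemma sm_of_dix (n : ℤ) {f : ℝ → E} (h : ∀ x y, dix n x = dix n y → f x = f y) :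
    StronglyMeasurable f := by
  have : f = (fun k : ℤ => f ((k:ℝ) * (2:ℝ)^(-n))) ∘ dix n := by
    ext x
    refine h _ _ ?_
    symm
    rw [← mem_dI]
    refine ⟨le_rfl, ?_⟩
    have : (0:ℝ) < 2^(-n) := by positivity
    nlinarith
  rw [this]
  exact StronglyMeasurable.of_discrete.comp_measurable (dix_meas n)

lemma Ed_sm (n : ℤ) (f : ℝ → E) : StronglyMeasurable (Ed n f) :=
  sm_of_dix n fun _ _ h => Ed_const n f h

lemma Ed_norm_le (n : ℤ) (f : ℝ → E) (x : ℝ) :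
    ‖Ed n f x‖ₑ ≤ ENNReal.ofReal ((2:ℝ)^n) * ∫⁻ y in dI n (dix n x), ‖f y‖ₑ := by
  unfold Ed
  rw [enorm_smul]
  gcongr
  · rw [Real.enorm_eq_ofReal (by positivity)]
  · exact enorm_integral_le_lintegral_enorm _

lemma Ed_lint_dI (n k : ℤ) (f : ℝ → E) :
    ∫⁻ x in dI n k, ‖Ed n f x‖ₑ ≤ ∫⁻ x in dI n k, ‖f x‖ₑ := by
  calc ∫⁻ x in dI n k, ‖Ed n f x‖ₑ 
      ≤ ∫⁻ x in dI n k, ENNReal.ofReal ((2:ℝ)^n) * ∫⁻ y in dI n k, ‖f y‖ₑ := by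
        refine setLIntegral_mono' (dI_meas n k) fun x hx => ?_
        have := Ed_norm_le n f x
        rwa [mem_dI.1 hx] at this
    _ = _ := by
        rw [setLIntegral_const, dI_vol, mul_right_comm, ← ofReal_mul (by positivity),
          ← zpow_add₀ (by norm_num)]
        simp

lemma lint_dI (n : ℤ) (f : ℝ → ℝ≥0∞) : ∫⁻ x, f x = ∑' k, ∫⁻ x in dI n k, f x := by
  rw [← lintegral_iUnion (dI_meas n) (dI_disj n), dI_union, setLIntegral_univ]

lemma Ed_lint (n : ℤ) (f : ℝ → E) : ∫⁻ x, ‖Ed n f x‖ₑ ≤ ∫⁻ x, ‖f x‖ₑ := by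
  rw [lint_dI n, lint_dI n (fun x => ‖f x‖ₑ)]
  exact ENNReal.tsum_le_tsum fun k => Ed_lint_dI n k f

lemma Ed_bound (n : ℤ) {f : ℝ → E} {C : ℝ} (h : ∀ x, ‖f x‖ ≤ C) (x : ℝ) : ‖Ed n f x‖ ≤ C := by
  unfold Ed
  rw [norm_smul, Real.norm_of_nonneg (by positivity)]
  have h1 := norm_setIntegral_le_of_norm_le_const (μ := volume) (s := dI n (dix n x)) (f := f)
    (C := C) (by rw [dI_vol]; simp) (fun x _ => h x)
  rw [dI_real] at h1
  calc (2:ℝ)^n * _ ≤ (2:ℝ)^n * (C * 2^(-n)) := by gcongr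
    _ = C * ((2:ℝ)^n * 2^(-n)) := by ring
    _ = C := by rw [← zpow_add₀ (by norm_num)]; simp

lemma Ed_nice (n : ℤ) {f : ℝ → E} (hf : Nice f) : Nice (Ed n f) := by
  obtain ⟨C, hC⟩ := hf.bdd
  refine ⟨Ed_sm n f, ⟨(Ed_sm n f).aestronglyMeasurable, ?_⟩, C, Ed_bound n hC⟩
  exact (Ed_lint n f).trans_lt hf.int.2
end

lemma Ed_pair (n : ℤ) {f φ : ℝ → ℂ} (hf : Nice f) (hφ : Nice φ)
    (hc : ∀ x y, dix n x = dix n y → φ x = φ y) :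
    ∫ x, φ x * Ed n f x = ∫ x, φ x * f x := by
  have hmul : ∀ {g : ℝ → ℂ}, Nice g → Integrable (fun x => φ x * g x) := by
    intro g hg
    obtain ⟨C, hC⟩ := hφ.bdd
    exact hg.int.bdd_mul hφ.sm.aestronglyMeasurable (Filter.Eventually.of_forall hC)
  have key : ∀ {g : ℝ → ℂ}, Nice g → ∫ x, φ x * g x = ∑' k, ∫ x in dI n k, φ x * g x := by
    intro g hg
    rw [← integral_iUnion (dI_meas n) (dI_disj n) (by rw [dI_union]; exact (hmul hg).integrableOn),
      dI_union, setIntegral_univ]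
  rw [key hf, key (Ed_nice n hf)]
  congr 1; ext k
  have hx0 : dix n ((k:ℝ) * (2:ℝ)^(-n)) = k := by
    rw [← mem_dI]
    refine ⟨le_rfl, ?_⟩
    have : (0:ℝ) < 2^(-n) := by positivity
    nlinarith
  set x0 := (k:ℝ) * (2:ℝ)^(-n)
  have e1 : ∫ x in dI n k, φ x * f x = φ x0 * ∫ x in dI n k, f x := by
    rw [← integral_const_mul]
    refine setIntegral_congr_fun (dI_meas n k) fun x hx => ?_
    simp only [hc x x0 (by rw [hx0]; exact mem_dI.1 hx)]
  have e2 : ∫ x in dI n k, φ x * Ed n f x = ∫ x in dI n k, φ x0 * ((2:ℝ)^n • ∫ x in dI n k, f x) := by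
    refine setIntegral_congr_fun (dI_meas n k) fun x hx => ?_
    simp only [hc x x0 (by rw [hx0]; exact mem_dI.1 hx), Ed, mem_dI.1 hx]
  rw [e1, e2, setIntegral_const, dI_real, mul_smul_comm, smul_smul, ← zpow_add₀ (by norm_num)]
  simp

variable {Ψ ψ : ℝ → ℂ} {A : ℝ}

/-- `(1 - E_n)` on a lower frequency piece. -/
lemma Ker.est1 (hk : Ker Ψ ψ A) {h : ℝ → ℂ} (hh : Nice h) (n j : ℤ) (hjn : j ≤ n) :
    ∫⁻ x, ‖cv (dil ψ j) h x - Ed n (cv (dil ψ j) h) x‖ₑ ^ 2 ≤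
      ENNReal.ofReal (12 * A ^ 2 * Real.pi ^ 2) * ENNReal.ofReal ((2:ℝ) ^ (j - n))
        * ∫⁻ x, ‖h x‖ₑ ^ 2 := by
  have hA := hk.A_pos
  set a : ℝ := (2:ℝ)^j with ha
  set d : ℝ := (2:ℝ)^(j-n) with hd
  have hap : 0 < a := by positivity
  have hdp : 0 < d := by positivity
  have hd1 : d ≤ 1 := zpow_le_one_of_nonpos₀ (by norm_num) (by omega)
  set u := cv (dil ψ j) h with hu
  have hun : Nice u := cv_nice (hk.dnice j) hh
  have hinteg : ∀ x, Integrable (fun z => 3 * A * d * (a * Phi (a * (x - z))) * ‖h z‖) := by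
    intro x
    refine hh.int.norm.bdd_mul (c := 3 * A * d * a) ?_ (Filter.Eventually.of_forall fun z => ?_)
    · have := Phi_cont
      exact Continuous.aestronglyMeasurable (by fun_prop)
    · have h1 := Phi_pos (a * (x-z))
      have h2 := Phi_le_one (a * (x-z))
      rw [Real.norm_of_nonneg (by positivity)]
      have : 3 * A * d * (a * Phi (a * (x - z))) = 3 * A * d * a * Phi (a * (x - z)) := by ring
      rw [this]
      exact mul_le_of_le_one_right (by positivity) h2
  have hdiff : ∀ x x', dix n x = dix n x' → ‖u x - u x'‖ ≤
      ∫ z, 3 * A * d * (a * Phi (a * (x - z))) * ‖h z‖ := by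
    intro x x' hxx
    rw [hu]; unfold cv
    rw [← integral_sub (cv_integrable (hk.dnice j) hh x) (cv_integrable (hk.dnice j) hh x')]
    refine norm_integral_le_of_norm_le (hinteg x) (Filter.Eventually.of_forall fun z => ?_)
    rw [← mul_sub, norm_mul, mul_comm]
    gcongr
    unfold dil
    rw [← ha, ← smul_sub, norm_smul, Real.norm_of_nonneg hap.le, norm_sub_rev]
    have hdist : |a * (x' - z) - a * (x - z)| ≤ d := by
      have h1 : x ∈ dI n (dix n x) := mem_dI.2 rfl
      have h2 : x' ∈ dI n (dix n x) := mem_dI.2 hxx.symm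
      have h3 : |x' - x| ≤ (2:ℝ)^(-n) := by
        rw [abs_le]; unfold dI at h1 h2
        constructor <;> nlinarith [h1.1, h1.2, h2.1, h2.2]
      have h4 : a * (x' - z) - a * (x - z) = a * (x' - x) := by ring
      have hd2 : d = a * (2:ℝ)^(-n) := by
        rw [hd, ha, ← zpow_add₀ (by norm_num)]; rfl
      rw [h4, abs_mul, abs_of_pos hap, hd2]
      gcongr
    have h5 := hk.near (a * (x - z)) (a * (x' - z)) (hdist.trans hd1)
    have h6 := Phi_pos (a * (x-z))
    calc a * _ ≤ a * (3 * A * Phi (a * (x - z)) * |a * (x' - z) - a * (x - z)|) := by gcongr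
      _ ≤ a * (3 * A * Phi (a * (x - z)) * d) := by gcongr
      _ = _ := by ring
  have hpt : ∀ x, ‖u x - Ed n u x‖ ≤ ∫ z, 3 * A * d * (a * Phi (a * (x - z))) * ‖h z‖ := by
    intro x
    have e1 : u x - Ed n u x = (2:ℝ)^n • ∫ y in dI n (dix n x), (u x - u y) := by
      have hc : Integrable (fun _ => u x) (volume.restrict (dI n (dix n x))) :=
        integrableOn_const (by rw [dI_vol]; simp)
      rw [integral_sub hc hun.int.integrableOn,
        setIntegral_const, dI_real, smul_sub, smul_smul, ← zpow_add₀ (by norm_num)]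
      simp [Ed]
    rw [e1, norm_smul, Real.norm_of_nonneg (by positivity)]
    have h1 := norm_setIntegral_le_of_norm_le_const (μ := volume) (s := dI n (dix n x))
      (f := fun y => u x - u y) (C := ∫ z, 3 * A * d * (a * Phi (a * (x - z))) * ‖h z‖)
      (by rw [dI_vol]; simp) (fun y hy => hdiff x y (mem_dI.1 hy).symm)
    rw [dI_real] at h1
    refine (mul_le_mul_of_nonneg_left h1 (by positivity)).trans (le_of_eq ?_)
    rw [mul_left_comm, ← zpow_add₀ (by norm_num)]; simp
  have hs := schur_two (e := fun x => u x - Ed n u x) (h := h)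
    (k := fun x z => ENNReal.ofReal (3 * A * d) * ENNReal.ofReal (a * Phi (a * (x - z))))
    (by have := Phi_cont; exact Measurable.const_mul (Continuous.measurable
          (ENNReal.continuous_ofReal.comp (by fun_prop))) _) hh.sm.measurable
    (ENNReal.ofReal (3 * A * d) * ENNReal.ofReal Real.pi) (ENNReal.ofReal (3 * A * d) * ENNReal.ofReal Real.pi)
    ?_ ?_ ?_
  · refine hs.trans (mul_le_mul' ?_ le_rfl)
    rw [← ofReal_mul (by positivity), ← ofReal_mul (by positivity), ← ofReal_mul (by positivity)]
    refine ofReal_le_ofReal ?_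
    have : 0 < A^2 * Real.pi ^2 := by positivity
    nlinarith [mul_nonneg this.le hdp.le, mul_nonneg (mul_nonneg this.le hdp.le) (sub_nonneg.2 hd1)]
  · intro x
    rw [← ofReal_norm]
    refine (ofReal_le_ofReal (hpt x)).trans ?_
    rw [ofReal_integral_eq_lintegral_ofReal (hinteg x) (Filter.Eventually.of_forall fun z => by
      have := Phi_pos (a * (x-z)); positivity)]
    refine lintegral_mono fun z => ?_
    have := Phi_pos (a * (x-z))
    rw [ofReal_mul (by positivity), ofReal_mul (by positivity), ofReal_norm]
  · intro x
    rw [lintegral_const_mul' _ _ (by simp), Phi_scale_shift' a x hap]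
  · intro x
    rw [lintegral_const_mul' _ _ (by simp), Phi_scale_shift a x hap]

end

section
variable {Ψ ψ : ℝ → ℂ} {A : ℝ}

lemma Ker.dil_int (hk : Ker Ψ ψ A) (j : ℤ) (a b z : ℝ) (hab : a ≤ b) :
    ∫ y in Set.Ico a b, dil ψ j (y - z) = Ψ ((2:ℝ)^j * (b - z)) - Ψ ((2:ℝ)^j * (a - z)) := by
  rw [integral_Ico_eq_integral_Ioc, ← intervalIntegral.integral_of_le hab]
  have hd : ∀ y, HasDerivAt (fun y => Ψ ((2:ℝ)^j * (y - z))) (dil ψ j (y - z)) y := by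
    intro y
    have h1 : HasDerivAt (fun y => (2:ℝ)^j * (y - z)) ((2:ℝ)^j) y := by
      simpa using ((hasDerivAt_id y).sub_const z).const_mul ((2:ℝ)^j)
    have := (hk.hΨ ((2:ℝ)^j * (y - z))).scomp y h1
    exact this
  refine intervalIntegral.integral_eq_sub_of_hasDerivAt (fun y _ => hd y) ?_
  have := dil_cont hk.cont j
  exact Continuous.intervalIntegrable (by fun_prop) _ _

lemma Ker.Ed_formula (hk : Ker Ψ ψ A) {h : ℝ → ℂ} (hh : Nice h) (n j : ℤ) (x : ℝ) :
    Ed n (cv (dil ψ j) h) x = (2:ℝ)^n • ∫ z, h z *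
      (Ψ ((2:ℝ)^j * (((dix n x:ℝ) + 1) * (2:ℝ)^(-n) - z)) - Ψ ((2:ℝ)^j * ((dix n x:ℝ) * (2:ℝ)^(-n) - z))) := by
  unfold Ed cv
  congr 1
  rw [integral_integral_swap]
  · congr 1; ext z
    rw [integral_const_mul]
    unfold dI
    rw [hk.dil_int j _ _ z (by
      have : (0:ℝ) < 2^(-n) := by positivity
      nlinarith)]
  · obtain ⟨C, hC⟩ := (hk.dnice j).bdd
    have hc : Integrable (fun _ => C) (volume.restrict (dI n (dix n x))) :=
        integrableOn_const (by rw [dI_vol]; simp)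
    have hm : Measurable (Function.uncurry fun y z => h z * dil ψ j (y - z)) := by
      have h1 := hh.sm.measurable
      have h2 := (dil_cont hk.cont j).measurable
      exact (h1.comp measurable_snd).mul (h2.comp (by fun_prop))
    refine (hc.mul_prod hh.int.norm).mono' hm.aestronglyMeasurable (Filter.Eventually.of_forall fun p => ?_)
    simp only [Function.uncurry, norm_mul]
    rw [mul_comm]
    gcongr
    exact hC _

lemma Phi_anti {u v : ℝ} (h : |u| ≤ |v|) : Phi v ≤ Phi u := by
  unfold Phi
  have : u^2 ≤ v^2 := sq_le_sq.2 h
  exact inv_anti₀ (by positivity) (by linarith)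

/-- `E_n` on a higher frequency piece. -/
lemma Ker.est2 (hk : Ker Ψ ψ A) {h : ℝ → ℂ} (hh : Nice h) (n j : ℤ) (hjn : n ≤ j) :
    ∫⁻ x, ‖Ed n (cv (dil ψ j) h) x‖ₑ ^ 2 ≤
      ENNReal.ofReal (12 * A ^ 2 * Real.pi ^ 2) * ENNReal.ofReal ((2:ℝ) ^ (n - j))
        * ∫⁻ x, ‖h x‖ₑ ^ 2 := by
  have hA := hk.A_pos
  set a : ℝ := (2:ℝ)^j with ha
  set c : ℝ := (2:ℝ)^n with hc
  set d : ℝ := (2:ℝ)^(n-j) with hd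
  have hap : 0 < a := by positivity
  have hcp : 0 < c := by positivity
  have hdp : 0 < d := by positivity
  have hcd : c = d * a := by rw [hc, hd, ha, ← zpow_add₀ (by norm_num)]; congr 1; ring
  have hca : c ≤ a := by rw [ha, hc]; gcongr; norm_num
  set r : ℝ → ℝ := fun x => ((dix n x:ℝ) + 1) * (2:ℝ)^(-n) with hr
  set l : ℝ → ℝ := fun x => (dix n x:ℝ) * (2:ℝ)^(-n) with hl
  have hrm : Measurable r := by have := dix_meas n; fun_prop
  have hlm : Measurable l := by have := dix_meas n; fun_prop
  have hPm := Phi_cont.measurable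
  have hc1 : c * (2:ℝ)^(-n) = 1 := by rw [hc, ← zpow_add₀ (by norm_num)]; simp
  have hcomp : ∀ (w x z : ℝ), |x - w| ≤ (2:ℝ)^(-n) → Phi (a * (w - z)) ≤ 3 * Phi (c * (x - z)) := by
    intro w x z hw
    have h1 : Phi (a * (w - z)) ≤ Phi (c * (w - z)) := by
      apply Phi_anti
      rw [abs_mul, abs_mul, abs_of_pos hap, abs_of_pos hcp]
      gcongr
    refine h1.trans (Phi_near _ _ ?_)
    have : c * (w - z) - c * (x - z) = - (c * (x - w)) := by ring
    rw [this, abs_neg, abs_mul, abs_of_pos hcp, ← hc1]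
    gcongr
  have hs := schur_two (e := Ed n (cv (dil ψ j) h)) (h := h)
    (k := fun x z => ENNReal.ofReal (A * d) * (ENNReal.ofReal (a * Phi (a * (r x - z))) +
      ENNReal.ofReal (a * Phi (a * (l x - z)))))
    (by unfold Function.uncurry; fun_prop) hh.sm.measurable
    (ENNReal.ofReal (A * d) * (ENNReal.ofReal Real.pi + ENNReal.ofReal Real.pi))
    (ENNReal.ofReal (6 * A) * ENNReal.ofReal Real.pi)
    ?_ ?_ ?_
  · refine hs.trans (mul_le_mul' ?_ le_rfl)
    rw [← ofReal_add (by positivity) (by positivity), ← ofReal_mul (by positivity),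
      ← ofReal_mul (by positivity), ← ofReal_mul (by positivity), ← ofReal_mul (by positivity)]
    refine ofReal_le_ofReal (le_of_eq ?_)
    ring
  · intro x
    rw [hk.Ed_formula hh, enorm_smul, Real.enorm_eq_ofReal (by positivity)]
    refine (mul_le_mul' le_rfl (enorm_integral_le_lintegral_enorm _)).trans ?_
    rw [← lintegral_const_mul' _ _ (by simp)]
    refine lintegral_mono fun z => ?_
    simp only
    rw [enorm_mul, mul_comm ‖h z‖ₑ, ← mul_assoc]
    refine mul_le_mul' ?_ le_rfl
    rw [← ofReal_norm, ← ofReal_mul (by positivity)]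
    have p1 := Phi_pos (a * (r x - z))
    have p2 := Phi_pos (a * (l x - z))
    rw [← ofReal_add (by positivity) (by positivity), ← ofReal_mul (by positivity)]
    refine ofReal_le_ofReal ?_
    have h1 := (hk.bΨ (a * (r x - z))).trans (mul_le_mul_of_nonneg_left (Phi_sq_le _) hA.le)
    have h2 := (hk.bΨ (a * (l x - z))).trans (mul_le_mul_of_nonneg_left (Phi_sq_le _) hA.le)
    calc c * _ ≤ c * (A * Phi (a * (r x - z)) + A * Phi (a * (l x - z))) := by
          gcongr
          exact (norm_sub_le _ _).trans (add_le_add h1 h2)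
      _ = _ := by rw [hcd]; ring
  · intro x
    rw [lintegral_const_mul _ (by fun_prop), lintegral_add_left (by fun_prop),
      Phi_scale_shift' a _ hap, Phi_scale_shift' a _ hap]
  · intro z
    calc _ ≤ ∫⁻ x, ENNReal.ofReal (6 * A) * ENNReal.ofReal (c * Phi (c * (x - z))) := by
          refine lintegral_mono fun x => ?_
          have p1 := Phi_pos (a * (r x - z))
          have p2 := Phi_pos (a * (l x - z))
          simp only
          rw [← ofReal_add (by positivity) (by positivity), ← ofReal_mul (by positivity),
            ← ofReal_mul (by positivity)]
          refine ofReal_le_ofReal ?_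
          have hx : x ∈ dI n (dix n x) := mem_dI.2 rfl
          unfold dI at hx
          have h1 := hcomp (r x) x z (by
            simp only [hr]; rw [abs_le]; constructor <;> nlinarith [hx.1, hx.2])
          have h2 := hcomp (l x) x z (by
            simp only [hl]; rw [abs_le]; constructor <;> nlinarith [hx.1, hx.2])
          calc _ = A * c * (Phi (a * (r x - z)) + Phi (a * (l x - z))) := by rw [hcd]; ring
            _ ≤ A * c * (3 * Phi (c * (x - z)) + 3 * Phi (c * (x - z))) := by gcongr
            _ = _ := by ring
      _ = _ := by rw [lintegral_const_mul _ (by fun_prop), Phi_scale_shift c z hcp]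

end

section
variable {Ψ ψ : ℝ → ℂ} {A : ℝ}

/-- squared `L²` norm -/
def Qn (f : ℝ → ℂ) : ℝ≥0∞ := ∫⁻ x, ‖f x‖ₑ ^ 2

lemma enorm_sq_eq (z : ℂ) : ‖z‖ₑ ^ 2 = ENNReal.ofReal (‖z‖ ^ 2) := by
  rw [← ofReal_norm, ofReal_pow (norm_nonneg _)]

/-- weights -/
def wt (m : ℤ) : ℝ := ((2:ℝ) ^ (-(1/2:ℝ))) ^ m.natAbs

lemma wt_pos (m : ℤ) : 0 < wt m := by unfold wt; positivity
lemma wt_sq (m : ℤ) : wt m * wt m = ((2:ℝ)⁻¹) ^ m.natAbs := by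
  unfold wt
  rw [← mul_pow, ← Real.rpow_add (by norm_num)]
  norm_num

/-- total weight -/
def Wt : ℝ≥0∞ := ∑' m : ℤ, ENNReal.ofReal (wt m)

lemma Wt_ne_top : Wt ≠ ⊤ := by
  have := (geo_int_summable (1/2) (by norm_num)).tsum_ofReal_ne_top
  exact this

lemma wt_sum1 (n : ℤ) (L : ℕ) : ∑ j ∈ Finset.range L, ENNReal.ofReal (wt (n - j)) ≤ Wt := by
  refine (ENNReal.sum_le_tsum (Finset.range L)).trans ?_
  exact ENNReal.tsum_comp_le_tsum_of_injective (f := fun j : ℕ => n - (j:ℤ))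
    (fun a b h => by simpa using h) (fun m => ENNReal.ofReal (wt m))

lemma wt_sum2 (j : ℤ) (L : ℕ) : ∑ n ∈ Finset.range L, ENNReal.ofReal (wt (n - j)) ≤ Wt := by
  refine (ENNReal.sum_le_tsum (Finset.range L)).trans ?_
  exact ENNReal.tsum_comp_le_tsum_of_injective (f := fun n : ℕ => (n:ℤ) - j)
    (fun a b h => by simpa using h) (fun m => ENNReal.ofReal (wt m))

lemma cs_wt (a : ℕ → ℂ) (n : ℤ) (L : ℕ) :
    ‖∑ j ∈ Finset.range L, a j‖ₑ ^ 2 ≤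
      Wt * ∑ j ∈ Finset.range L, ENNReal.ofReal ((wt (n - j))⁻¹) * ‖a j‖ₑ ^ 2 := by
  have h1 : ‖∑ j ∈ Finset.range L, a j‖ ^ 2 ≤ (∑ j ∈ Finset.range L, wt (n - j)) *
      ∑ j ∈ Finset.range L, (wt (n-j))⁻¹ * ‖a j‖^2 := by
    refine (pow_le_pow_left₀ (norm_nonneg _) (norm_sum_le _ _) 2).trans ?_
    refine Finset.sum_sq_le_sum_mul_sum_of_sq_le_mul _ (fun j _ => (wt_pos _).le)
      (fun j _ => by have := wt_pos (n - j); positivity) (fun j _ => ?_)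
    have := wt_pos (n-j)
    refine le_of_eq ?_
    field_simp
  rw [enorm_sq_eq]
  refine (ofReal_le_ofReal h1).trans ?_
  rw [ofReal_mul (Finset.sum_nonneg fun j _ => (wt_pos _).le),
    ofReal_sum_of_nonneg (fun j _ => (wt_pos _).le),
    ofReal_sum_of_nonneg (fun j _ => by have := wt_pos (n - j); positivity)]
  refine mul_le_mul' (wt_sum1 n L) (le_of_eq (Finset.sum_congr rfl fun j _ => ?_))
  rw [ofReal_mul (by have := wt_pos (n - j); positivity), enorm_sq_eq]

lemma Ed_add (n : ℤ) {f g : ℝ → ℂ} (hf : Nice f) (hg : Nice g) (x : ℝ) :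
    Ed n (fun y => f y + g y) x = Ed n f x + Ed n g x := by
  unfold Ed
  rw [integral_add hf.int.integrableOn hg.int.integrableOn, smul_add]

lemma Ed_sum (n : ℤ) {f : ℕ → ℝ → ℂ} (hf : ∀ j, Nice (f j)) (L : ℕ) (x : ℝ) :
    Ed n (fun y => ∑ j ∈ Finset.range L, f j y) x = ∑ j ∈ Finset.range L, Ed n (f j) x := by
  unfold Ed
  rw [integral_finsetSum _ (fun j _ => (hf j).int.integrableOn), Finset.smul_sum]

/-- the pieces -/
def uu (ψ : ℝ → ℂ) (j0 : ℤ) (h : ℕ → ℝ → ℂ) (j : ℕ) : ℝ → ℂ := cv (dil ψ (j0 + j)) (h j)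
/-- partial sums -/
def SS (ψ : ℝ → ℂ) (j0 : ℤ) (h : ℕ → ℝ → ℂ) (n : ℕ) (x : ℝ) : ℂ :=
  ∑ j ∈ Finset.range n, uu ψ j0 h j x
/-- martingale -/
def XX (ψ : ℝ → ℂ) (j0 : ℤ) (h : ℕ → ℝ → ℂ) (L n : ℕ) : ℝ → ℂ := Ed (j0 + n) (SS ψ j0 h L)
/-- error -/
def er (ψ : ℝ → ℂ) (j0 : ℤ) (h : ℕ → ℝ → ℂ) (L n : ℕ) (x : ℝ) : ℂ :=
  XX ψ j0 h L n x - SS ψ j0 h n x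

variable {j0 : ℤ} {h : ℕ → ℝ → ℂ}
lemma Ker.uu_nice (hk : Ker Ψ ψ A) (hh : ∀ j, Nice (h j)) (j : ℕ) : Nice (uu ψ j0 h j) :=
  cv_nice (hk.dnice _) (hh j)
lemma Ker.SS_nice (hk : Ker Ψ ψ A) (hh : ∀ j, Nice (h j)) (n : ℕ) : Nice (SS ψ j0 h n) :=
  Nice.sum _ (fun j => hk.uu_nice hh j)
lemma Ker.XX_nice (hk : Ker Ψ ψ A) (hh : ∀ j, Nice (h j)) (L n : ℕ) : Nice (XX ψ j0 h L n) :=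
  Ed_nice _ (hk.SS_nice hh L)
lemma Ker.er_nice (hk : Ker Ψ ψ A) (hh : ∀ j, Nice (h j)) (L n : ℕ) : Nice (er ψ j0 h L n) :=
  (hk.XX_nice hh L n).sub (hk.SS_nice hh n)

/-- the constant -/
def DD (A : ℝ) : ℝ≥0∞ := ENNReal.ofReal (12 * A ^ 2 * Real.pi ^ 2)

lemma Ker.e_bound (hk : Ker Ψ ψ A) (hh : ∀ j, Nice (h j)) (n j : ℕ) :
    ∫⁻ x, ‖Ed (j0 + n) (uu ψ j0 h j) x - (if j < n then uu ψ j0 h j x else 0)‖ₑ ^ 2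
      ≤ DD A * ENNReal.ofReal (wt ((n:ℤ) - j) * wt ((n:ℤ) - j)) * Qn (h j) := by
  rw [wt_sq]
  split_ifs with hjn
  · have := hk.est1 (hh j) (j0 + n) (j0 + j) (by omega)
    simp_rw [enorm_sub_rev (Ed _ _ _)]
    refine this.trans (le_of_eq ?_)
    have e : ((2:ℝ) ^ (j0 + (j:ℤ) - (j0 + (n:ℤ)))) = (2⁻¹)^ ((n:ℤ)-j).natAbs := by
      rw [inv_pow, ← zpow_natCast, ← zpow_neg]; congr 1; omega
    rw [e]; rfl
  · have := hk.est2 (hh j) (j0 + n) (j0 + j) (by omega)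
    simp_rw [sub_zero]
    refine this.trans (le_of_eq ?_)
    have e : ((2:ℝ) ^ (j0 + (n:ℤ) - (j0 + (j:ℤ)))) = (2⁻¹)^ ((n:ℤ)-j).natAbs := by
      rw [inv_pow, ← zpow_natCast, ← zpow_neg]; congr 1; omega
    rw [e]; rfl

lemma Ker.er_eq (hk : Ker Ψ ψ A) (hh : ∀ j, Nice (h j)) (L n : ℕ) (hn : n ≤ L) (x : ℝ) :
    er ψ j0 h L n x = ∑ j ∈ Finset.range L,
      (Ed (j0 + n) (uu ψ j0 h j) x - (if j < n then uu ψ j0 h j x else 0)) := by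
  rw [Finset.sum_sub_distrib, ← Ed_sum _ (hk.uu_nice hh)]
  unfold er XX SS
  congr 1
  rw [← Finset.sum_filter]
  refine Finset.sum_congr ?_ fun _ _ => rfl
  ext j; simp; omega

lemma Ker.er_bound (hk : Ker Ψ ψ A) (hh : ∀ j, Nice (h j)) (L : ℕ) :
    ∑ n ∈ Finset.range (L+1), Qn (er ψ j0 h L n) ≤
      Wt * Wt * DD A * ∑ j ∈ Finset.range L, Qn (h j) := by
  have h1 : ∀ n ∈ Finset.range (L+1), Qn (er ψ j0 h L n) ≤
      Wt * ∑ j ∈ Finset.range L, ENNReal.ofReal (wt ((n:ℤ) - j)) * DD A * Qn (h j) := by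
    intro n hn
    have hnL : n ≤ L := by simp at hn; omega
    have hm : ∀ j, Measurable fun x => ‖Ed (j0 + n) (uu ψ j0 h j) x - (if j < n then uu ψ j0 h j x else 0)‖ₑ ^ 2 := by
      intro j
      have a1 := (Ed_sm (j0 + n) (uu ψ j0 h j)).measurable
      have a2 := (hk.uu_nice hh j (j0 := j0)).sm.measurable
      split_ifs <;> fun_prop
    calc Qn (er ψ j0 h L n) ≤ ∫⁻ x, Wt * ∑ j ∈ Finset.range L, ENNReal.ofReal ((wt ((n:ℤ) - j))⁻¹) *
          ‖Ed (j0 + n) (uu ψ j0 h j) x - (if j < n then uu ψ j0 h j x else 0)‖ₑ ^ 2 := by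
          refine lintegral_mono fun x => ?_
          rw [hk.er_eq hh L n hnL x]
          exact cs_wt _ n L
      _ = Wt * ∑ j ∈ Finset.range L, ENNReal.ofReal ((wt ((n:ℤ) - j))⁻¹) *
          ∫⁻ x, ‖Ed (j0 + n) (uu ψ j0 h j) x - (if j < n then uu ψ j0 h j x else 0)‖ₑ ^ 2 := by
          rw [lintegral_const_mul _ (Finset.measurable_fun_sum _ fun j _ => (hm j).const_mul _),
            lintegral_finsetSum _ (fun j _ => (hm j).const_mul _)]
          congr 1
          refine Finset.sum_congr rfl fun j _ => ?_
          rw [lintegral_const_mul _ (hm j)]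
      _ ≤ _ := by
          refine mul_le_mul' le_rfl (Finset.sum_le_sum fun j hj => ?_)
          refine (mul_le_mul' le_rfl (hk.e_bound hh n j)).trans (le_of_eq ?_)
          have := wt_pos ((n:ℤ) - j)
          rw [ofReal_mul this.le, ← mul_assoc, ← mul_assoc, mul_right_comm _ (DD A), ← mul_assoc,
            ← ofReal_mul (by positivity), inv_mul_cancel₀ this.ne', ofReal_one, one_mul]
  refine (Finset.sum_le_sum h1).trans ?_
  rw [← Finset.mul_sum, Finset.sum_comm, mul_assoc, mul_assoc]
  gcongr
  rw [Finset.mul_sum, Finset.mul_sum]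
  gcongr with j hj
  rw [← Finset.sum_mul, ← Finset.sum_mul, mul_assoc]
  gcongr
  exact wt_sum2 j (L+1)

lemma enorm_add_sq_le (a b : ℂ) : ‖a + b‖ₑ ^ 2 ≤ 2 * (‖a‖ₑ ^ 2 + ‖b‖ₑ ^ 2) := by
  rw [enorm_sq_eq, enorm_sq_eq, enorm_sq_eq, ← ofReal_add (by positivity) (by positivity),
    ← ofReal_ofNat 2, ← ofReal_mul (by positivity)]
  refine ofReal_le_ofReal ?_
  have := norm_add_le a b
  have h2 := norm_nonneg (a+b)
  nlinarith [sq_nonneg (‖a‖ - ‖b‖)]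

lemma Qn_add_le {f g : ℝ → ℂ} (hf : Nice f) (hg : Nice g) :
    Qn (fun x => f x + g x) ≤ 2 * (Qn f + Qn g) := by
  unfold Qn
  have h1 := hf.sm.measurable
  rw [← lintegral_add_left (by fun_prop), ← lintegral_const_mul' _ _ (by simp)]
  exact lintegral_mono fun x => enorm_add_sq_le _ _

lemma Qn_neg {f : ℝ → ℂ} : Qn (fun x => - f x) = Qn f := by simp [Qn]

lemma Ker.uu_bound (hk : Ker Ψ ψ A) (hh : ∀ j, Nice (h j)) (j : ℕ) :
    Qn (uu ψ j0 h j) ≤ 4 * DD A * Qn (h j) := by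
  have hu : Nice (uu ψ j0 h j) := hk.uu_nice hh j
  have hE := Ed_nice (j0 + j) hu
  have h1 := hk.est1 (hh j) (j0 + j) (j0 + j) le_rfl
  have h2 := hk.est2 (hh j) (j0 + j) (j0 + j) le_rfl
  have h3 := Qn_add_le (hu.sub hE) hE
  simp only [sub_add_cancel] at h3
  refine h3.trans ?_
  simp only [sub_self, zpow_zero, ofReal_one, mul_one] at h1 h2
  calc _ ≤ 2 * (DD A * Qn (h j) + DD A * Qn (h j)) := by gcongr <;> assumption
    _ = _ := by ring

end

section
variable {Ψ ψ : ℝ → ℂ} {A : ℝ} {j0 : ℤ} {h : ℕ → ℝ → ℂ}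

lemma Nice.mul {f g : ℝ → ℂ} (hf : Nice f) (hg : Nice g) : Integrable (fun x => f x * g x) := by
  obtain ⟨C, hC⟩ := hf.bdd
  exact hg.int.bdd_mul hf.sm.aestronglyMeasurable (Filter.Eventually.of_forall hC)

lemma Nice.conj {f : ℝ → ℂ} (hf : Nice f) : Nice (fun x => (starRingEnd ℂ) (f x)) :=
  hf.mono (Complex.continuous_conj.comp_stronglyMeasurable hf.sm) (fun x => by simp)

lemma Nice.sq_int {f : ℝ → ℂ} (hf : Nice f) : Integrable (fun x => ‖f x‖ ^ 2) := by
  have := (hf.mul hf).norm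
  simpa [sq] using this

lemma Nice.Qn_eq {f : ℝ → ℂ} (hf : Nice f) : Qn f = ENNReal.ofReal (∫ x, ‖f x‖ ^ 2) := by
  rw [ofReal_integral_eq_lintegral_ofReal hf.sq_int (Filter.Eventually.of_forall fun x => by positivity)]
  unfold Qn
  simp_rw [enorm_sq_eq]

lemma Qn_orth {f g : ℝ → ℂ} (hf : Nice f) (hg : Nice g)
    (ho : ∫ x, (starRingEnd ℂ) (f x) * g x = 0) :
    Qn (fun x => f x + g x) = Qn f + Qn g := by
  rw [hf.Qn_eq, hg.Qn_eq, (hf.add hg).Qn_eq, ← ofReal_add (integral_nonneg fun x => by positivity)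
    (integral_nonneg fun x => by positivity)]
  congr 1
  have hi := hf.conj.mul hg
  have e : ∀ x, ‖f x + g x‖ ^ 2 = ‖f x‖^2 + ‖g x‖^2 + 2 * ((starRingEnd ℂ) (f x) * g x).re := by
    intro x
    rw [Complex.sq_norm, Complex.sq_norm, Complex.sq_norm]
    simp [Complex.normSq_apply]; ring
  simp_rw [e]
  have h3 : ∫ x, ((starRingEnd ℂ) (f x) * g x).re = 0 := by
    have := integral_re hi
    simp only [RCLike.re_eq_complex_re] at this
    rw [this, ho]; simp
  have i1 : Integrable (fun x => ‖f x‖ ^ 2 + ‖g x‖ ^ 2) := hf.sq_int.add hg.sq_int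
  have i2 : Integrable (fun x => 2 * ((starRingEnd ℂ) (f x) * g x).re) := by
    have := hi.re
    simp only [RCLike.re_eq_complex_re] at this
    exact this.const_mul 2
  rw [integral_add i1 i2, integral_add hf.sq_int hg.sq_int, integral_const_mul, h3]
  ring

/-- Greedy approximation of the martingale. -/
def RR (X : ℕ → ℝ → ℂ) (l : ℝ) : ℕ → ℝ → ℂ
  | 0 => X 0
  | n + 1 => fun x => if l < ‖X (n+1) x - RR X l n x‖ then X (n+1) x else RR X l n x

lemma RR_near (X : ℕ → ℝ → ℂ) {l : ℝ} (hl : 0 < l) (n : ℕ) (x : ℝ) : ‖X n x - RR X l n x‖ ≤ l := by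
  cases n with
  | zero => simp [RR, hl.le]
  | succ n =>
    simp only [RR]
    split_ifs with h1
    · simp [hl.le]
    · exact not_lt.1 h1

lemma RR_jump (X : ℕ → ℝ → ℂ) {l : ℝ} (n : ℕ) (x : ℝ)
    (hne : RR X l (n+1) x ≠ RR X l n x) : l < ‖RR X l (n+1) x - RR X l n x‖ := by
  simp only [RR] at hne ⊢
  split_ifs with h1
  · exact h1
  · simp [h1] at hne

lemma RR_dix (j0 : ℤ) {X : ℕ → ℝ → ℂ} {l : ℝ}
    (hX : ∀ n x y, dix (j0 + (n:ℕ)) x = dix (j0 + n) y → X n x = X n y) :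
    ∀ (n : ℕ) (x y : ℝ), dix (j0 + n) x = dix (j0 + n) y → RR X l n x = RR X l n y := by
  intro n
  induction n with
  | zero => exact hX 0
  | succ n ih =>
    intro x y hxy
    have h1 := hX (n+1) x y hxy
    have h2 := ih x y (by
      rw [dix_succ, dix_succ _ y]
      push_cast at hxy
      rw [add_assoc, hxy])
    simp only [RR, h1, h2]

lemma RR_nice {X : ℕ → ℝ → ℂ} (hX : ∀ n, Nice (X n)) (l : ℝ) (n : ℕ) : Nice (RR X l n) := by
  induction n with
  | zero => exact hX 0
  | succ n ih =>
    have hm : MeasurableSet {x | l < ‖X (n+1) x - RR X l n x‖} :=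
      measurableSet_lt measurable_const (((hX (n+1)).sub ih).sm.norm.measurable)
    have := ((hX (n+1)).indicator hm).add (ih.indicator hm.compl)
    convert this using 2 with x
    simp only [RR, Set.indicator]
    by_cases h1 : l < ‖X (n+1) x - RR X l n x‖ <;> simp [h1]

lemma mart_bound (j0 : ℤ) {T : ℝ → ℂ} (hT : Nice T) (l : ℝ) (m : ℕ) :
    let X : ℕ → ℝ → ℂ := fun n => Ed (j0 + n) T
    ∑ n ∈ Finset.range m, Qn (fun x => RR X l (n+1) x - RR X l n x) +
      Qn (fun x => X m x - RR X l m x) ≤ ∑ n ∈ Finset.range m, Qn (fun x => X (n+1) x - X n x) := by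
  intro X
  have hX : ∀ n, Nice (X n) := fun n => Ed_nice _ hT
  have hXd : ∀ n x y, dix (j0 + (n:ℕ)) x = dix (j0 + n) y → X n x = X n y :=
    fun n x y hxy => Ed_const _ _ hxy
  have hR := RR_nice hX l
  induction m with
  | zero => simp [RR, Qn]
  | succ m ih =>
    rw [Finset.sum_range_succ, Finset.sum_range_succ, add_assoc]
    have h1 : Qn (fun x => RR X l (m+1) x - RR X l m x) + Qn (fun x => X (m+1) x - RR X l (m+1) x)
        ≤ Qn (fun x => X (m+1) x - RR X l m x) := by
      unfold Qn
      rw [← lintegral_add_left (((hR (m+1)).sub (hR m)).sm.measurable.enorm.pow_const 2)]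
      refine lintegral_mono fun x => ?_
      simp only [RR]
      split_ifs <;> simp
    have ho : ∫ x, (starRingEnd ℂ) (X m x - RR X l m x) * (X (m+1) x - X m x) = 0 := by
      have hφ := ((hX m).sub (hR m)).conj
      have hc0 : ∀ x y, dix (j0 + m) x = dix (j0 + m) y →
          (starRingEnd ℂ) (X m x - RR X l m x) = (starRingEnd ℂ) (X m y - RR X l m y) := by
        intro x y hxy
        rw [hXd m x y hxy, RR_dix j0 hXd m x y hxy]
      have hc1 : ∀ x y, dix (j0 + (m+1:ℕ)) x = dix (j0 + (m+1:ℕ)) y →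
          (starRingEnd ℂ) (X m x - RR X l m x) = (starRingEnd ℂ) (X m y - RR X l m y) := by
        intro x y hxy
        apply hc0
        rw [dix_succ, dix_succ _ y]
        push_cast at hxy
        rw [add_assoc, hxy]
      have e1 := Ed_pair (j0 + (m+1:ℕ)) hT hφ hc1
      have e2 := Ed_pair (j0 + m) hT hφ hc0
      simp_rw [mul_sub]
      rw [integral_sub (hφ.mul (hX (m+1))) (hφ.mul (hX m)), sub_eq_zero]
      exact e1.trans e2.symm
    have h2 := Qn_orth ((hX m).sub (hR m)) ((hX (m+1)).sub (hX m)) ho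
    have h3 : (fun x => X m x - RR X l m x + (X (m+1) x - X m x)) = fun x => X (m+1) x - RR X l m x := by
      ext x; ring
    rw [h3] at h2
    calc _ ≤ ∑ n ∈ Finset.range m, Qn (fun x => RR X l (n+1) x - RR X l n x) +
          Qn (fun x => X (m+1) x - RR X l m x) := by gcongr
      _ ≤ _ := by rw [h2, ← add_assoc]; gcongr

/-- Disjoint blocks. -/
lemma block_sum (a : ℕ → ℝ≥0∞) (n : ℕ → ℕ) (hn : Monotone n) (L K : ℕ) (hL : ∀ k, n k ≤ L) :
    ∑ k ∈ Finset.range K, ∑ i ∈ Finset.Ico (n k) (n (k+1)), a i ≤ ∑ i ∈ Finset.range L, a i := by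
  have e : ∑ k ∈ Finset.range K, ∑ i ∈ Finset.Ico (n k) (n (k+1)), a i = ∑ i ∈ Finset.Ico (n 0) (n K), a i := by
    induction K with
    | zero => simp
    | succ K ih => rw [Finset.sum_range_succ, ih, Finset.sum_Ico_consecutive _ (hn (by omega)) (hn (by omega))]
  rw [e]
  refine Finset.sum_le_sum_of_subset fun i hi => ?_
  have := hL K
  simp at hi ⊢; omega

lemma Ker.X_diff (hk : Ker Ψ ψ A) (hh : ∀ j, Nice (h j)) (L : ℕ) :
    ∑ n ∈ Finset.range L, Qn (fun x => XX ψ j0 h L (n+1) x - XX ψ j0 h L n x) ≤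
      (8 * (Wt * Wt * DD A) + 2 * (4 * DD A)) * ∑ j ∈ Finset.range L, Qn (h j) := by
  have h1 : ∀ n, Qn (fun x => XX ψ j0 h L (n+1) x - XX ψ j0 h L n x) ≤
      2 * (2 * (Qn (er ψ j0 h L (n+1)) + Qn (er ψ j0 h L n)) + Qn (uu ψ j0 h n)) := by
    intro n
    have e : (fun x => XX ψ j0 h L (n+1) x - XX ψ j0 h L n x) =
        fun x => (er ψ j0 h L (n+1) x + - er ψ j0 h L n x) + uu ψ j0 h n x := by
      ext x
      unfold er
      have : SS ψ j0 h (n+1) x = SS ψ j0 h n x + uu ψ j0 h n x := by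
        unfold SS; rw [Finset.sum_range_succ]
      rw [this]; ring
    have n1 := hk.er_nice hh L (n+1) (j0 := j0)
    have n2 : Nice fun x => - er ψ j0 h L n x := by
      simpa using (Nice.zero (E := ℂ)).sub (hk.er_nice hh L n (j0 := j0))
    rw [e]
    refine (Qn_add_le (n1.add n2) (hk.uu_nice hh n)).trans ?_
    gcongr
    refine (Qn_add_le n1 n2).trans ?_
    rw [Qn_neg]
  refine (Finset.sum_le_sum fun n _ => h1 n).trans ?_
  rw [← Finset.mul_sum, Finset.sum_add_distrib, ← Finset.mul_sum, Finset.sum_add_distrib]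
  have h2 := hk.er_bound hh L (j0 := j0)
  have h3 : ∑ n ∈ Finset.range L, Qn (er ψ j0 h L (n+1)) ≤ ∑ n ∈ Finset.range (L+1), Qn (er ψ j0 h L n) := by
    rw [Finset.sum_range_succ']; exact le_self_add
  have h4 : ∑ n ∈ Finset.range L, Qn (er ψ j0 h L n) ≤ ∑ n ∈ Finset.range (L+1), Qn (er ψ j0 h L n) := by
    rw [Finset.sum_range_succ]; exact le_self_add
  have h5 : ∑ n ∈ Finset.range L, Qn (uu ψ j0 h n) ≤ 4 * DD A * ∑ j ∈ Finset.range L, Qn (h j) := by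
    rw [Finset.mul_sum]
    exact Finset.sum_le_sum fun j _ => hk.uu_bound hh j
  set Z := ∑ j ∈ Finset.range L, Qn (h j)
  calc _ ≤ 2 * (2 * (Wt * Wt * DD A * Z + Wt * Wt * DD A * Z) + 4 * DD A * Z) := by
        gcongr
        · exact h3.trans h2
        · exact h4.trans h2
    _ = _ := by ring


/-- local mass -/
def am (ψ : ℝ → ℂ) (j0 : ℤ) (h : ℕ → ℝ → ℂ) (L : ℕ) (l : ℝ) (i : ℕ) (x : ℝ) : ℝ≥0∞ :=
  ‖RR (XX ψ j0 h L) (l/8) (i+1) x - RR (XX ψ j0 h L) (l/8) i x‖ₑ ^ 2 + ‖er ψ j0 h L i x‖ₑ ^ 2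
    + ‖er ψ j0 h L (i+1) x‖ₑ ^ 2

lemma le_sq_enorm {l : ℝ} (hl : 0 < l) {z : ℂ} (hz : l / 8 ≤ ‖z‖) : ENNReal.ofReal (l^2/64) ≤ ‖z‖ₑ ^ 2 := by
  rw [enorm_sq_eq]
  refine ofReal_le_ofReal ?_
  nlinarith

lemma jump_pt (L : ℕ) {l : ℝ} (hl : 0 < l) (x : ℝ) (a b : ℕ) (hab : a ≤ b)
    (hj : l / 2 < ‖SS ψ j0 h b x - SS ψ j0 h a x‖) :
    ∃ i ∈ Finset.Ico a b, ENNReal.ofReal (l^2/64) ≤ am ψ j0 h L l i x := by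
  have hlt : a < b := by
    rcases hab.lt_or_eq with h1 | rfl
    · exact h1
    · simp at hj; linarith
  by_cases c1 : l / 8 ≤ ‖er ψ j0 h L a x‖
  · refine ⟨a, by simp [hlt], (le_sq_enorm hl c1).trans ?_⟩
    unfold am
    exact le_add_self.trans le_self_add
  by_cases c2 : l / 8 ≤ ‖er ψ j0 h L b x‖
  · obtain ⟨b, rfl⟩ : ∃ b', b = b' + 1 := ⟨b - 1, by omega⟩
    refine ⟨b, by simp; omega, (le_sq_enorm hl c2).trans ?_⟩
    unfold am
    exact le_add_self
  by_contra hcon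
  push Not at hcon c1 c2
  set R := RR (XX ψ j0 h L) (l/8) with hR
  have hconst : ∀ m, a ≤ m → m ≤ b → R m x = R a x := by
    intro m ham
    induction m, ham using Nat.le_induction with
    | base => simp
    | succ m ham ih =>
      intro hmb
      rw [← ih (by omega)]
      by_contra hne
      have h1 := RR_jump (XX ψ j0 h L) m x hne
      have h2 := hcon m (by simp; omega)
      refine absurd h2 (not_lt.2 ((le_sq_enorm hl h1.le).trans ?_))
      unfold am
      rw [add_assoc]; exact le_self_add
  have h1 := RR_near (XX ψ j0 h L) (l := l/8) (by positivity) a x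
  have h2 := RR_near (XX ψ j0 h L) (l := l/8) (by positivity) b x
  rw [← hR] at h1 h2
  rw [hconst b hab le_rfl] at h2
  have e : SS ψ j0 h b x - SS ψ j0 h a x = (XX ψ j0 h L b x - R a x) - (XX ψ j0 h L a x - R a x)
      - er ψ j0 h L b x + er ψ j0 h L a x := by unfold er; ring
  have h3 : ‖SS ψ j0 h b x - SS ψ j0 h a x‖ ≤ ‖XX ψ j0 h L b x - R a x‖ + ‖XX ψ j0 h L a x - R a x‖
      + ‖er ψ j0 h L b x‖ + ‖er ψ j0 h L a x‖ := by
    rw [e]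
    refine (norm_add_le _ _).trans ?_
    gcongr
    refine (norm_sub_le _ _).trans ?_
    gcongr
    exact norm_sub_le _ _
  linarith

/-- The `L²` jump constant. -/
def C2 (A : ℝ) : ℝ≥0∞ := 64 * (10 * (Wt * Wt * DD A) + 2 * (4 * DD A))

lemma C2_ne_top : C2 A ≠ ⊤ := by
  unfold C2 DD
  have := Wt_ne_top
  finiteness

lemma Ker.am_meas (hk : Ker Ψ ψ A) (hh : ∀ j, Nice (h j)) (L : ℕ) (l : ℝ) (i : ℕ) :
    Measurable (am ψ j0 h L l i) := by
  have h1 : ∀ n, Measurable (RR (XX ψ j0 h L) (l/8) n) := fun n =>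
    (RR_nice (hk.XX_nice hh L) (l/8) n).sm.measurable
  have h2 : ∀ n, Measurable (er ψ j0 h L n) := fun n => (hk.er_nice hh L n).sm.measurable
  unfold am
  fun_prop

lemma Ker.jump_two (hk : Ker Ψ ψ A) (hh : ∀ j, Nice (h j)) (L : ℕ) {l : ℝ} (hl : 0 < l) :
    ∃ G : ℝ → ℝ≥0∞, Measurable G ∧
      ∫⁻ x, G x ≤ C2 A * ENNReal.ofReal (l ^ (-2:ℝ)) * ∑ j ∈ Finset.range L, Qn (h j) ∧
      ∀ (x : ℝ) (n : ℕ → ℕ) (K : ℕ), Monotone n → (∀ k, n k ≤ L) →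
        ∑ k ∈ Finset.range K, (if l / 2 < ‖SS ψ j0 h (n (k+1)) x - SS ψ j0 h (n k) x‖ then 1 else 0)
          ≤ G x := by
  refine ⟨fun x => (ENNReal.ofReal (l^2/64))⁻¹ * ∑ i ∈ Finset.range L, am ψ j0 h L l i x,
    (Finset.measurable_fun_sum _ fun i _ => hk.am_meas hh L l i).const_mul _, ?_, ?_⟩
  · rw [lintegral_const_mul _ (Finset.measurable_fun_sum _ fun i _ => hk.am_meas hh L l i),
      lintegral_finsetSum _ (fun i _ => hk.am_meas hh L l i)]
    have e0 : ∀ i, ∫⁻ x, am ψ j0 h L l i x =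
        Qn (fun x => RR (XX ψ j0 h L) (l/8) (i+1) x - RR (XX ψ j0 h L) (l/8) i x)
        + Qn (er ψ j0 h L i) + Qn (er ψ j0 h L (i+1)) := by
      intro i
      have h1 : ∀ n, Measurable (RR (XX ψ j0 h L) (l/8) n) := fun n =>
        (RR_nice (hk.XX_nice hh L) (l/8) n).sm.measurable
      have h2 : ∀ n, Measurable (er ψ j0 h L n) := fun n => (hk.er_nice hh L n).sm.measurable
      unfold am Qn
      rw [lintegral_add_left (by fun_prop), lintegral_add_left (by fun_prop)]
    simp_rw [e0]
    rw [Finset.sum_add_distrib, Finset.sum_add_distrib]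
    have h2 := hk.er_bound hh L (j0 := j0)
    have h3 : ∑ n ∈ Finset.range L, Qn (er ψ j0 h L (n+1)) ≤ ∑ n ∈ Finset.range (L+1), Qn (er ψ j0 h L n) := by
      rw [Finset.sum_range_succ']; exact le_self_add
    have h4 : ∑ n ∈ Finset.range L, Qn (er ψ j0 h L n) ≤ ∑ n ∈ Finset.range (L+1), Qn (er ψ j0 h L n) := by
      rw [Finset.sum_range_succ]; exact le_self_add
    have h5 := (le_self_add.trans (mart_bound j0 (hk.SS_nice hh L (j0 := j0)) (l/8) L)).trans
      (hk.X_diff hh L (j0 := j0))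
    have e1 : (ENNReal.ofReal (l^2/64))⁻¹ = 64 * ENNReal.ofReal (l ^ (-2:ℝ)) := by
      rw [← ofReal_inv_of_pos (by positivity), ← ofReal_ofNat 64, ← ofReal_mul (by positivity),
        Real.rpow_neg hl.le, Real.rpow_ofNat]
      congr 1; field_simp
    rw [e1]
    set Z := ∑ j ∈ Finset.range L, Qn (h j)
    calc _ ≤ 64 * ENNReal.ofReal (l ^ (-2:ℝ)) * ((8 * (Wt * Wt * DD A) + 2 * (4 * DD A)) * Z +
          Wt * Wt * DD A * Z + Wt * Wt * DD A * Z) := by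
          gcongr
          · exact h5
          · exact h4.trans h2
          · exact h3.trans h2
      _ = _ := by unfold C2; ring
  · intro x n K hn hL
    refine le_trans ?_ (mul_le_mul' le_rfl (block_sum (fun i => am ψ j0 h L l i x) n hn L K hL))
    rw [Finset.mul_sum]
    refine Finset.sum_le_sum fun k _ => ?_
    split_ifs with hj
    · obtain ⟨i, hi, hi2⟩ := jump_pt L hl x _ _ (hn (Nat.le_succ k)) hj
      have h0 : ENNReal.ofReal (l^2/64) ≠ 0 := by simp; positivity
      rw [← ENNReal.inv_mul_cancel h0 (by simp)]
      gcongr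
      exact hi2.trans (Finset.single_le_sum (f := fun i => am ψ j0 h L l i x) (fun _ _ => zero_le) hi)
    · exact zero_le

end

section
variable {Ψ ψ : ℝ → ℂ} {A : ℝ} {j0 : ℤ} {h : ℕ → ℝ → ℂ}

lemma enorm_rpow_eq (z : ℂ) {s : ℝ} (hs : 0 ≤ s) : ‖z‖ₑ ^ s = ENNReal.ofReal (‖z‖ ^ s) := by
  rw [← ofReal_norm, ofReal_rpow_of_nonneg (norm_nonneg _) hs]

lemma low_sum (s : ℝ) (hs1 : 1 < s) (hs2 : s < 2) : ∃ C : ℝ≥0, ∀ z : ℂ,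
    ∑' m : ℤ, ENNReal.ofReal (((2:ℝ)^m) ^ (s-2)) * (if ‖z‖ ≤ (2:ℝ)^m then ‖z‖ₑ ^ 2 else 0) ≤ C * ‖z‖ₑ ^ s := by
  obtain ⟨C, hC⟩ := geo_high (2 - s) (by linarith)
  refine ⟨C, fun z => ?_⟩
  rcases eq_or_ne z 0 with rfl | hz
  · simp
  have hz' : 0 < ‖z‖ := norm_pos_iff.2 hz
  have h1 := hC ‖z‖ hz'
  calc _ = (∑' m : ℤ, (if ‖z‖ ≤ (2:ℝ)^m then ENNReal.ofReal (((2:ℝ)^m) ^ (-(2-s))) else 0)) * ‖z‖ₑ ^ 2 := by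
        rw [← ENNReal.tsum_mul_right]
        congr 1; ext m
        split_ifs <;> simp
    _ ≤ C * ENNReal.ofReal (‖z‖ ^ (-(2-s))) * ‖z‖ₑ ^ 2 := by gcongr
    _ = _ := by
        rw [mul_assoc, enorm_sq_eq, ← ofReal_mul (by positivity), enorm_rpow_eq z (by linarith)]
        congr 2
        rw [← Real.rpow_natCast, ← Real.rpow_add hz']
        congr 1; push_cast; ring

lemma high_sum (s : ℝ) (hs1 : 1 < s) : ∃ C : ℝ≥0, ∀ z : ℂ,
    ∑' m : ℤ, ENNReal.ofReal (((2:ℝ)^m) ^ (s-1)) * (if (2:ℝ)^m < ‖z‖ then ‖z‖ₑ else 0) ≤ C * ‖z‖ₑ ^ s := by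
  obtain ⟨C, hC⟩ := geo_low (s - 1) (by linarith)
  refine ⟨C, fun z => ?_⟩
  rcases eq_or_ne z 0 with rfl | hz
  · simp
  have hz' : 0 < ‖z‖ := norm_pos_iff.2 hz
  have h1 := hC ‖z‖ hz'.le
  calc _ = (∑' m : ℤ, (if (2:ℝ)^m < ‖z‖ then ENNReal.ofReal (((2:ℝ)^m) ^ (s-1)) else 0)) * ‖z‖ₑ := by
        rw [← ENNReal.tsum_mul_right]
        congr 1; ext m
        split_ifs <;> simp
    _ ≤ C * ENNReal.ofReal (‖z‖ ^ (s-1)) * ‖z‖ₑ := by gcongr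
    _ = _ := by
        rw [mul_assoc, ← ofReal_norm, ← ofReal_mul (by positivity), ofReal_norm, enorm_rpow_eq z (by linarith)]
        congr 2
        nth_rw 2 [← Real.rpow_one ‖z‖]
        rw [← Real.rpow_add hz']
        congr 1; ring

lemma Ker.dil_L1 (hk : Ker Ψ ψ A) (j : ℤ) (y : ℝ) :
    ∫⁻ x, ‖dil ψ j (x - y)‖ₑ ≤ ENNReal.ofReal (A * Real.pi) := by
  have hA := hk.A_pos
  have hp : (0:ℝ) < 2^j := by positivity
  rw [ofReal_mul hA.le, ← Phi_scale_shift ((2:ℝ)^j) y hp, ← lintegral_const_mul' _ _ (by simp)]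
  refine lintegral_mono fun x => ?_
  rw [← ofReal_norm, ← ofReal_mul hA.le]
  refine ofReal_le_ofReal ?_
  unfold dil
  rw [norm_smul, Real.norm_of_nonneg hp.le]
  have := (hk.bψ ((2:ℝ)^j * (x - y))).trans (mul_le_mul_of_nonneg_left (Phi_sq_le _) hA.le)
  calc _ ≤ (2:ℝ)^j * (A * Phi ((2:ℝ)^j * (x - y))) := by gcongr
    _ = _ := by ring

lemma Ker.cv_L1 (hk : Ker Ψ ψ A) (j : ℤ) {f : ℝ → ℂ} (hf : Nice f) :
    ∫⁻ x, ‖cv (dil ψ j) f x‖ₑ ≤ ENNReal.ofReal (A * Real.pi) * ∫⁻ x, ‖f x‖ₑ := by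
  have h1 := hf.sm.measurable
  have h2 := (dil_cont hk.cont j).measurable
  calc _ ≤ ∫⁻ x, ∫⁻ y, ‖f y‖ₑ * ‖dil ψ j (x - y)‖ₑ := by
        refine lintegral_mono fun x => (enorm_integral_le_lintegral_enorm _).trans ?_
        simp_rw [enorm_mul]; exact le_rfl
    _ = ∫⁻ y, ∫⁻ x, ‖f y‖ₑ * ‖dil ψ j (x - y)‖ₑ := by
        rw [lintegral_lintegral_swap]
        unfold Function.uncurry; fun_prop
    _ ≤ ∫⁻ y, ‖f y‖ₑ * ENNReal.ofReal (A * Real.pi) := by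
        refine lintegral_mono fun y => ?_
        rw [lintegral_const_mul _ (by fun_prop)]
        gcongr
        exact hk.dil_L1 j y
    _ = _ := by rw [lintegral_mul_const _ (by fun_prop), mul_comm]

/-- small part -/
def hlo (h : ℕ → ℝ → ℂ) (m : ℤ) (j : ℕ) (x : ℝ) : ℂ := if ‖h j x‖ ≤ (2:ℝ)^m then h j x else 0
/-- large part -/
def hhi (h : ℕ → ℝ → ℂ) (m : ℤ) (j : ℕ) (x : ℝ) : ℂ := if (2:ℝ)^m < ‖h j x‖ then h j x else 0

lemma hlo_nice (hh : ∀ j, Nice (h j)) (m : ℤ) (j : ℕ) : Nice (hlo h m j) := by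
  have hm : MeasurableSet {x | ‖h j x‖ ≤ (2:ℝ)^m} :=
    measurableSet_le (hh j).sm.norm.measurable measurable_const
  convert (hh j).indicator hm using 1
  ext x; simp [hlo, Set.indicator]

lemma hhi_nice (hh : ∀ j, Nice (h j)) (m : ℤ) (j : ℕ) : Nice (hhi h m j) := by
  have hm : MeasurableSet {x | (2:ℝ)^m < ‖h j x‖} :=
    measurableSet_lt measurable_const (hh j).sm.norm.measurable
  convert (hh j).indicator hm using 1
  ext x; simp [hhi, Set.indicator]

lemma Ker.SS_split (hk : Ker Ψ ψ A) (hh : ∀ j, Nice (h j)) (m : ℤ) (n : ℕ) (x : ℝ) :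
    SS ψ j0 h n x = SS ψ j0 (hlo h m) n x + SS ψ j0 (hhi h m) n x := by
  unfold SS
  rw [← Finset.sum_add_distrib]
  refine Finset.sum_congr rfl fun j _ => ?_
  unfold uu
  rw [← cv_add (hk.dnice _) (hlo_nice hh m j) (hhi_nice hh m j)]
  congr 1; ext y
  unfold hlo hhi
  by_cases h1 : ‖h j y‖ ≤ (2:ℝ)^m
  · simp [h1, not_lt.2 h1]
  · simp [h1, not_le.1 h1]

lemma SS_diff (a b : ℕ) (hab : a ≤ b) (x : ℝ) :
    SS ψ j0 h b x - SS ψ j0 h a x = ∑ j ∈ Finset.Ico a b, uu ψ j0 h j x := by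
  unfold SS; rw [Finset.sum_Ico_eq_sub _ hab]

lemma Ker.ind_split (hk : Ker Ψ ψ A) (hh : ∀ j, Nice (h j)) (m : ℤ) (a b : ℕ) (hab : a ≤ b) (x : ℝ) :
    (if (2:ℝ)^m < ‖SS ψ j0 h b x - SS ψ j0 h a x‖ then (1:ℝ≥0∞) else 0) ≤
      (if (2:ℝ)^m / 2 < ‖SS ψ j0 (hlo h m) b x - SS ψ j0 (hlo h m) a x‖ then 1 else 0)
      + ENNReal.ofReal (2 * ((2:ℝ)^m)⁻¹) * ∑ j ∈ Finset.Ico a b, ‖uu ψ j0 (hhi h m) j x‖ₑ := by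
  split_ifs with h1 h2
  · exact le_self_add
  · rw [zero_add]
    have hp : (0:ℝ) < 2^m := by positivity
    have h3 : (2:ℝ)^m / 2 < ‖SS ψ j0 (hhi h m) b x - SS ψ j0 (hhi h m) a x‖ := by
      rw [hk.SS_split hh m, hk.SS_split hh m a, add_sub_add_comm] at h1
      have := norm_add_le (SS ψ j0 (hlo h m) b x - SS ψ j0 (hlo h m) a x) (SS ψ j0 (hhi h m) b x - SS ψ j0 (hhi h m) a x)
      linarith
    rw [SS_diff a b hab] at h3
    calc (1:ℝ≥0∞) = ENNReal.ofReal (2 * ((2:ℝ)^m)⁻¹) * ENNReal.ofReal ((2:ℝ)^m/2) := by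
          rw [← ofReal_mul (by positivity), ← ofReal_one]; congr 1; field_simp
      _ ≤ ENNReal.ofReal (2 * ((2:ℝ)^m)⁻¹) * ‖∑ j ∈ Finset.Ico a b, uu ψ j0 (hhi h m) j x‖ₑ := by
          rw [← ofReal_norm]; gcongr
      _ ≤ _ := by gcongr; exact enorm_sum_le _ _
  · exact zero_le
  · exact zero_le

lemma layer_sum (s : ℝ) (hs : 0 < s) (z : ℂ) :
    ‖z‖ₑ ^ s ≤ ∑' m : ℤ, ENNReal.ofReal (((2:ℝ)^(m+1)) ^ s) * (if (2:ℝ)^m < ‖z‖ then (1:ℝ≥0∞) else 0) := by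
  rcases eq_or_ne z 0 with rfl | hz
  · simp [hs]
  obtain ⟨m, h1, h2⟩ := exists_mem_Ioc_zpow (norm_pos_iff.2 hz) one_lt_two
  refine le_trans ?_ (ENNReal.le_tsum m)
  rw [if_pos h1, mul_one, enorm_rpow_eq z hs.le]
  refine ofReal_le_ofReal ?_
  gcongr

theorem Ker.var_s (hk : Ker Ψ ψ A) (s : ℝ) (hs1 : 1 < s) (hs2 : s < 2) :
    ∃ C : ℝ≥0, ∀ (j0 : ℤ) (h : ℕ → ℝ → ℂ), (∀ j, Nice (h j)) → ∀ L : ℕ,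
      ∃ G : ℝ → ℝ≥0∞, Measurable G ∧
        ∫⁻ x, G x ≤ C * ∑ j ∈ Finset.range L, ∫⁻ x, ‖h j x‖ₑ ^ s ∧
        ∀ (x : ℝ) (n : ℕ → ℕ) (K : ℕ), Monotone n → (∀ k, n k ≤ L) →
          ∑ k ∈ Finset.range K, ‖SS ψ j0 h (n (k+1)) x - SS ψ j0 h (n k) x‖ₑ ^ s ≤ G x := by
  obtain ⟨Cl, hCl⟩ := low_sum s hs1 hs2
  obtain ⟨Ch, hCh⟩ := high_sum s hs1
  have hA := hk.A_pos
  set B : ℝ≥0∞ := ENNReal.ofReal (A * Real.pi) with hB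
  refine ⟨(ENNReal.ofReal (2^s) * (C2 A * Cl + 2 * B * Ch)).toNNReal, fun j0 h hh L => ?_⟩
  rw [coe_toNNReal (by have := C2_ne_top (A := A); finiteness)]
  have hjt := fun m : ℤ => hk.jump_two (hlo_nice hh m) L (l := (2:ℝ)^m) (by positivity) (j0 := j0)
  choose G hGm hGi hG using hjt
  have hum : ∀ m j, Measurable (uu ψ j0 (hhi h m) j) := fun m j =>
    (hk.uu_nice (hhi_nice hh m) j).sm.measurable
  have htm : ∀ m : ℤ, Measurable fun x => ENNReal.ofReal (((2:ℝ)^(m+1)) ^ s) * (G m x +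
    ENNReal.ofReal (2 * ((2:ℝ)^m)⁻¹) * ∑ j ∈ Finset.range L, ‖uu ψ j0 (hhi h m) j x‖ₑ) := by
    intro m
    have := hGm m
    have := hum m
    fun_prop
  refine ⟨fun x => ∑' m : ℤ, ENNReal.ofReal (((2:ℝ)^(m+1)) ^ s) * (G m x +
    ENNReal.ofReal (2 * ((2:ℝ)^m)⁻¹) * ∑ j ∈ Finset.range L, ‖uu ψ j0 (hhi h m) j x‖ₑ),
    Measurable.tsum htm, ?_, ?_⟩
  · rw [lintegral_tsum fun m => (htm m).aemeasurable]
    have hhm : ∀ j, Measurable (h j) := fun j => (hh j).sm.measurable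
    have hlom : ∀ m j, Measurable (hlo h m j) := fun m j => (hlo_nice hh m j).sm.measurable
    have hhim : ∀ m j, Measurable (hhi h m j) := fun m j => (hhi_nice hh m j).sm.measurable
    have hterm : ∀ m : ℤ, ∫⁻ x, ENNReal.ofReal (((2:ℝ)^(m+1)) ^ s) * (G m x +
        ENNReal.ofReal (2 * ((2:ℝ)^m)⁻¹) * ∑ j ∈ Finset.range L, ‖uu ψ j0 (hhi h m) j x‖ₑ) ≤
        ENNReal.ofReal (2^s) * ∑ j ∈ Finset.range L, ∫⁻ x,
          (C2 A * (ENNReal.ofReal (((2:ℝ)^m)^(s-2)) * ‖hlo h m j x‖ₑ ^ 2)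
           + 2 * B * (ENNReal.ofReal (((2:ℝ)^m)^(s-1)) * ‖hhi h m j x‖ₑ)) := by
      intro m
      have hp : (0:ℝ) < 2^m := by positivity
      have hGm' := hGm m
      have hum' := hum m
      have hl' := hlom m
      have hh' := hhim m
      rw [lintegral_const_mul _ (by fun_prop), lintegral_add_left (hGm m),
        lintegral_const_mul _ (by fun_prop), lintegral_finsetSum _ (by fun_prop)]
      have e1 : ENNReal.ofReal (((2:ℝ)^(m+1)) ^ s) = ENNReal.ofReal (2^s) * ENNReal.ofReal (((2:ℝ)^m)^s) := by
        rw [← ofReal_mul (by positivity), ← Real.mul_rpow (by norm_num) hp.le, zpow_add_one₀ (by norm_num),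
          mul_comm]
      have e2 : ENNReal.ofReal (((2:ℝ)^m)^(s-2)) = ENNReal.ofReal (((2:ℝ)^m)^s) * ENNReal.ofReal (((2:ℝ)^m)^(-2:ℝ)) := by
        rw [← ofReal_mul (by positivity), ← Real.rpow_add hp]; rfl
      have e3 : ENNReal.ofReal (((2:ℝ)^m)^(s-1)) = ENNReal.ofReal (((2:ℝ)^m)^s) * ENNReal.ofReal (((2:ℝ)^m)⁻¹) := by
        rw [← ofReal_mul (by positivity), Real.rpow_sub hp, Real.rpow_one]; rfl
      have e4 : ENNReal.ofReal (2 * ((2:ℝ)^m)⁻¹) = 2 * ENNReal.ofReal (((2:ℝ)^m)⁻¹) := by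
        rw [ofReal_mul (by norm_num)]; simp
      have e5 : ∀ j, ∫⁻ x,
          (C2 A * (ENNReal.ofReal (((2:ℝ)^m)^(s-2)) * ‖hlo h m j x‖ₑ ^ 2)
           + 2 * B * (ENNReal.ofReal (((2:ℝ)^m)^(s-1)) * ‖hhi h m j x‖ₑ)) =
          C2 A * (ENNReal.ofReal (((2:ℝ)^m)^(s-2)) * Qn (hlo h m j)) +
           2 * B * (ENNReal.ofReal (((2:ℝ)^m)^(s-1)) * ∫⁻ x, ‖hhi h m j x‖ₑ) := by
        intro j
        rw [lintegral_add_left (by fun_prop), lintegral_const_mul _ (by fun_prop),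
          lintegral_const_mul _ (by fun_prop), lintegral_const_mul _ (by fun_prop),
          lintegral_const_mul _ (by fun_prop)]
        rfl
      simp_rw [e5]
      rw [Finset.sum_add_distrib, ← Finset.mul_sum, ← Finset.mul_sum, ← Finset.mul_sum, ← Finset.mul_sum]
      have h1 := hGi m
      have h2 : ∑ j ∈ Finset.range L, ∫⁻ x, ‖uu ψ j0 (hhi h m) j x‖ₑ ≤
          B * ∑ j ∈ Finset.range L, ∫⁻ x, ‖hhi h m j x‖ₑ := by
        rw [Finset.mul_sum]
        exact Finset.sum_le_sum fun j _ => hk.cv_L1 _ (hhi_nice hh m j)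
      rw [e1, e2, e3, e4, mul_assoc]
      refine mul_le_mul' le_rfl ?_
      calc _ ≤ ENNReal.ofReal (((2:ℝ)^m)^s) * (C2 A * ENNReal.ofReal (((2:ℝ)^m) ^ (-2:ℝ)) * ∑ j ∈ Finset.range L, Qn (hlo h m j)
            + 2 * ENNReal.ofReal (((2:ℝ)^m)⁻¹) * (B * ∑ j ∈ Finset.range L, ∫⁻ x, ‖hhi h m j x‖ₑ)) := by gcongr
        _ = _ := by ring
    refine (ENNReal.tsum_le_tsum hterm).trans ?_
    rw [ENNReal.tsum_mul_left, Summable.tsum_finsetSum (fun _ _ => ENNReal.summable), mul_assoc]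
    refine mul_le_mul' le_rfl ?_
    rw [Finset.mul_sum]
    refine Finset.sum_le_sum fun j _ => ?_
    have hl' := fun m => hlom m j
    have hh' := fun m => hhim m j
    rw [← lintegral_tsum (by fun_prop), ← lintegral_const_mul _ (by have := hhm j; fun_prop)]
    refine lintegral_mono fun x => ?_
    simp only
    rw [ENNReal.tsum_add, ENNReal.tsum_mul_left, ENNReal.tsum_mul_left, add_mul, mul_assoc (C2 A) (Cl:ℝ≥0∞),
      mul_assoc (2 * B) (Ch:ℝ≥0∞)]
    refine add_le_add (mul_le_mul' le_rfl ?_) (mul_le_mul' le_rfl ?_)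
    · refine le_trans (le_of_eq ?_) (hCl (h j x))
      congr 1; ext m
      unfold hlo
      split_ifs <;> simp
    · refine le_trans (le_of_eq ?_) (hCh (h j x))
      congr 1; ext m
      unfold hhi
      split_ifs <;> simp
  · intro x n K hn hL
    calc _ ≤ ∑ k ∈ Finset.range K, ∑' m : ℤ, ENNReal.ofReal (((2:ℝ)^(m+1)) ^ s) *
          (if (2:ℝ)^m < ‖SS ψ j0 h (n (k+1)) x - SS ψ j0 h (n k) x‖ then (1:ℝ≥0∞) else 0) :=
          Finset.sum_le_sum fun k _ => layer_sum s (by linarith) _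
      _ = ∑' m : ℤ, ENNReal.ofReal (((2:ℝ)^(m+1)) ^ s) * ∑ k ∈ Finset.range K, 
          (if (2:ℝ)^m < ‖SS ψ j0 h (n (k+1)) x - SS ψ j0 h (n k) x‖ then (1:ℝ≥0∞) else 0) := by
          rw [← Summable.tsum_finsetSum (fun _ _ => ENNReal.summable)]
          simp_rw [Finset.mul_sum]
      _ ≤ _ := by
          refine ENNReal.tsum_le_tsum fun m => mul_le_mul' le_rfl ?_
          refine (Finset.sum_le_sum fun k _ => hk.ind_split hh m _ _ (hn (Nat.le_succ k)) x).trans ?_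
          rw [Finset.sum_add_distrib, ← Finset.mul_sum]
          refine add_le_add (hG m x n K hn hL) (mul_le_mul' le_rfl ?_)
          exact block_sum _ n hn L K hL

end

section
section cz
variable {E : Type*} [NormedAddCommGroup E] 

/-- Dyadic averages of the norm. -/
def av (f : ℝ → E) (n : ℤ) (x : ℝ) : ℝ≥0∞ :=
  ENNReal.ofReal ((2:ℝ)^n) * ∫⁻ y in dI n (dix n x), ‖f y‖ₑ

/-- Points with stopping level `n`. -/
def St (f : ℝ → E) (α : ℝ≥0∞) (n : ℤ) : Set ℝ := {x | α < av f n x ∧ ∀ m < n, av f m x ≤ α}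

/-- Stopped pieces. -/
def PP (f : ℝ → E) (α : ℝ≥0∞) (p : ℤ × ℤ) : Set ℝ := dI p.1 p.2 ∩ St f α p.1

lemma dix_mono {n : ℤ} {x y : ℝ} (h : dix n x = dix n y) (m : ℤ) (hm : m ≤ n) :
    dix m x = dix m y := by
  obtain ⟨k, rfl⟩ : ∃ k : ℕ, m = n - k := ⟨(n-m).toNat, by omega⟩
  clear hm
  induction k with
  | zero => simpa using h
  | succ k ih =>
    have e : n - ((k+1:ℕ):ℤ) + 1 = n - k := by push_cast; ring
    rw [dix_succ, dix_succ _ y, e, ih]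

variable {f : ℝ → E} {α : ℝ≥0∞}

lemma av_congr {n : ℤ} {x y : ℝ} (h : dix n x = dix n y) (m : ℤ) (hm : m ≤ n) :
    av f m x = av f m y := by
  unfold av; rw [dix_mono h m hm]

lemma av_meas (n : ℤ) : Measurable (av f n) := by
  have : av f n = (fun k => ENNReal.ofReal ((2:ℝ)^n) * ∫⁻ y in dI n k, ‖f y‖ₑ) ∘ dix n := rfl
  rw [this]
  exact (measurable_of_countable _).comp (dix_meas n)

lemma St_meas (n : ℤ) : MeasurableSet (St f α n) := by
  have : St f α n = {x | α < av f n x} ∩ ⋂ m : ℤ, ⋂ _ : m < n, {x | av f m x ≤ α} := by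
    ext x; simp [St]
  rw [this]
  exact (measurableSet_lt measurable_const (av_meas n)).inter
    (MeasurableSet.iInter fun m => MeasurableSet.iInter fun _ =>
      measurableSet_le (av_meas m) measurable_const)

lemma St_congr {n : ℤ} {x y : ℝ} (h : dix n x = dix n y) (hx : x ∈ St f α n) : y ∈ St f α n := by
  refine ⟨by rw [← av_congr h n le_rfl]; exact hx.1, fun m hm => ?_⟩
  rw [← av_congr h m hm.le]; exact hx.2 m hm

lemma St_unique {n m : ℤ} {x : ℝ} (h : x ∈ St f α n) (h' : x ∈ St f α m) : n = m := by
  rcases lt_trichotomy n m with hl | hl | hl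
  · exact absurd (h'.2 n hl) (not_le.2 h.1)
  · exact hl
  · exact absurd (h.2 m hl) (not_le.2 h'.1)

lemma PP_meas (p : ℤ × ℤ) : MeasurableSet (PP f α p) := (dI_meas _ _).inter (St_meas _)

lemma PP_disj : Pairwise (Function.onFun Disjoint (PP f α)) := by
  intro p q hpq
  refine Set.disjoint_left.2 fun x hx hy => hpq ?_
  have h1 := St_unique hx.2 hy.2
  have h2 := mem_dI.1 hx.1
  have h3 := mem_dI.1 hy.1
  exact Prod.ext h1 (by rw [← h2, ← h3, h1])

lemma PP_eq {p : ℤ × ℤ} (h : (PP f α p).Nonempty) : PP f α p = dI p.1 p.2 := by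
  obtain ⟨x, hx1, hx2⟩ := h
  refine Set.inter_eq_left.2 fun y hy => St_congr ?_ hx2
  rw [mem_dI.1 hx1, mem_dI.1 hy]

lemma mem_PP {x : ℝ} {n : ℤ} (h : x ∈ St f α n) : x ∈ PP f α (n, dix n x) := ⟨mem_dI.2 rfl, h⟩

lemma exists_stopLevel (hf : Integrable f) (hα : α ≠ 0) {n : ℤ} {x : ℝ}
    (h : α < av f n x) : ∃ m, x ∈ St f α m := by
  have hI : ∫⁻ y, ‖f y‖ₑ ≠ ⊤ := hf.2.ne
  have hα' : α ≠ ⊤ := (lt_top_of_lt h).ne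
  have hbd : ∃ b : ℤ, ∀ z : ℤ, α < av f z x → b ≤ z := by
    set I := (∫⁻ y, ‖f y‖ₑ).toReal with hIdef
    have hI0 : 0 ≤ I := toReal_nonneg
    have ha : 0 < α.toReal := toReal_pos hα hα'
    obtain ⟨k, hk⟩ := exists_pow_lt_of_lt_one (div_pos ha (by linarith : 0 < I + 1))
      (by norm_num : (1/2:ℝ) < 1)
    refine ⟨-k, fun z hz => ?_⟩
    by_contra hlt
    push Not at hlt
    refine absurd hz (not_lt.2 ?_)
    calc av f z x ≤ ENNReal.ofReal ((2:ℝ)^z) * ∫⁻ y, ‖f y‖ₑ := by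
          unfold av; gcongr; exact Measure.restrict_le_self
      _ = ENNReal.ofReal ((2:ℝ)^z * I) := by
          rw [ofReal_mul (by positivity), hIdef, ofReal_toReal hI]
      _ ≤ ENNReal.ofReal α.toReal := by
          refine ofReal_le_ofReal ?_
          have h1 : (2:ℝ)^z ≤ (1/2)^k := by
            have : ((1:ℝ)/2)^k = 2^(-(k:ℤ)) := by simp
            rw [this]
            exact zpow_le_zpow_right₀ (by norm_num) hlt.le
          rw [lt_div_iff₀ (by linarith)] at hk
          have : (0:ℝ) ≤ (1/2)^k := by positivity
          nlinarith
      _ = α := ofReal_toReal hα'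
  obtain ⟨m, hm, hmin⟩ := Int.exists_least_of_bdd hbd ⟨n, h⟩
  refine ⟨m, hm, fun j hj => ?_⟩
  by_contra hc
  exact absurd (hmin j (not_le.1 hc)) (not_le.2 hj)

lemma av_double (n : ℤ) (x : ℝ) : av f n x ≤ 2 * av f (n-1) x := by
  unfold av
  have h1 : ENNReal.ofReal ((2:ℝ)^n) = 2 * ENNReal.ofReal ((2:ℝ)^(n-1)) := by
    have : (2:ℝ)^n = 2 * 2^(n-1) := by rw [zpow_sub_one₀ (by norm_num)]; ring
    rw [this, ofReal_mul (by norm_num)]; simp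
  rw [h1, mul_assoc]
  gcongr 2 * (_ * ?_)
  refine lintegral_mono_set fun y hy => ?_
  rw [mem_dI] at hy ⊢
  exact dix_mono hy _ (by omega)

lemma PP_vol (p : ℤ × ℤ) : α * volume (PP f α p) ≤ ∫⁻ x in PP f α p, ‖f x‖ₑ := by
  by_cases h : (PP f α p).Nonempty
  · obtain ⟨x, hx⟩ := id h
    rw [PP_eq h, dI_vol]
    have h1 := hx.2.1
    unfold av at h1
    rw [mem_dI.1 hx.1] at h1
    calc α * ENNReal.ofReal ((2:ℝ)^(-p.1)) ≤ (ENNReal.ofReal ((2:ℝ)^p.1) * ∫⁻ y in dI p.1 p.2, ‖f y‖ₑ)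
          * ENNReal.ofReal ((2:ℝ)^(-p.1)) := by gcongr
      _ = _ := by
          rw [mul_right_comm, ← ofReal_mul (by positivity), ← zpow_add₀ (by norm_num)]; simp
  · rw [Set.not_nonempty_iff_eq_empty] at h
    simp [h]

/-- Center. -/
def cen (p : ℤ × ℤ) : ℝ := ((p.2:ℝ) + 1/2) * (2:ℝ)^(-p.1)

lemma cen_dist {p : ℤ × ℤ} {y : ℝ} (hy : y ∈ dI p.1 p.2) : 2 * |y - cen p| ≤ (2:ℝ)^(-p.1) := by
  have h1 := hy.1
  have h2 := hy.2
  unfold cen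
  have : |y - ((p.2:ℝ) + 1/2) * (2:ℝ)^(-p.1)| ≤ (2:ℝ)^(-p.1)/2 := by
    rw [abs_le]; constructor <;> linarith
  linarith

/-- Enlarged exceptional set. -/
def Ost (f : ℝ → E) (α : ℝ≥0∞) : Set ℝ :=
  ⋃ p : ℤ × ℤ, ⋃ _ : (PP f α p).Nonempty, Metric.ball (cen p) ((2:ℝ)^(-p.1))

lemma Ost_meas : MeasurableSet (Ost f α) :=
  MeasurableSet.iUnion fun _ => MeasurableSet.iUnion fun _ => Metric.isOpen_ball.measurableSet

lemma Ost_vol : α * volume (Ost f α) ≤ 2 * ∫⁻ x, ‖f x‖ₑ := by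
  calc α * volume (Ost f α) ≤ α * ∑' p : ℤ × ℤ, 2 * volume (PP f α p) := by
        refine mul_le_mul' le_rfl ((measure_iUnion_le _).trans (ENNReal.tsum_le_tsum fun p => ?_))
        by_cases h : (PP f α p).Nonempty
        · simp only [h, Set.iUnion_true]
          rw [PP_eq h, dI_vol, Real.volume_ball, ofReal_mul (by norm_num)]
          simp
        · simp [h]
    _ = 2 * ∑' p : ℤ × ℤ, α * volume (PP f α p) := by
        rw [ENNReal.tsum_mul_left, ENNReal.tsum_mul_left]; ring
    _ ≤ 2 * ∑' p : ℤ × ℤ, ∫⁻ x in PP f α p, ‖f x‖ₑ := by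
        gcongr; exact PP_vol _
    _ ≤ _ := by
        rw [← lintegral_iUnion PP_meas PP_disj]
        gcongr
        exact Measure.restrict_le_self
end cz

section ld
variable {E : Type*} [NormedAddCommGroup E] [NormedSpace ℝ E] [CompleteSpace E]

lemma Ed_tendsto {f : ℝ → E} (hf : Integrable f) :
    ∀ᵐ x, Filter.Tendsto (fun n : ℕ => Ed (n:ℤ) f x) Filter.atTop (nhds (f x)) := by
  have h := IsUnifLocDoublingMeasure.ae_tendsto_average (μ := (volume : Measure ℝ)) hf.locallyIntegrable 1
  filter_upwards [h] with x hx
  have h2 := hx (l := Filter.atTop) (w := fun n : ℕ => cen ((n:ℤ), dix n x))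
    (δ := fun n : ℕ => (2:ℝ)^(-(n:ℤ))/2) ?_ ?_
  · refine h2.congr fun n => ?_
    rw [Real.closedBall_eq_Icc, setAverage_eq, Ed]
    have e1 : cen ((n:ℤ), dix n x) - (2:ℝ)^(-(n:ℤ))/2 = (dix n x : ℝ) * (2:ℝ)^(-(n:ℤ)) := by
      unfold cen; ring
    have e2 : cen ((n:ℤ), dix n x) + (2:ℝ)^(-(n:ℤ))/2 = ((dix n x : ℝ) + 1) * (2:ℝ)^(-(n:ℤ)) := by
      unfold cen; ring
    rw [e1, e2]
    have e3 : volume.real (Set.Icc ((dix n x : ℝ) * (2:ℝ)^(-(n:ℤ))) (((dix n x : ℝ) + 1) * (2:ℝ)^(-(n:ℤ)))) = (2:ℝ)^(-(n:ℤ)) := by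
      rw [Measure.real, Real.volume_Icc, toReal_ofReal]
      · ring
      · have : (0:ℝ) < (2:ℝ)^(-(n:ℤ)) := by positivity
        nlinarith
    rw [e3, zpow_neg, inv_inv, integral_Icc_eq_integral_Ico]
    unfold dI
    simp only [zpow_neg]
  · refine tendsto_nhdsWithin_iff.2 ⟨?_, Filter.Eventually.of_forall fun n => ?_⟩
    · have : (fun n : ℕ => (2:ℝ)^(-(n:ℤ))/2) = fun n : ℕ => ((1/2:ℝ))^n/2 := by
        ext n; simp
      rw [this]
      simpa using (tendsto_pow_atTop_nhds_zero_of_lt_one (by norm_num) (by norm_num : (1/2:ℝ) < 1)).div_const 2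
    · simp only [Set.mem_Ioi]; positivity
  · refine Filter.Eventually.of_forall fun n => ?_
    have := cen_dist (p := ((n:ℤ), dix n x)) (y := x) (mem_dI.2 rfl)
    rw [Metric.mem_closedBall, Real.dist_eq]
    simp only at this ⊢
    linarith
end ld

end

section
set_option linter.unusedSectionVars false
section cz2
variable {E : Type*} [NormedAddCommGroup E] [NormedSpace ℝ E]

open Classical in
/-- Stopping level. -/
def Nst (f : ℝ → E) (α : ℝ≥0∞) (x : ℝ) : ℤ := if h : ∃ n, x ∈ St f α n then h.choose else 0

open Classical in
/-- Good part. -/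
def gd (f : ℝ → E) (α : ℝ≥0∞) (x : ℝ) : E :=
  if ∃ n, x ∈ St f α n then Ed (Nst f α x) f x else f x

/-- Bad part. -/
def bd (f : ℝ → E) (α : ℝ≥0∞) (x : ℝ) : E := f x - gd f α x

/-- Exceptional set. -/
def Om (f : ℝ → E) (α : ℝ≥0∞) : Set ℝ := ⋃ p, PP f α p

variable {f : ℝ → E} {α : ℝ≥0∞}

lemma Om_meas : MeasurableSet (Om f α) := MeasurableSet.iUnion PP_meas

lemma mem_Om {x : ℝ} : x ∈ Om f α ↔ ∃ n, x ∈ St f α n := by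
  unfold Om
  constructor
  · intro h
    obtain ⟨p, hp⟩ := Set.mem_iUnion.1 h
    exact ⟨_, hp.2⟩
  · rintro ⟨n, h⟩
    exact Set.mem_iUnion.2 ⟨_, mem_PP h⟩

lemma Nst_eq {x : ℝ} {n : ℤ} (h : x ∈ St f α n) : Nst f α x = n := by
  have h' : ∃ n, x ∈ St f α n := ⟨n, h⟩
  unfold Nst
  rw [dif_pos h']
  exact St_unique h'.choose_spec h

lemma Nst_meas : Measurable (Nst f α) := by
  refine measurable_to_countable' fun n => ?_
  have : Nst f α ⁻¹' {n} = St f α n ∪ ((Om f α)ᶜ ∩ {_x | n = 0}) := by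
    ext x
    simp only [Set.mem_preimage, Set.mem_singleton_iff, Set.mem_union, Set.mem_inter_iff,
      Set.mem_compl_iff, mem_Om, Set.mem_ofPred_eq]
    constructor
    · intro h
      by_cases hx : ∃ n, x ∈ St f α n
      · obtain ⟨m, hm⟩ := hx
        rw [Nst_eq hm] at h
        subst h
        exact Or.inl hm
      · right
        refine ⟨hx, ?_⟩
        unfold Nst at h
        rw [dif_neg hx] at h
        exact h.symm
    · rintro (h | ⟨h, rfl⟩)
      · exact Nst_eq h
      · unfold Nst; rw [dif_neg h]
  rw [this]
  exact (St_meas n).union (Om_meas.compl.inter (MeasurableSet.const _))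

lemma gd_on {p : ℤ × ℤ} {x : ℝ} (h : x ∈ PP f α p) : gd f α x = Ed p.1 f x := by
  unfold gd
  rw [if_pos ⟨_, h.2⟩, Nst_eq h.2]

lemma gd_off {x : ℝ} (h : x ∉ Om f α) : gd f α x = f x := by
  unfold gd
  rw [if_neg (by rwa [mem_Om] at h)]

lemma gd_sm [SecondCountableTopology E] (hf : StronglyMeasurable f) :
    StronglyMeasurable (gd f α) := by
  borelize E
  refine Measurable.stronglyMeasurable ?_
  unfold gd
  refine Measurable.ite ?_ ?_ hf.measurable
  · have : {x | ∃ n, x ∈ St f α n} = Om f α := by ext x; rw [mem_Om]; rfl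
    rw [this]; exact Om_meas
  · have h1 : Measurable (fun p : ℤ × ℝ => Ed p.1 f p.2) :=
      measurable_from_prod_countable_right fun n => (Ed_sm n f).measurable
    exact h1.comp (Nst_meas.prodMk measurable_id)

lemma gd_lint : ∫⁻ x, ‖gd f α x‖ₑ ≤ ∫⁻ x, ‖f x‖ₑ := by
  rw [← lintegral_add_compl _ (Om_meas (f := f) (α := α)),
    ← lintegral_add_compl (fun x => ‖f x‖ₑ) (Om_meas (f := f) (α := α))]
  refine add_le_add ?_ (le_of_eq ?_)
  · unfold Om
    rw [lintegral_iUnion PP_meas PP_disj, lintegral_iUnion PP_meas PP_disj]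
    refine ENNReal.tsum_le_tsum fun p => ?_
    rw [setLIntegral_congr_fun (PP_meas p) (g := fun x => ‖Ed p.1 f x‖ₑ)
      (fun x hx => by simp only [gd_on hx])]
    by_cases h : (PP f α p).Nonempty
    · rw [PP_eq h]; exact Ed_lint_dI _ _ _
    · rw [Set.not_nonempty_iff_eq_empty] at h
      simp [h]
  · exact setLIntegral_congr_fun Om_meas.compl (fun x hx => by simp only [gd_off hx])

lemma gd_nice [SecondCountableTopology E] (hf : Nice f) : Nice (gd f α) := by
  obtain ⟨C, hC⟩ := hf.bdd
  refine ⟨gd_sm hf.sm, ⟨(gd_sm hf.sm).aestronglyMeasurable, gd_lint.trans_lt hf.int.2⟩, C, fun x => ?_⟩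
  unfold gd
  split_ifs
  · exact Ed_bound _ hC x
  · exact hC x

lemma gd_bound [CompleteSpace E] (hf : Nice f) (hα : α ≠ 0) : ∀ᵐ x, ‖gd f α x‖ₑ ≤ 2 * α := by
  filter_upwards [Ed_tendsto hf.int] with x hx
  by_cases h : ∃ n, x ∈ St f α n
  · obtain ⟨n, hn⟩ := h
    rw [gd_on (mem_PP hn)]
    refine (Ed_norm_le n f x).trans ((av_double n x).trans ?_)
    exact mul_le_mul' le_rfl (hn.2 _ (by omega))
  · rw [gd_off (by rwa [mem_Om])]
    have h1 : ‖f x‖ₑ ≤ α := by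
      refine le_of_tendsto hx.enorm (Filter.Eventually.of_forall fun n => ?_)
      refine (Ed_norm_le n f x).trans ?_
      by_contra hc
      exact h (exists_stopLevel hf.int hα (n := n) (not_le.1 hc))
    refine h1.trans ?_
    exact le_mul_of_one_le_left (by positivity) (by norm_num)

lemma bd_mean [CompleteSpace E] (hf : Nice f) (p : ℤ × ℤ) : ∫ x in PP f α p, bd f α x = 0 := by
  rw [setIntegral_congr_fun (PP_meas p) (g := fun x => f x - Ed p.1 f x)
      (fun x hx => by simp only [bd, gd_on hx])]
  by_cases h : (PP f α p).Nonempty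
  · rw [PP_eq h, integral_sub hf.int.integrableOn (Ed_nice _ hf).int.integrableOn]
    rw [setIntegral_congr_fun (dI_meas _ _) (f := Ed p.1 f)
      (g := fun x => (2:ℝ)^p.1 • ∫ y in dI p.1 p.2, f y)
      (fun x hx => by simp only [Ed, mem_dI.1 hx])]
    rw [setIntegral_const, dI_real, smul_smul, ← zpow_add₀ (by norm_num)]
    simp
  · rw [Set.not_nonempty_iff_eq_empty] at h
    simp [h]

lemma bd_off {x : ℝ} (h : x ∉ Om f α) : bd f α x = 0 := by
  simp [bd, gd_off h]

lemma bd_lint (hf : Nice f) : ∫⁻ x, ‖bd f α x‖ₑ ≤ 2 * ∫⁻ x, ‖f x‖ₑ := by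
  calc ∫⁻ x, ‖bd f α x‖ₑ ≤ ∫⁻ x, (‖f x‖ₑ + ‖gd f α x‖ₑ) := 
        lintegral_mono fun x => enorm_sub_le
    _ = (∫⁻ x, ‖f x‖ₑ) + ∫⁻ x, ‖gd f α x‖ₑ := lintegral_add_left hf.sm.enorm _
    _ ≤ _ := by rw [two_mul]; exact add_le_add le_rfl gd_lint

/-- Center of the stopped interval. -/
def cc (f : ℝ → E) (α : ℝ≥0∞) (y : ℝ) : ℝ := cen (Nst f α y, dix (Nst f α y) y)

lemma cc_on {p : ℤ × ℤ} {x : ℝ} (h : x ∈ PP f α p) : cc f α x = cen p := by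
  unfold cc
  rw [Nst_eq h.2, mem_dI.1 h.1]

lemma cc_meas : Measurable (cc f α) := by
  have h1 : Measurable (fun p : ℤ × ℝ => dix p.1 p.2) :=
      measurable_from_prod_countable_right fun n => dix_meas n
  exact (measurable_of_countable cen).comp
    (Nst_meas.prodMk (h1.comp (Nst_meas.prodMk measurable_id)))

end cz2

section weak
variable {E F : Type*} [NormedAddCommGroup E] [NormedSpace ℂ E] [CompleteSpace E]
  [SecondCountableTopology E] [NormedAddCommGroup F] [NormedSpace ℂ F] [CompleteSpace F]

/-- Convolution operator with operator-valued kernel. -/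
def TT (K : ℝ → E →L[ℂ] F) (f : ℝ → E) (x : ℝ) : F := ∫ y, K (x - y) (f y)

variable {K : ℝ → E →L[ℂ] F} {f : ℝ → E} {α : ℝ≥0∞}

lemma TT_int (hK : Nice K) (hf : Nice f) (x : ℝ) : Integrable (fun y => K (x - y) (f y)) := 
  hf.conv_integrable hK (ContinuousLinearMap.apply ℂ F) x

lemma TT_nice (hK : Nice K) (hf : Nice f) : Nice (TT K f) := 
  hf.conv hK (ContinuousLinearMap.apply ℂ F)

lemma TT_add (hK : Nice K) {g : ℝ → E} (hf : Nice f) (hg : Nice g) (x : ℝ) :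
    TT K (fun y => f y + g y) x = TT K f x + TT K g x := by
  unfold TT
  rw [← integral_add (TT_int hK hf x) (TT_int hK hg x)]
  simp

lemma TT_bd_eq (hK : Nice K) (hf : Nice f) (x : ℝ) :
    TT K (bd f α) x = ∫ y, (K (x - y) - K (x - cc f α y)) (bd f α y) := by
  have hb : Nice (bd f α) := hf.sub (gd_nice hf)
  obtain ⟨D, hD0, hD⟩ := hK.bdd'
  have hsm : StronglyMeasurable (fun y => K (x - cc f α y) (bd f α y)) :=
    (ContinuousLinearMap.apply ℂ F (E := E)).continuous₂.comp_stronglyMeasurable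
      (hb.sm.prodMk (hK.sm.comp_measurable (g := fun y => x - cc f α y) (measurable_const.sub cc_meas)))
  have hi : Integrable (fun y => K (x - cc f α y) (bd f α y)) := by
    refine (hb.int.norm.const_mul D).mono' hsm.aestronglyMeasurable
      (Filter.Eventually.of_forall fun y => ?_)
    refine (ContinuousLinearMap.le_opNorm _ _).trans ?_
    gcongr
    exact hD _
  have h0 : ∫ y, K (x - cc f α y) (bd f α y) = 0 := by
    have h1 : ∫ y, K (x - cc f α y) (bd f α y) = ∫ y in Om f α, K (x - cc f α y) (bd f α y) := by
      symm
      refine setIntegral_eq_integral_of_forall_compl_eq_zero fun y hy => ?_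
      rw [bd_off hy, map_zero]
    rw [h1]
    unfold Om
    rw [integral_iUnion PP_meas PP_disj hi.integrableOn]
    have : ∀ p, ∫ y in PP f α p, K (x - cc f α y) (bd f α y) = 0 := by
      intro p
      rw [setIntegral_congr_fun (PP_meas p) (g := fun y => K (x - cen p) (bd f α y))
        (fun y hy => by simp only [cc_on hy])]
      rw [ContinuousLinearMap.integral_comp_comm _ hb.int.integrableOn, bd_mean hf, map_zero]
    simp [this]
  unfold TT
  have e : (fun y => (K (x - y) - K (x - cc f α y)) (bd f α y)) =
    fun y => K (x - y) (bd f α y) - K (x - cc f α y) (bd f α y) := by ext y; simp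
  rw [e, integral_sub (TT_int hK hb x) hi, h0, sub_zero]

lemma TT_bd_bound (hK : Nice K) (hf : Nice f) {B : ℝ≥0∞}
    (hB : ∀ y, ∫⁻ x in {x : ℝ | 2 * |y| ≤ |x|}, ‖K (x - y) - K x‖ₑ ≤ B) :
    ∫⁻ x in (Ost f α)ᶜ, ‖TT K (bd f α) x‖ₑ ≤ B * (2 * ∫⁻ x, ‖f x‖ₑ) := by
  have hb : Nice (bd f α) := hf.sub (gd_nice hf)
  have hm : StronglyMeasurable (fun p : ℝ × ℝ => K (p.1 - p.2) - K (p.1 - cc f α p.2)) := by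
    refine StronglyMeasurable.sub ?_ ?_
    · exact hK.sm.comp_measurable (g := fun p : ℝ × ℝ => p.1 - p.2) (by fun_prop)
    · exact hK.sm.comp_measurable (g := fun p : ℝ × ℝ => p.1 - cc f α p.2)
        (measurable_fst.sub (cc_meas.comp measurable_snd))
  calc ∫⁻ x in (Ost f α)ᶜ, ‖TT K (bd f α) x‖ₑ 
      ≤ ∫⁻ x in (Ost f α)ᶜ, ∫⁻ y, ‖K (x - y) - K (x - cc f α y)‖ₑ * ‖bd f α y‖ₑ := by
        refine lintegral_mono fun x => ?_
        rw [TT_bd_eq hK hf]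
        refine (enorm_integral_le_lintegral_enorm _).trans (lintegral_mono fun y => ?_)
        exact ContinuousLinearMap.le_opENorm _ _
    _ = ∫⁻ y, ∫⁻ x in (Ost f α)ᶜ, ‖K (x - y) - K (x - cc f α y)‖ₑ * ‖bd f α y‖ₑ := by
        refine lintegral_lintegral_swap ?_
        exact (hm.enorm.mul (hb.sm.enorm.comp measurable_snd)).aemeasurable
    _ ≤ ∫⁻ y, B * ‖bd f α y‖ₑ := by
        refine lintegral_mono fun y => ?_
        by_cases hy : y ∈ Om f α
        · rw [lintegral_mul_const' _ _ (by simp)]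
          refine mul_le_mul' ?_ le_rfl
          obtain ⟨p, hp⟩ := Set.mem_iUnion.1 hy
          rw [cc_on hp]
          calc ∫⁻ x in (Ost f α)ᶜ, ‖K (x - y) - K (x - cen p)‖ₑ
              ≤ ∫⁻ x in {x : ℝ | 2 * |y - cen p| ≤ |x - cen p|}, ‖K (x - y) - K (x - cen p)‖ₑ := by
                refine lintegral_mono_set fun x hx => ?_
                have h1 := cen_dist hp.1
                refine h1.trans ?_
                by_contra hc
                refine hx (Set.mem_iUnion.2 ⟨p, Set.mem_iUnion.2 ⟨⟨y, hp⟩, ?_⟩⟩)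
                rw [Metric.mem_ball, Real.dist_eq]
                exact not_le.1 hc
            _ = ∫⁻ x, ({x : ℝ | 2 * |y - cen p| ≤ |x|}.indicator 
                  (fun x => ‖K (x - (y - cen p)) - K x‖ₑ)) (x - cen p) := by
                rw [← lintegral_indicator]
                · congr 1; ext x
                  simp only [Set.indicator, Set.mem_ofPred_eq]
                  congr 3
                  ring_nf
                · exact measurableSet_le measurable_const (by fun_prop)
            _ = ∫⁻ x in {x : ℝ | 2 * |y - cen p| ≤ |x|}, ‖K (x - (y - cen p)) - K x‖ₑ := by
                rw [lintegral_sub_right_eq_self (fun x => ({x : ℝ | 2 * |y - cen p| ≤ |x|}.indicator 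
                  (fun x => ‖K (x - (y - cen p)) - K x‖ₑ)) x), lintegral_indicator]
                exact measurableSet_le measurable_const (by fun_prop)
            _ ≤ B := hB _
        · simp [bd_off hy]
    _ = B * ∫⁻ y, ‖bd f α y‖ₑ := lintegral_const_mul _ hb.sm.enorm
    _ ≤ _ := mul_le_mul' le_rfl (bd_lint hf)

theorem weak_one (hK : Nice K) {B M : ℝ≥0∞} {r : ℝ} (hr : 1 < r)
    (hB : ∀ y, ∫⁻ x in {x : ℝ | 2 * |y| ≤ |x|}, ‖K (x - y) - K x‖ₑ ≤ B)
    (hM : ∀ f : ℝ → E, Nice f → ∫⁻ x, ‖TT K f x‖ₑ ^ r ≤ M * ∫⁻ x, ‖f x‖ₑ ^ r)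
    (hf : Nice f) (hα : α ≠ 0) (hα' : α ≠ ⊤) :
    α * volume {x | α < ‖TT K f x‖ₑ} ≤ (4 ^ r * M + 2 + 4 * B) * ∫⁻ x, ‖f x‖ₑ := by
  have hg : Nice (gd f α) := gd_nice hf
  have hb : Nice (bd f α) := hf.sub hg
  have h2α : α / 2 ≠ 0 := by simp [hα]
  have h2α' : α / 2 ≠ ⊤ := by finiteness
  have hTg := TT_nice hK hg
  have hTb := TT_nice hK hb
  have hsub : {x | α < ‖TT K f x‖ₑ} ⊆ {x | α / 2 ≤ ‖TT K (gd f α) x‖ₑ} ∪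
      (Ost f α ∪ ((Ost f α)ᶜ ∩ {x | α / 2 ≤ ‖TT K (bd f α) x‖ₑ})) := by
    intro x hx
    by_contra hc
    simp only [Set.mem_union, Set.mem_inter_iff, Set.mem_ofPred_eq, not_or, not_and, not_le,
      Set.mem_compl_iff] at hc hx
    obtain ⟨h1, h2, h3⟩ := hc
    have h4 := h3 h2
    have e : TT K f x = TT K (gd f α) x + TT K (bd f α) x := by
      rw [← TT_add hK hg hb]; congr 1; ext y; simp [bd]
    rw [e] at hx
    have := (enorm_add_le _ _).trans_lt (ENNReal.add_lt_add h1 h4)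
    rw [ENNReal.add_halves] at this
    exact lt_asymm hx this
  have I1 : α * volume {x | α / 2 ≤ ‖TT K (gd f α) x‖ₑ} ≤ 4 ^ r * M * ∫⁻ x, ‖f x‖ₑ := by
    have c1 : (α/2)^r * volume {x | α / 2 ≤ ‖TT K (gd f α) x‖ₑ} ≤ M * ((2*α)^(r-1) * ∫⁻ x, ‖f x‖ₑ) := by
      calc (α/2)^r * volume {x | α / 2 ≤ ‖TT K (gd f α) x‖ₑ} 
          ≤ (α/2)^r * volume {x | (α / 2)^r ≤ ‖TT K (gd f α) x‖ₑ ^ r} := by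
            refine mul_le_mul' le_rfl (measure_mono fun x hx => ?_)
            exact ENNReal.rpow_le_rpow hx (by linarith)
        _ ≤ ∫⁻ x, ‖TT K (gd f α) x‖ₑ ^ r := 
            mul_meas_ge_le_lintegral (hTg.sm.enorm.pow_const r) _
        _ ≤ M * ∫⁻ x, ‖gd f α x‖ₑ ^ r := hM _ hg
        _ ≤ M * ∫⁻ x, (2*α)^(r-1) * ‖gd f α x‖ₑ := by
            refine mul_le_mul' le_rfl (lintegral_mono_ae ?_)
            filter_upwards [gd_bound hf hα] with x hx
            calc ‖gd f α x‖ₑ ^ r = ‖gd f α x‖ₑ ^ ((r-1) + 1) := by ring_nf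
              _ = ‖gd f α x‖ₑ ^ (r-1) * ‖gd f α x‖ₑ := by
                rw [ENNReal.rpow_add_of_nonneg _ _ (by linarith) (by norm_num), ENNReal.rpow_one]
              _ ≤ _ := mul_le_mul' (ENNReal.rpow_le_rpow hx (by linarith)) le_rfl
        _ ≤ _ := by
            rw [lintegral_const_mul _ hg.sm.enorm]
            exact mul_le_mul' le_rfl (mul_le_mul' le_rfl gd_lint)
    have hne : (α/2)^(r-1) ≠ 0 := by
      simp only [ne_eq, ENNReal.rpow_eq_zero_iff, not_or, not_and]
      exact ⟨fun h => absurd h h2α, fun h => absurd h h2α'⟩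
    have hne' : (α/2)^(r-1) ≠ ⊤ := ENNReal.rpow_ne_top_of_nonneg (by linarith) h2α'
    rw [← ENNReal.mul_le_mul_iff_right hne hne']
    have e1 : (α/2)^r = (α/2)^(r-1) * (α/2) := by
      conv_lhs => rw [show r = (r-1)+1 by ring]
      rw [ENNReal.rpow_add_of_nonneg _ _ (by linarith) (by norm_num), ENNReal.rpow_one]
    have e2 : 2 * α = 4 * (α/2) := by
      have : (4:ℝ≥0∞) = 2 * 2 := by norm_num
      rw [this, mul_assoc, ENNReal.mul_div_cancel (by norm_num) (by norm_num)]
    have e3 : α = 2 * (α/2) := (ENNReal.mul_div_cancel (by norm_num) (by norm_num)).symm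
    have e4 : (4:ℝ≥0∞)^r = 4 * 4^(r-1) := by
      conv_lhs => rw [show r = 1 + (r-1) by ring]
      rw [ENNReal.rpow_add_of_nonneg _ _ (by norm_num) (by linarith), ENNReal.rpow_one]
    calc (α/2)^(r-1) * (α * volume {x | α / 2 ≤ ‖TT K (gd f α) x‖ₑ}) 
        = 2 * ((α/2)^r * volume {x | α / 2 ≤ ‖TT K (gd f α) x‖ₑ}) := by
          rw [e1]; nth_rewrite 2 [e3]; ring
      _ ≤ 2 * (M * ((2*α)^(r-1) * ∫⁻ x, ‖f x‖ₑ)) := mul_le_mul' le_rfl c1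
      _ = 2 * (M * ((4^(r-1) * (α/2)^(r-1)) * ∫⁻ x, ‖f x‖ₑ)) := by
          rw [e2, ENNReal.mul_rpow_of_nonneg _ _ (by linarith)]
      _ ≤ 4 * (M * ((4^(r-1) * (α/2)^(r-1)) * ∫⁻ x, ‖f x‖ₑ)) := 
          mul_le_mul' (by norm_num) le_rfl
      _ = _ := by rw [e4]; ring
  have I3 : α * volume ((Ost f α)ᶜ ∩ {x | α / 2 ≤ ‖TT K (bd f α) x‖ₑ}) ≤ 4 * B * ∫⁻ x, ‖f x‖ₑ := by
    have h1 := mul_meas_ge_le_lintegral (μ := volume.restrict (Ost f α)ᶜ) hTb.sm.enorm (α/2)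
    rw [Measure.restrict_apply' Ost_meas.compl, Set.inter_comm] at h1
    calc α * volume ((Ost f α)ᶜ ∩ {x | α / 2 ≤ ‖TT K (bd f α) x‖ₑ})
        = 2 * ((α/2) * volume ((Ost f α)ᶜ ∩ {x | α / 2 ≤ ‖TT K (bd f α) x‖ₑ})) := by
          rw [← mul_assoc, ENNReal.mul_div_cancel (by norm_num) (by norm_num)]
      _ ≤ 2 * (B * (2 * ∫⁻ x, ‖f x‖ₑ)) := mul_le_mul' le_rfl (h1.trans (TT_bd_bound hK hf hB))
      _ = _ := by
          have : (4:ℝ≥0∞) = 2 * 2 := by norm_num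
          rw [this]; ring
  calc α * volume {x | α < ‖TT K f x‖ₑ} ≤ α * (volume {x | α / 2 ≤ ‖TT K (gd f α) x‖ₑ} +
        (volume (Ost f α) + volume ((Ost f α)ᶜ ∩ {x | α / 2 ≤ ‖TT K (bd f α) x‖ₑ}))) := by
        refine mul_le_mul' le_rfl ((measure_mono hsub).trans ((measure_union_le _ _).trans ?_))
        exact add_le_add le_rfl (measure_union_le _ _)
    _ = α * volume {x | α / 2 ≤ ‖TT K (gd f α) x‖ₑ} + (α * volume (Ost f α) 
        + α * volume ((Ost f α)ᶜ ∩ {x | α / 2 ≤ ‖TT K (bd f α) x‖ₑ})) := by ring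
    _ ≤ 4 ^ r * M * (∫⁻ x, ‖f x‖ₑ) + (2 * (∫⁻ x, ‖f x‖ₑ) + 4 * B * ∫⁻ x, ‖f x‖ₑ) :=
        add_le_add I1 (add_le_add Ost_vol I3)
    _ = _ := by ring
end weak

end

section
set_option linter.unusedSectionVars false

section marc0
variable {E : Type*} [NormedAddCommGroup E]

lemma low_sum' (r q : ℝ) (hq : 0 < q) (hqr : q < r) : ∃ C : ℝ≥0, ∀ z : E,
    ∑' m : ℤ, ENNReal.ofReal (((2:ℝ)^m) ^ (q-r)) * (if ‖z‖ ≤ (2:ℝ)^m then ‖z‖ₑ ^ r else 0) ≤ C * ‖z‖ₑ ^ q := by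
  obtain ⟨C, hC⟩ := geo_high (r - q) (by linarith)
  refine ⟨C, fun z => ?_⟩
  have hr : 0 < r := by linarith
  rcases eq_or_ne z 0 with rfl | hz
  · simp [hq, hr]
  have hz' : 0 < ‖z‖ := norm_pos_iff.2 hz
  have h1 := hC ‖z‖ hz'
  calc _ = (∑' m : ℤ, (if ‖z‖ ≤ (2:ℝ)^m then ENNReal.ofReal (((2:ℝ)^m) ^ (-(r-q))) else 0)) * ‖z‖ₑ ^ r := by
        rw [← ENNReal.tsum_mul_right]
        congr 1; ext m
        split_ifs <;> simp
    _ ≤ C * ENNReal.ofReal (‖z‖ ^ (-(r-q))) * ‖z‖ₑ ^ r := by gcongr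
    _ = _ := by
        rw [mul_assoc, ← ofReal_norm, ofReal_rpow_of_nonneg (norm_nonneg _) hr.le, ← ofReal_mul (by positivity),
          ofReal_rpow_of_nonneg (norm_nonneg _) hq.le]
        congr 2
        rw [← Real.rpow_add hz']
        congr 1; ring

lemma layer_sum' (s : ℝ) (hs : 0 < s) (z : E) :
    ‖z‖ₑ ^ s ≤ ∑' m : ℤ, ENNReal.ofReal (((2:ℝ)^(m+1)) ^ s) * (if (2:ℝ)^m < ‖z‖ then (1:ℝ≥0∞) else 0) := by
  have := layer_sum s hs ((‖z‖:ℝ):ℂ)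
  have e : ‖((‖z‖:ℝ):ℂ)‖ₑ = ‖z‖ₑ := by rw [← ofReal_norm, ← ofReal_norm]; simp
  simpa [e] using this

end marc0

section marc
variable {E F : Type*} [NormedAddCommGroup E] [NormedSpace ℂ E] [CompleteSpace E]
  [SecondCountableTopology E] [NormedAddCommGroup F] [NormedSpace ℂ F] [CompleteSpace F]

/-- Low part. -/
def flo (f : ℝ → E) (m : ℤ) (x : ℝ) : E := if ‖f x‖ ≤ (2:ℝ)^m then f x else 0
/-- High part. -/
def fhi (f : ℝ → E) (m : ℤ) (x : ℝ) : E := if (2:ℝ)^m < ‖f x‖ then f x else 0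

variable {K : ℝ → E →L[ℂ] F} {f : ℝ → E}

lemma flo_nice (hf : Nice f) (m : ℤ) : Nice (flo f m) := by
  refine hf.mono ?_ fun x => ?_
  · exact StronglyMeasurable.ite (measurableSet_le hf.sm.norm.measurable measurable_const) hf.sm
      stronglyMeasurable_const
  · unfold flo; split_ifs <;> simp

lemma fhi_nice (hf : Nice f) (m : ℤ) : Nice (fhi f m) := by
  refine hf.mono ?_ fun x => ?_
  · exact StronglyMeasurable.ite (measurableSet_lt measurable_const hf.sm.norm.measurable) hf.sm
      stronglyMeasurable_const
  · unfold fhi; split_ifs <;> simp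

theorem marc (r q : ℝ) (hq : 1 < q) (hqr : q < r) : ∃ C : ℝ≥0, 
    ∀ (E F : Type) [NormedAddCommGroup E] [NormedSpace ℂ E] [CompleteSpace E]
    [SecondCountableTopology E] [NormedAddCommGroup F] [NormedSpace ℂ F] [CompleteSpace F],
    ∀ (K : ℝ → E →L[ℂ] F), Nice K →
    ∀ M D : ℝ≥0∞,
    (∀ f : ℝ → E, Nice f → ∫⁻ x, ‖TT K f x‖ₑ ^ r ≤ M * ∫⁻ x, ‖f x‖ₑ ^ r) →
    (∀ f : ℝ → E, Nice f → ∀ α : ℝ≥0∞, α ≠ 0 → α ≠ ⊤ →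
      α * volume {x | α < ‖TT K f x‖ₑ} ≤ D * ∫⁻ x, ‖f x‖ₑ) →
    ∀ f : ℝ → E, Nice f → ∫⁻ x, ‖TT K f x‖ₑ ^ q ≤ C * (M + D) * ∫⁻ x, ‖f x‖ₑ ^ q := by
  obtain ⟨C1, hC1⟩ := low_sum' (E := ℂ) r q (by linarith) hqr
  obtain ⟨C2, hC2⟩ := high_sum q hq
  refine ⟨Real.toNNReal ((2:ℝ)^(q+r)) * (C1 + C2), ?_⟩
  intro E F _ _ _ _ _ _ _ K hK M D hM hD f hf
  replace hC1 : ∀ z : E, ∑' m : ℤ, ENNReal.ofReal (((2:ℝ)^m) ^ (q-r)) * 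
      (if ‖z‖ ≤ (2:ℝ)^m then ‖z‖ₑ ^ r else 0) ≤ C1 * ‖z‖ₑ ^ q := by
    intro z
    have e : ‖((‖z‖:ℝ):ℂ)‖ₑ = ‖z‖ₑ := by rw [← ofReal_norm, ← ofReal_norm]; simp
    simpa [e] using hC1 ((‖z‖:ℝ):ℂ)
  replace hC2 : ∀ z : E, ∑' m : ℤ, ENNReal.ofReal (((2:ℝ)^m) ^ (q-1)) * 
      (if (2:ℝ)^m < ‖z‖ then ‖z‖ₑ else 0) ≤ C2 * ‖z‖ₑ ^ q := by
    intro z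
    have e : ‖((‖z‖:ℝ):ℂ)‖ₑ = ‖z‖ₑ := by rw [← ofReal_norm, ← ofReal_norm]; simp
    simpa [e] using hC2 ((‖z‖:ℝ):ℂ)
  have hr : 0 < r := by linarith
  have hTf := TT_nice hK hf
  have hcoef1 : ∀ m : ℤ, ENNReal.ofReal (((2:ℝ)^(m+1)) ^ q) * ENNReal.ofReal (((2:ℝ)^(m-1)) ^ (-r))
      = ENNReal.ofReal ((2:ℝ)^(q+r)) * ENNReal.ofReal (((2:ℝ)^m)^(q-r)) := by
    intro m
    rw [← ofReal_mul (by positivity), ← ofReal_mul (by positivity)]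
    congr 1
    rw [← Real.rpow_intCast, ← Real.rpow_intCast, ← Real.rpow_intCast, ← Real.rpow_mul (by norm_num),
      ← Real.rpow_mul (by norm_num), ← Real.rpow_mul (by norm_num),
      ← Real.rpow_add (by norm_num), ← Real.rpow_add (by norm_num)]
    congr 1; push_cast; ring
  have hcoef2 : ∀ m : ℤ, ENNReal.ofReal (((2:ℝ)^(m+1)) ^ q) * ENNReal.ofReal (((2:ℝ)^(m-1))⁻¹)
      ≤ ENNReal.ofReal ((2:ℝ)^(q+r)) * ENNReal.ofReal (((2:ℝ)^m)^(q-1)) := by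
    intro m
    rw [← ofReal_mul (by positivity), ← ofReal_mul (by positivity)]
    refine ofReal_le_ofReal ?_
    have e : ((2:ℝ)^(m+1)) ^ q * ((2:ℝ)^(m-1))⁻¹ = (2:ℝ)^(q+1) * ((2:ℝ)^m)^(q-1) := by
      rw [← Real.rpow_neg_one, ← Real.rpow_intCast, ← Real.rpow_intCast, ← Real.rpow_intCast, ← Real.rpow_mul (by norm_num),
        ← Real.rpow_mul (by norm_num), ← Real.rpow_mul (by norm_num),
        ← Real.rpow_add (by norm_num), ← Real.rpow_add (by norm_num)]
      congr 1; push_cast; ring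
    rw [e]
    gcongr
    · norm_num
    · linarith
  have hdist : ∀ m : ℤ, volume {x | (2:ℝ)^m < ‖TT K f x‖} ≤
      ENNReal.ofReal (((2:ℝ)^(m-1)) ^ (-r)) * (M * ∫⁻ x, ‖flo f m x‖ₑ ^ r) +
      ENNReal.ofReal (((2:ℝ)^(m-1))⁻¹) * (D * ∫⁻ x, ‖fhi f m x‖ₑ) := by
    intro m
    have hlo := flo_nice hf m
    have hhi := fhi_nice hf m
    set a : ℝ := (2:ℝ)^(m-1) with ha
    have hap : 0 < a := by positivity
    have hsub : {x | (2:ℝ)^m < ‖TT K f x‖} ⊆ {x | ENNReal.ofReal a ≤ ‖TT K (flo f m) x‖ₑ} ∪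
        {x | ENNReal.ofReal a < ‖TT K (fhi f m) x‖ₑ} := by
      intro x hx
      by_contra hc
      simp only [Set.mem_union, Set.mem_ofPred_eq, not_or, not_le, not_lt] at hc hx
      rw [← ofReal_norm, ← ofReal_norm, ofReal_lt_ofReal_iff hap, ofReal_le_ofReal_iff hap.le] at hc
      have e : TT K f x = TT K (flo f m) x + TT K (fhi f m) x := by
        rw [← TT_add hK hlo hhi]; congr 1; ext y
        unfold flo fhi
        by_cases h : ‖f y‖ ≤ (2:ℝ)^m
        · simp [h, not_lt.2 h]
        · simp [h, not_le.1 h]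
      rw [e] at hx
      have e2 : (2:ℝ)^m = a + a := by rw [ha, zpow_sub_one₀ (by norm_num)]; ring
      have := norm_add_le (TT K (flo f m) x) (TT K (fhi f m) x)
      linarith
    refine (measure_mono hsub).trans ((measure_union_le _ _).trans (add_le_add ?_ ?_))
    · have h1 : ENNReal.ofReal (a^r) * volume {x | ENNReal.ofReal a ≤ ‖TT K (flo f m) x‖ₑ} ≤ 
          M * ∫⁻ x, ‖flo f m x‖ₑ ^ r := by
        refine le_trans ?_ (hM _ hlo)
        refine le_trans (mul_le_mul' le_rfl (measure_mono fun x hx => ?_))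
          (mul_meas_ge_le_lintegral ((TT_nice hK hlo).sm.enorm.pow_const r) _)
        rw [← ofReal_rpow_of_nonneg hap.le hr.le]
        exact ENNReal.rpow_le_rpow hx hr.le
      calc _ = ENNReal.ofReal (a^(-r)) * (ENNReal.ofReal (a^r) * volume {x | ENNReal.ofReal a ≤ ‖TT K (flo f m) x‖ₑ}) := by
            rw [← mul_assoc, ← ofReal_mul (by positivity), ← Real.rpow_add hap]; simp
        _ ≤ _ := mul_le_mul' le_rfl h1
    · have h1 := hD _ hhi (ENNReal.ofReal a) (by simp [hap]) (by simp)
      calc _ = ENNReal.ofReal (a⁻¹) * (ENNReal.ofReal a * volume {x | ENNReal.ofReal a < ‖TT K (fhi f m) x‖ₑ}) := by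
            rw [← mul_assoc, ← ofReal_mul (by positivity), inv_mul_cancel₀ hap.ne']; simp
        _ ≤ _ := mul_le_mul' le_rfl h1
  have hc0 : ENNReal.ofReal ((2:ℝ)^(q+r)) = ((Real.toNNReal ((2:ℝ)^(q+r)) : ℝ≥0) : ℝ≥0∞) := rfl
  set c := ENNReal.ofReal ((2:ℝ)^(q+r)) with hc
  have hlow : ∑' m : ℤ, ENNReal.ofReal (((2:ℝ)^m)^(q-r)) * ∫⁻ x, ‖flo f m x‖ₑ ^ r ≤ C1 * ∫⁻ x, ‖f x‖ₑ ^ q := by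
    calc _ = ∑' m : ℤ, ∫⁻ x, ENNReal.ofReal (((2:ℝ)^m)^(q-r)) * ‖flo f m x‖ₑ ^ r := by
          congr 1; ext m
          rw [lintegral_const_mul _ ((flo_nice hf m).sm.enorm.pow_const r)]
      _ = ∫⁻ x, ∑' m : ℤ, ENNReal.ofReal (((2:ℝ)^m)^(q-r)) * ‖flo f m x‖ₑ ^ r := by
          rw [lintegral_tsum]
          intro m
          exact (((flo_nice hf m).sm.enorm.pow_const r).const_mul _).aemeasurable
      _ ≤ ∫⁻ x, C1 * ‖f x‖ₑ ^ q := by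
          refine lintegral_mono fun x => le_trans (le_of_eq ?_) (hC1 (f x))
          congr 1; ext m
          unfold flo
          split_ifs <;> simp [hr]
      _ = _ := lintegral_const_mul _ (hf.sm.enorm.pow_const q)
  have hhigh : ∑' m : ℤ, ENNReal.ofReal (((2:ℝ)^m)^(q-1)) * ∫⁻ x, ‖fhi f m x‖ₑ ≤ C2 * ∫⁻ x, ‖f x‖ₑ ^ q := by
    calc _ = ∑' m : ℤ, ∫⁻ x, ENNReal.ofReal (((2:ℝ)^m)^(q-1)) * ‖fhi f m x‖ₑ := by
          congr 1; ext m
          rw [lintegral_const_mul _ ((fhi_nice hf m).sm.enorm)]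
      _ = ∫⁻ x, ∑' m : ℤ, ENNReal.ofReal (((2:ℝ)^m)^(q-1)) * ‖fhi f m x‖ₑ := by
          rw [lintegral_tsum]
          intro m
          exact (((fhi_nice hf m).sm.enorm).const_mul _).aemeasurable
      _ ≤ ∫⁻ x, C2 * ‖f x‖ₑ ^ q := by
          refine lintegral_mono fun x => le_trans (le_of_eq ?_) (hC2 (f x))
          congr 1; ext m
          unfold fhi
          split_ifs <;> simp
      _ = _ := lintegral_const_mul _ (hf.sm.enorm.pow_const q)
  have hms : ∀ m : ℤ, MeasurableSet {x | (2:ℝ)^m < ‖TT K f x‖} := fun m =>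
    measurableSet_lt measurable_const hTf.sm.norm.measurable
  calc ∫⁻ x, ‖TT K f x‖ₑ ^ q ≤ ∫⁻ x, ∑' m : ℤ, ENNReal.ofReal (((2:ℝ)^(m+1)) ^ q) * 
        ({x | (2:ℝ)^m < ‖TT K f x‖}.indicator 1 x) := by
        refine lintegral_mono fun x => (layer_sum' q (by linarith) _).trans (le_of_eq ?_)
        simp [Set.indicator]
    _ = ∑' m : ℤ, ENNReal.ofReal (((2:ℝ)^(m+1)) ^ q) * volume {x | (2:ℝ)^m < ‖TT K f x‖} := by
        rw [lintegral_tsum fun m => ((measurable_one.indicator (hms m)).const_mul _).aemeasurable]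
        congr 1; ext m
        rw [lintegral_const_mul _ (measurable_one.indicator (hms m)), lintegral_indicator_one (hms m)]
    _ ≤ ∑' m : ℤ, (c * M * (ENNReal.ofReal (((2:ℝ)^m)^(q-r)) * ∫⁻ x, ‖flo f m x‖ₑ ^ r) +
          c * D * (ENNReal.ofReal (((2:ℝ)^m)^(q-1)) * ∫⁻ x, ‖fhi f m x‖ₑ)) := by
        refine ENNReal.tsum_le_tsum fun m => (mul_le_mul' le_rfl (hdist m)).trans ?_
        rw [mul_add]
        refine add_le_add ?_ ?_
        · rw [← mul_assoc, hcoef1]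
          exact le_of_eq (by ring)
        · rw [← mul_assoc]
          exact (mul_le_mul' (hcoef2 m) le_rfl).trans (le_of_eq (by ring))
    _ ≤ c * M * (C1 * ∫⁻ x, ‖f x‖ₑ ^ q) + c * D * (C2 * ∫⁻ x, ‖f x‖ₑ ^ q) := by
        rw [ENNReal.tsum_add, ENNReal.tsum_mul_left, ENNReal.tsum_mul_left]
        exact add_le_add (mul_le_mul' le_rfl hlow) (mul_le_mul' le_rfl hhigh)
    _ ≤ c * M * ((C1 + C2) * ∫⁻ x, ‖f x‖ₑ ^ q) + c * D * ((C1 + C2) * ∫⁻ x, ‖f x‖ₑ ^ q) := by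
        gcongr
        · exact le_self_add
        · exact le_add_self
    _ = _ := by rw [ENNReal.coe_mul, ← hc0, ENNReal.coe_add]; ring

/-- Calderon-Zygmund: from `L^r` to `L^q`, `1<q<r`. -/
theorem cz (r q : ℝ) (hq : 1 < q) (hqr : q < r) (M B : ℝ≥0) : ∃ C : ℝ≥0,
    ∀ (E F : Type) [NormedAddCommGroup E] [NormedSpace ℂ E] [CompleteSpace E]
    [SecondCountableTopology E] [NormedAddCommGroup F] [NormedSpace ℂ F] [CompleteSpace F],
    ∀ (K : ℝ → E →L[ℂ] F), Nice K →
    (∀ y, ∫⁻ x in {x : ℝ | 2 * |y| ≤ |x|}, ‖K (x - y) - K x‖ₑ ≤ B) →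
    (∀ f : ℝ → E, Nice f → ∫⁻ x, ‖TT K f x‖ₑ ^ r ≤ M * ∫⁻ x, ‖f x‖ₑ ^ r) →
    ∀ f : ℝ → E, Nice f → ∫⁻ x, ‖TT K f x‖ₑ ^ q ≤ C * ∫⁻ x, ‖f x‖ₑ ^ q := by
  obtain ⟨C, hC⟩ := marc r q hq hqr
  refine ⟨C * (M + ((4:ℝ≥0∞)^r * M + 2 + 4 * B).toNNReal), ?_⟩
  intro E F _ _ _ _ _ _ _ K hK hB hM f hf
  have hne : ((4:ℝ≥0∞)^r * M + 2 + 4 * B) ≠ ⊤ := by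
    have : (4:ℝ≥0∞)^r ≠ ⊤ := ENNReal.rpow_ne_top_of_nonneg (by linarith) (by norm_num)
    finiteness
  have := hC E F K hK M _ hM (fun f hf α hα hα' => weak_one hK (by linarith) hB hM hf hα hα') f hf
  rwa [← ENNReal.coe_toNNReal hne, ← ENNReal.coe_add, ← ENNReal.coe_mul] at this
end marc

end

section
set_option linter.unusedSectionVars false

lemma cv_adj {φ f w : ℝ → ℂ} (hφ : Nice φ) (hf : Nice f) (hw : Nice w) :
    ∫ x, f x * cv (fun z => φ (-z)) w x = ∫ x, cv φ f x * w x := by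
  obtain ⟨D, hD0, hD⟩ := hφ.bdd'
  have hi : Integrable (Function.uncurry fun x y => f x * (w y * φ (-(x - y)))) (volume.prod volume) := by
    have h1 := (hf.int.mul_prod hw.int).bdd_mul (c := D) (f := fun p : ℝ × ℝ => φ (-(p.1 - p.2)))
      ((hφ.sm.comp_measurable (g := fun p : ℝ × ℝ => -(p.1 - p.2)) (by fun_prop)).aestronglyMeasurable)
      (Filter.Eventually.of_forall fun p => hD _)
    refine h1.congr (Filter.Eventually.of_forall fun p => ?_)
    simp only [Function.uncurry]; ring
  unfold cv
  calc _ = ∫ x, ∫ y, f x * (w y * φ (-(x - y))) := by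
        congr 1; ext x; rw [integral_const_mul]
    _ = ∫ y, ∫ x, f x * (w y * φ (-(x - y))) := integral_integral_swap hi
    _ = _ := by
        congr 1; ext y
        rw [← integral_mul_const]
        congr 1; ext x
        rw [neg_sub]; ring

/-- Signed power. -/
def sgp (q : ℝ) (z : ℂ) : ℂ := (starRingEnd ℂ) z * ((‖z‖ ^ (q - 2) : ℝ) : ℂ)

lemma sgp_meas (q : ℝ) : Measurable (sgp q) := by
  unfold sgp; fun_prop

lemma sgp_mul {q : ℝ} (hq : 1 < q) (z : ℂ) : z * sgp q z = ((‖z‖ ^ q : ℝ) : ℂ) := by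
  unfold sgp
  rcases eq_or_ne z 0 with rfl | hz
  · rw [norm_zero, Real.zero_rpow (by linarith : q ≠ 0)]; simp
  have hz' : 0 < ‖z‖ := norm_pos_iff.2 hz
  rw [← mul_assoc, Complex.mul_conj, Complex.normSq_eq_norm_sq, ← Complex.ofReal_mul,
    ← Real.rpow_natCast, ← Real.rpow_add hz']
  congr 2; push_cast; ring

lemma sgp_norm {q : ℝ} (hq : 1 < q) (z : ℂ) : ‖sgp q z‖ = ‖z‖ ^ (q - 1) := by
  unfold sgp
  rcases eq_or_ne z 0 with rfl | hz
  · rw [norm_zero, Real.zero_rpow (by linarith : q - 1 ≠ 0)]; simp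
  have hz' : 0 < ‖z‖ := norm_pos_iff.2 hz
  rw [norm_mul, Complex.norm_conj, Complex.norm_real, Real.norm_of_nonneg (by positivity)]
  nth_rw 1 [← Real.rpow_one ‖z‖]
  rw [← Real.rpow_add hz']
  congr 1; ring

section dual
variable {E F E' F' : Type*} [NormedAddCommGroup E] [NormedAddCommGroup F]
  [NormedAddCommGroup E'] [NormedAddCommGroup F']

theorem dual (bE : E → E' → ℂ) (bF : F → F' → ℂ) (hbE : ∀ e e', ‖bE e e'‖ ≤ ‖e‖ * ‖e'‖)
    (T : (ℝ → E) → ℝ → F) (S : (ℝ → F') → ℝ → E')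
    (hT : ∀ f, Nice f → Nice (T f)) (hS : ∀ w, Nice w → Nice (S w))
    (pair : ∀ f w, Nice f → Nice w → ∫ x, bF (T f x) (w x) = ∫ x, bE (f x) (S w x))
    {q q' : ℝ} (hqq : q.HolderConjugate q')
    (norming : ∀ u : ℝ → F, Nice u → ∀ R : ℝ, ∃ w : ℝ → F', Nice w ∧
      ∀ x, bF (u x) (w x) = ((if |x| ≤ R then ‖u x‖ ^ q else 0 : ℝ) : ℂ) ∧
        ‖w x‖ ≤ if |x| ≤ R then ‖u x‖ ^ (q - 1) else 0)
    (C : ℝ≥0) (hC : ∀ w, Nice w → ∫⁻ x, ‖S w x‖ₑ ^ q' ≤ C * ∫⁻ x, ‖w x‖ₑ ^ q')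
    (f : ℝ → E) (hf : Nice f) :
    ∫⁻ x, ‖T f x‖ₑ ^ q ≤ (C ^ (q / q') : ℝ≥0) * ∫⁻ x, ‖f x‖ₑ ^ q := by
  have hq1 : 1 < q := hqq.lt
  have hq0 : 0 < q := by linarith
  have hq'0 : 0 < q' := hqq.symm.pos
  have hu := hT f hf
  set u := T f with hudef
  have key : ∀ n : ℕ, ∫⁻ x in {x : ℝ | |x| ≤ n}, ‖u x‖ₑ ^ q ≤ (C ^ (q / q') : ℝ≥0) * ∫⁻ x, ‖f x‖ₑ ^ q := by
    intro n
    have hms : MeasurableSet {x : ℝ | |x| ≤ n} := measurableSet_le (by fun_prop) measurable_const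
    set X := ∫⁻ x in {x : ℝ | |x| ≤ n}, ‖u x‖ₑ ^ q with hX
    set Y := ∫⁻ x, ‖f x‖ₑ ^ q with hY
    have hXi : X = ∫⁻ x, ENNReal.ofReal (if |x| ≤ (n:ℝ) then ‖u x‖ ^ q else 0) := by
      rw [hX, ← lintegral_indicator hms]
      congr 1; ext x
      simp only [Set.indicator, Set.mem_ofPred_eq]
      split_ifs
      · rw [← ofReal_norm, ofReal_rpow_of_nonneg (norm_nonneg _) hq0.le]
      · simp
    have hXfin : X ≠ ⊤ := by
      obtain ⟨D, hD0, hD⟩ := hu.bdd'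
      refine ne_top_of_le_ne_top (b := ENNReal.ofReal D ^ q * volume {x : ℝ | |x| ≤ n}) ?_ ?_
      · have : {x : ℝ | |x| ≤ n} = Set.Icc (-(n:ℝ)) n := by ext x; simp [abs_le]
        rw [this, Real.volume_Icc]
        have : ENNReal.ofReal D ^ q ≠ ⊤ := ENNReal.rpow_ne_top_of_nonneg hq0.le (by simp)
        finiteness
      · rw [← setLIntegral_const]
        refine lintegral_mono fun x => ENNReal.rpow_le_rpow ?_ hq0.le
        rw [← ofReal_norm]; exact ofReal_le_ofReal (hD x)
    obtain ⟨w, hw, hw2⟩ := norming u hu n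
    have hWX : ∫⁻ x, ‖w x‖ₑ ^ q' ≤ X := by
      rw [hXi]
      refine lintegral_mono fun x => ?_
      rw [← ofReal_norm, ofReal_rpow_of_nonneg (norm_nonneg _) hq'0.le]
      refine ofReal_le_ofReal ?_
      have h2 := (hw2 x).2
      split_ifs at h2 ⊢
      · calc ‖w x‖ ^ q' ≤ (‖u x‖ ^ (q-1)) ^ q' := by gcongr
          _ = _ := by
            rw [← Real.rpow_mul (norm_nonneg _)]
            congr 1
            have := hqq.sub_one_mul_conj
            linarith
      · have : ‖w x‖ = 0 := le_antisymm h2 (norm_nonneg _)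
        rw [this, Real.zero_rpow hq'0.ne']
    have hXle : X ≤ Y ^ (1/q) * (C * X) ^ (1/q') := by
      calc X = ‖∫ x : ℝ, ((if |x| ≤ (n:ℝ) then ‖u x‖ ^ q else 0 : ℝ) : ℂ)‖ₑ := by
            have e1 : ∫ x : ℝ, ((if |x| ≤ (n:ℝ) then ‖u x‖ ^ q else 0 : ℝ) : ℂ) = 
                ((∫ x : ℝ, (if |x| ≤ (n:ℝ) then ‖u x‖ ^ q else 0 : ℝ) : ℝ) : ℂ) := integral_ofReal
            rw [e1, ← ofReal_norm, Complex.norm_real, Real.norm_of_nonneg (integral_nonneg fun x => by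
              simp only [Pi.zero_apply]; split_ifs <;> positivity)]
            have hm : Measurable fun x : ℝ => (if |x| ≤ (n:ℝ) then ‖u x‖ ^ q else 0 : ℝ) :=
              Measurable.ite hms (hu.sm.norm.measurable.pow_const q) measurable_const
            rw [ofReal_integral_eq_lintegral_ofReal, hXi]
            · refine ⟨hm.aestronglyMeasurable, ?_⟩
              refine lt_of_le_of_lt (le_of_eq ?_) hXfin.lt_top
              rw [hXi]
              refine lintegral_congr fun x => ?_
              rw [← ofReal_norm, Real.norm_of_nonneg]
              show (0:ℝ) ≤ if |x| ≤ (n:ℝ) then ‖u x‖ ^ q else 0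
              split_ifs <;> positivity
            · refine Filter.Eventually.of_forall fun x => ?_
              show (0:ℝ) ≤ if |x| ≤ (n:ℝ) then ‖u x‖ ^ q else 0
              split_ifs <;> positivity
        _ = ‖∫ x, bE (f x) (S w x)‖ₑ := by
            rw [← pair f w hf hw]
            congr 2; ext x
            exact (hw2 x).1.symm
        _ ≤ ∫⁻ x, ‖bE (f x) (S w x)‖ₑ := enorm_integral_le_lintegral_enorm _
        _ ≤ ∫⁻ x, ‖f x‖ₑ * ‖S w x‖ₑ := by
            refine lintegral_mono fun x => ?_
            rw [← ofReal_norm, ← ofReal_norm, ← ofReal_norm, ← ofReal_mul (norm_nonneg _)]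
            exact ofReal_le_ofReal (hbE _ _)
        _ ≤ Y ^ (1/q) * (∫⁻ x, ‖S w x‖ₑ ^ q') ^ (1/q') := 
            lintegral_mul_le_Lp_mul_Lq volume hqq hf.sm.enorm.aemeasurable (hS w hw).sm.enorm.aemeasurable
        _ ≤ _ := by
            refine mul_le_mul' le_rfl (ENNReal.rpow_le_rpow ((hC w hw).trans ?_) (by positivity))
            exact mul_le_mul' le_rfl hWX
    rcases eq_or_ne X 0 with h0 | h0
    · rw [h0]; exact zero_le
    have hXp : X ^ (1/q') ≠ 0 := by
      simp [ENNReal.rpow_eq_zero_iff, h0, hXfin]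
    have hXp' : X ^ (1/q') ≠ ⊤ := ENNReal.rpow_ne_top_of_nonneg (by positivity) hXfin
    have hsum : 1/q + 1/q' = 1 := by simpa using hqq.inv_add_inv_eq_one
    have h3 : X ^ (1/q) ≤ Y ^ (1/q) * (C:ℝ≥0∞) ^ (1/q') := by
      rw [← ENNReal.mul_le_mul_iff_right hXp hXp']
      calc X ^ (1/q') * X ^ (1/q) = X := by
            rw [← ENNReal.rpow_add _ _ h0 hXfin, add_comm, hsum, ENNReal.rpow_one]
        _ ≤ _ := hXle
        _ = _ := by rw [ENNReal.mul_rpow_of_nonneg _ _ (by positivity)]; ring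
    have h4 := ENNReal.rpow_le_rpow h3 hq0.le
    rw [ENNReal.mul_rpow_of_nonneg _ _ hq0.le, ← ENNReal.rpow_mul, ← ENNReal.rpow_mul, ← ENNReal.rpow_mul,
      one_div_mul_cancel hq0.ne', ENNReal.rpow_one, ENNReal.rpow_one] at h4
    rw [ENNReal.coe_rpow_of_nonneg _ (by positivity), mul_comm]
    convert h4 using 3
    ring
  have hun : (⋃ n : ℕ, {x : ℝ | |x| ≤ n}) = Set.univ := by
    ext x
    simp only [Set.mem_iUnion, Set.mem_ofPred_eq, Set.mem_univ, iff_true]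
    exact exists_nat_ge |x|
  rw [← setLIntegral_univ, ← hun, setLIntegral_iUnion_of_directed]
  · exact iSup_le key
  · refine directed_of_isDirected_le fun a b hab x hx => ?_
    simp only [Set.mem_ofPred_eq] at hx ⊢
    exact hx.trans (by exact_mod_cast hab)
end dual

end

section
set_option linter.unusedSectionVars false

section czk
lemma enorm_sum_le_aux {ι E : Type*} [SeminormedAddCommGroup E] (s : Finset ι) (f : ι → E) :
    ‖∑ i ∈ s, f i‖ₑ ≤ ∑ i ∈ s, ‖f i‖ₑ := by
  simp_rw [← ofReal_norm]
  rw [← ofReal_sum_of_nonneg fun _ _ => norm_nonneg _]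
  exact ofReal_le_ofReal (norm_sum_le _ _)
variable {Ψ ψ : ℝ → ℂ} {A : ℝ}

lemma Ker.refl (hk : Ker Ψ ψ A) : Ker (fun x => - Ψ (-x)) (fun x => ψ (-x)) A := by
  have hP : ∀ x, Phi (-x) = Phi x := fun x => by unfold Phi; rw [neg_sq]
  obtain ⟨ψ', h1, h2⟩ := hk.dψ
  refine ⟨hk.A_pos, fun x => ?_, fun x => ?_, fun x => ?_, fun x => - ψ' (-x), fun x => ?_, fun x => ?_⟩
  · have := ((hk.hΨ (-x)).scomp x (hasDerivAt_neg x)).neg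
    simp only [Function.comp_def, neg_smul, one_smul, neg_neg] at this
    exact this
  · rw [norm_neg]; simpa [hP] using hk.bΨ (-x)
  · simpa [hP] using hk.bψ (-x)
  · simpa [Function.comp_def] using ((h1 (-x)).scomp x (hasDerivAt_neg x))
  · rw [norm_neg]; simpa [hP] using h2 (-x)

lemma Nice.smul_const {E : Type*} [NormedAddCommGroup E] [NormedSpace ℂ E] {φ : ℝ → ℂ} (h : Nice φ) (v : E) :
    Nice (fun x => φ x • v) := by
  obtain ⟨D, hD0, hD⟩ := h.bdd'
  refine ⟨h.sm.smul_const v, h.int.smul_const v, D * ‖v‖, fun x => ?_⟩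
  rw [norm_smul]
  gcongr
  exact hD x

/-- The operator valued kernel. -/
def KK {E F : Type*} [NormedAddCommGroup E] [NormedSpace ℂ E] [NormedAddCommGroup F] [NormedSpace ℂ F]
    (ψ : ℝ → ℂ) (j0 : ℤ) {L : ℕ} (Lop : Fin L → E →L[ℂ] F) (z : ℝ) : E →L[ℂ] F :=
  ∑ j : Fin L, dil ψ (j0 + (j:ℕ)) z • Lop j

lemma KK_nice {E F : Type*} [NormedAddCommGroup E] [NormedSpace ℂ E] [NormedAddCommGroup F] [NormedSpace ℂ F]
    (hk : Ker Ψ ψ A) (j0 : ℤ) {L : ℕ} (Lop : Fin L → E →L[ℂ] F) : Nice (KK ψ j0 Lop) := by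
  unfold KK
  exact Nice.sum _ fun j => (hk.dnice _).smul_const _

theorem Ker.czk (hk : Ker Ψ ψ A) (r q : ℝ) (hq : 1 < q) (hqr : q < r) (M : ℝ≥0) : ∃ C : ℝ≥0,
    ∀ (E F : Type) [NormedAddCommGroup E] [NormedSpace ℂ E] [CompleteSpace E]
    [SecondCountableTopology E] [NormedAddCommGroup F] [NormedSpace ℂ F] [CompleteSpace F],
    ∀ (j0 : ℤ) (L : ℕ) (Lop : Fin L → E →L[ℂ] F), (∀ j, ‖Lop j‖ ≤ 1) →
    (∀ f : ℝ → E, Nice f → ∫⁻ x, ‖TT (KK ψ j0 Lop) f x‖ₑ ^ r ≤ M * ∫⁻ x, ‖f x‖ₑ ^ r) →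
    ∀ f : ℝ → E, Nice f → ∫⁻ x, ‖TT (KK ψ j0 Lop) f x‖ₑ ^ q ≤ C * ∫⁻ x, ‖f x‖ₑ ^ q := by
  obtain ⟨B, hB⟩ := hk.horm
  obtain ⟨C, hC⟩ := cz r q hq hqr M B
  refine ⟨C, fun E F _ _ _ _ _ _ _ j0 L Lop hL hM => ?_⟩
  refine hC E F _ (KK_nice hk j0 Lop) (fun y => ?_) hM
  refine le_trans ?_ (hB y)
  have hm : ∀ j, Measurable fun x => ‖dil ψ j (x - y) - dil ψ j x‖ₑ := fun j => by
    have := dil_cont hk.cont j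
    fun_prop
  calc ∫⁻ x in {x : ℝ | 2 * |y| ≤ |x|}, ‖KK ψ j0 Lop (x - y) - KK ψ j0 Lop x‖ₑ
      ≤ ∫⁻ x in {x : ℝ | 2 * |y| ≤ |x|}, ∑ j : Fin L, ‖dil ψ (j0 + (j:ℕ)) (x - y) - dil ψ (j0 + (j:ℕ)) x‖ₑ := by
        refine lintegral_mono fun x => ?_
        have e : KK ψ j0 Lop (x - y) - KK ψ j0 Lop x = ∑ j : Fin L,
            (dil ψ (j0 + (j:ℕ)) (x - y) • Lop j - dil ψ (j0 + (j:ℕ)) x • Lop j) := by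
          unfold KK
          rw [← Finset.sum_sub_distrib]
        rw [e]
        refine le_trans (enorm_sum_le_aux _ _) (Finset.sum_le_sum fun j _ => ?_)
        rw [← sub_smul, enorm_smul]
        refine mul_le_of_le_one_right' ?_
        rw [← ofReal_norm]
        exact ofReal_le_one.2 (hL j)
    _ = ∑ j : Fin L, ∫⁻ x in {x : ℝ | 2 * |y| ≤ |x|}, ‖dil ψ (j0 + (j:ℕ)) (x - y) - dil ψ (j0 + (j:ℕ)) x‖ₑ :=
        lintegral_finsetSum _ fun j _ => hm _
    _ ≤ _ := by
        have hinj : Function.Injective (fun j : Fin L => j0 + ((j:ℕ):ℤ)) := by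
          intro a b hab
          dsimp only at hab
          exact Fin.ext (by omega)
        rw [← tsum_fintype (L := .unconditional _)]
        exact ENNReal.tsum_comp_le_tsum_of_injective hinj (fun j : ℤ => ∫⁻ x in {x : ℝ | 2 * |y| ≤ |x|}, ‖dil ψ j (x - y) - dil ψ j x‖ₑ)
end czk

section ops
variable (a : ℝ≥0∞) [Fact (1 ≤ a)] {L N : ℕ} (ℓ : Fin N → Fin L → ℂ)

/-- forward blocks -/
def LF (hℓ : ∀ n j, ‖ℓ n j‖ ≤ 1) (j : Fin L) : PiLp a (fun _ : Fin L => ℂ) →L[ℂ] (Fin N → ℂ) :=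
  LinearMap.mkContinuous
    { toFun := fun h n => ℓ n j * h j
      map_add' := fun x y => by ext n; simp [mul_add]
      map_smul' := fun c x => by ext n; simp; ring } 1 (fun h => by
        rw [one_mul, pi_norm_le_iff_of_nonneg (norm_nonneg _)]
        intro n
        show ‖ℓ n j * h j‖ ≤ _
        rw [norm_mul]
        exact (mul_le_of_le_one_left (norm_nonneg _) (hℓ n j)).trans (PiLp.norm_apply_le h j))

/-- adjoint blocks -/
def LA (hℓ : ∀ n j, ‖ℓ n j‖ ≤ 1) (j : Fin L) : PiLp 1 (fun _ : Fin N => ℂ) →L[ℂ] PiLp a (fun _ : Fin L => ℂ) :=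
  LinearMap.mkContinuous
    { toFun := fun w => PiLp.single a j (∑ n, ℓ n j * w n)
      map_add' := fun x y => by
        ext i
        by_cases h : i = j
        · subst h; simp [mul_add, Finset.sum_add_distrib]
        · simp [h]
      map_smul' := fun c x => by
        ext i
        by_cases h : i = j
        · subst h; simp [Finset.mul_sum]; refine Finset.sum_congr rfl fun i _ => by ring
        · simp [h] } 1 (fun w => by
        rw [one_mul, PiLp.norm_eq_sum (p := 1) (by norm_num)]
        show ‖(PiLp.single a j (∑ n, ℓ n j * w n) : PiLp a (fun _ : Fin L => ℂ))‖ ≤ _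
        rw [PiLp.norm_single]
        simp only [toReal_one, Real.rpow_one, one_div, inv_one]
        refine (norm_sum_le _ _).trans (Finset.sum_le_sum fun n _ => ?_)
        rw [norm_mul]
        exact mul_le_of_le_one_left (norm_nonneg _) (hℓ n j))

lemma LF_norm (hℓ : ∀ n j, ‖ℓ n j‖ ≤ 1) (j : Fin L) : ‖LF a ℓ hℓ j‖ ≤ 1 := LinearMap.mkContinuous_norm_le _ zero_le_one _
lemma LA_norm (hℓ : ∀ n j, ‖ℓ n j‖ ≤ 1) (j : Fin L) : ‖LA a ℓ hℓ j‖ ≤ 1 := LinearMap.mkContinuous_norm_le _ zero_le_one _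
lemma LF_apply (hℓ : ∀ n j, ‖ℓ n j‖ ≤ 1) (j : Fin L) (h) (n) : LF a ℓ hℓ j h n = ℓ n j * h j := rfl
lemma LA_apply (hℓ : ∀ n j, ‖ℓ n j‖ ≤ 1) (j : Fin L) (w) : LA a ℓ hℓ j w = PiLp.single a j (∑ n, ℓ n j * w n) := rfl

lemma nice_comp {ι : Type} [Fintype ι] {f : ℝ → PiLp a (fun _ : ι => ℂ)} (hf : Nice f) (j : ι) : Nice (fun x => f x j) :=
  hf.mono ((PiLp.continuous_apply a _ j).comp_stronglyMeasurable hf.sm) fun x => PiLp.norm_apply_le _ _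

lemma nice_mk {ι : Type} [Fintype ι] {f : ι → ℝ → ℂ} (hf : ∀ j, Nice (f j)) :
    Nice (fun x => WithLp.toLp a (fun j => f j x)) := by
  classical
  have : (fun x => WithLp.toLp a (fun j => f j x)) = fun x => ∑ j : ι, f j x • (PiLp.single a j (1:ℂ) : PiLp a (fun _ : ι => ℂ)) := by
    ext x i
    simp [Pi.single_apply]
  rw [this]
  exact Nice.sum _ fun j => (hf j).smul_const _

variable {Ψ ψ : ℝ → ℂ} {A : ℝ}

lemma TTF_apply (hk : Ker Ψ ψ A) (j0 : ℤ) (hℓ : ∀ n j, ‖ℓ n j‖ ≤ 1) {f : ℝ → PiLp a (fun _ : Fin L => ℂ)}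
    (hf : Nice f) (x : ℝ) (n : Fin N) : TT (KK ψ j0 (LF a ℓ hℓ)) f x n =
      ∑ j : Fin L, ℓ n j * cv (dil ψ (j0 + (j:ℕ))) (fun y => f y j) x := by
  unfold TT
  have h1 := ContinuousLinearMap.integral_comp_comm (ContinuousLinearMap.proj (R := ℂ) (φ := fun _ : Fin N => ℂ) n)
    (TT_int (KK_nice hk j0 (LF a ℓ hℓ)) hf x)
  simp only [ContinuousLinearMap.proj_apply] at h1
  rw [← h1]
  unfold cv
  simp_rw [← integral_const_mul]
  rw [← integral_finsetSum]
  · congr 1; ext y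
    simp [KK, LF_apply]
    refine Finset.sum_congr rfl fun j _ => by ring
  · intro j _
    exact (cv_integrable (hk.dnice _) (nice_comp a hf j) x).const_mul _

lemma TTA_apply (hk : Ker Ψ ψ A) (j0 : ℤ) (hℓ : ∀ n j, ‖ℓ n j‖ ≤ 1) {w : ℝ → PiLp 1 (fun _ : Fin N => ℂ)}
    (hw : Nice w) (x : ℝ) (j : Fin L) : TT (KK ψ j0 (LA a ℓ hℓ)) w x j =
      cv (dil ψ (j0 + (j:ℕ))) (fun y => ∑ n, ℓ n j * w y n) x := by
  unfold TT
  have h1 := ContinuousLinearMap.integral_comp_comm (PiLp.proj (𝕜 := ℂ) a (fun _ : Fin L => ℂ) j)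
    (TT_int (KK_nice hk j0 (LA a ℓ hℓ)) hw x)
  simp only [PiLp.proj_apply] at h1
  rw [← h1]
  unfold cv
  congr 1; ext y
  simp [KK, LA_apply, Pi.single_apply]
  ring
end ops

end

section
set_option linter.unusedSectionVars false

/-- Admissible dual coefficient vectors. -/
def Adm (s' : ℝ) {L : ℕ} (ℓ : Fin L → ℂ) : Prop := ∃ (K : ℕ) (n : ℕ → ℕ) (c : ℕ → ℂ),
  Monotone n ∧ (∀ k, n k ≤ L) ∧ ∑ k ∈ Finset.range K, ‖c k‖ ^ s' ≤ 1 ∧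
  ∀ j : Fin L, ℓ j = ∑ k ∈ Finset.range K, if n k ≤ (j:ℕ) ∧ (j:ℕ) < n (k+1) then c k else 0

lemma Adm.le_one {s' : ℝ} (hs : 0 < s') {L : ℕ} {ℓ : Fin L → ℂ} (h : Adm s' ℓ) (j : Fin L) : ‖ℓ j‖ ≤ 1 := by
  obtain ⟨K, n, c, hn, hL, hc, hl⟩ := h
  rw [hl j]
  by_cases hex : ∃ k ∈ Finset.range K, n k ≤ (j:ℕ) ∧ (j:ℕ) < n (k+1)
  · obtain ⟨k, hk, h1, h2⟩ := hex
    rw [Finset.sum_eq_single_of_mem k hk]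
    · rw [if_pos ⟨h1, h2⟩]
      have h3 : ‖c k‖ ^ s' ≤ 1 :=
        (Finset.single_le_sum (f := fun k => ‖c k‖ ^ s') (fun i _ => by positivity) hk).trans hc
      by_contra h4
      push Not at h4
      exact absurd h3 (not_le.2 (Real.one_lt_rpow h4 hs))
    · intro b _ hbk
      rw [if_neg]
      rintro ⟨h3, h4⟩
      rcases lt_or_gt_of_ne hbk with h5 | h5
      · have := hn (show b + 1 ≤ k by omega); omega
      · have := hn (show k + 1 ≤ b by omega); omega
  · push Not at hex
    rw [Finset.sum_eq_zero]
    · simp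
    · intro k hk
      rw [if_neg]
      rintro ⟨h1, h2⟩
      exact absurd h2 (not_lt.2 (hex k hk h1))

lemma adm_pair {L K : ℕ} {ℓ : Fin L → ℂ} {n : ℕ → ℕ} {c : ℕ → ℂ} (hn : Monotone n) (hL : ∀ k, n k ≤ L)
    (hl : ∀ j : Fin L, ℓ j = ∑ k ∈ Finset.range K, if n k ≤ (j:ℕ) ∧ (j:ℕ) < n (k+1) then c k else 0)
    (U : ℕ → ℂ) : ∑ j : Fin L, ℓ j * U j =
      ∑ k ∈ Finset.range K, c k * (∑ j ∈ Finset.range (n (k+1)), U j - ∑ j ∈ Finset.range (n k), U j) := by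
  simp_rw [hl, Finset.sum_mul]
  rw [Finset.sum_comm]
  refine Finset.sum_congr rfl fun k _ => ?_
  rw [← Finset.sum_Ico_eq_sub _ (hn (show k ≤ k + 1 by omega)), Finset.mul_sum]
  rw [Fin.sum_univ_eq_sum_range (fun j => (if n k ≤ j ∧ j < n (k+1) then c k else 0) * U j) L]
  simp_rw [ite_mul, zero_mul]
  rw [← Finset.sum_filter]
  refine Finset.sum_congr ?_ fun _ _ => rfl
  ext j
  simp only [Finset.mem_filter, Finset.mem_range, Finset.mem_Ico]
  have := hL (k+1)
  constructor
  · rintro ⟨_, h⟩; exact h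
  · intro h; exact ⟨by omega, h⟩

lemma enorm_pi_le {N : ℕ} {v : Fin N → ℂ} {c : ℝ≥0∞} (h : ∀ n, ‖v n‖ₑ ≤ c) : ‖v‖ₑ ≤ c := by
  rcases eq_or_ne c ⊤ with rfl | hc
  · exact le_top
  lift c to ℝ≥0 using hc
  rw [enorm_eq_nnnorm, ENNReal.coe_le_coe, pi_nnnorm_le_iff]
  intro n
  have := h n
  rwa [enorm_eq_nnnorm, ENNReal.coe_le_coe] at this

lemma norm_PiLp {s : ℝ} (hs : 0 < s) {ι : Type} [Fintype ι] (v : PiLp (ENNReal.ofReal s) (fun _ : ι => ℂ)) :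
    ‖v‖ = (∑ j, ‖v j‖ ^ s) ^ (1/s) := by
  have := PiLp.norm_eq_sum (p := ENNReal.ofReal s) (by rw [toReal_ofReal hs.le]; exact hs) v
  rwa [toReal_ofReal hs.le] at this

lemma norm_PiLp_pow {s : ℝ} (hs : 0 < s) {ι : Type} [Fintype ι] (v : PiLp (ENNReal.ofReal s) (fun _ : ι => ℂ)) :
    ‖v‖ ^ s = ∑ j, ‖v j‖ ^ s := by
  rw [norm_PiLp hs, ← Real.rpow_mul (Finset.sum_nonneg fun _ _ => by positivity), one_div_mul_cancel hs.ne',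
    Real.rpow_one]

lemma enorm_PiLp {s : ℝ} (hs : 0 < s) [Fact (1 ≤ ENNReal.ofReal s)] {ι : Type} [Fintype ι] (v : PiLp (ENNReal.ofReal s) (fun _ : ι => ℂ)) :
    ‖v‖ₑ ^ s = ∑ j, ‖v j‖ₑ ^ s := by
  simp_rw [← ofReal_norm, ofReal_rpow_of_nonneg (norm_nonneg _) hs.le]
  rw [norm_PiLp_pow hs, ofReal_sum_of_nonneg fun _ _ => by positivity]

lemma nice_cpt {w : ℝ → ℂ} (hw : Measurable w) {R D : ℝ} (h : ∀ x, ‖w x‖ ≤ if |x| ≤ R then D else 0) : Nice w := by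
  have hset : {x : ℝ | |x| ≤ R} = Set.Icc (-R) R := by ext x; simp [abs_le]
  have hn : Integrable (Set.indicator {x : ℝ | |x| ≤ R} (fun _ => D)) := by
    rw [hset, integrable_indicator_iff measurableSet_Icc]
    exact integrableOn_const (by simp)
  refine ⟨hw.stronglyMeasurable, hn.mono' hw.aestronglyMeasurable (Filter.Eventually.of_forall fun x => ?_), |D|, fun x => ?_⟩
  · refine (h x).trans (le_of_eq ?_)
    simp [Set.indicator]
  · refine (h x).trans ?_
    split_ifs
    · exact le_abs_self D
    · positivity

section norming
variable {N : ℕ}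

/-- first argmax -/
def fam (u : Fin N → ℂ) (n : Fin N) : Prop := (∀ m, ‖u m‖ ≤ ‖u n‖) ∧ ∀ m, m < n → ‖u m‖ < ‖u n‖

lemma fam_exists (u : Fin N → ℂ) (hN : Nonempty (Fin N)) : ∃ n, fam u n := by
  obtain ⟨n0, hn0⟩ := Finite.exists_max (fun n => ‖u n‖)
  obtain ⟨n, hn, hmin⟩ := (wellFounded_lt (α := Fin N)).has_min {n | ∀ m, ‖u m‖ ≤ ‖u n‖} ⟨n0, hn0⟩
  refine ⟨n, hn, fun m hm => ?_⟩
  by_contra hlt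
  push Not at hlt
  exact hmin m (fun k => (hn k).trans hlt) hm

lemma fam_unique {u : Fin N → ℂ} {n m : Fin N} (hn : fam u n) (hm : fam u m) : m = n := by
  rcases lt_trichotomy m n with h | h | h
  · exact absurd (hn.2 m h) (not_lt.2 (hm.1 n))
  · exact h
  · exact absurd (hm.2 n h) (not_lt.2 (hn.1 m))

lemma fam_norm {u : Fin N → ℂ} {n : Fin N} (hn : fam u n) : ‖u n‖ = ‖u‖ :=
  le_antisymm (norm_le_pi_norm u n) ((pi_norm_le_iff_of_nonneg (norm_nonneg _)).2 hn.1)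

open Classical in
lemma norming_sup {q : ℝ} (hq : 1 < q) (u : ℝ → Fin N → ℂ) (hu : Nice u) (R : ℝ) :
    ∃ w : ℝ → PiLp 1 (fun _ : Fin N => ℂ), Nice w ∧
      ∀ x, ∑ n, u x n * w x n = ((if |x| ≤ R then ‖u x‖ ^ q else 0 : ℝ) : ℂ) ∧
        ‖w x‖ ≤ if |x| ≤ R then ‖u x‖ ^ (q - 1) else 0 := by
  obtain ⟨D, hD0, hD⟩ := hu.bdd'
  have hum : ∀ n, Measurable fun x => u x n := fun n => (measurable_pi_apply n).comp hu.sm.measurable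
  have hset : ∀ n, MeasurableSet {x : ℝ | |x| ≤ R ∧ fam (u x) n} := by
    intro n
    unfold fam
    refine (measurableSet_le (f := fun x : ℝ => |x|) (by fun_prop) measurable_const).inter (MeasurableSet.inter ?_ ?_)
    · have : {x : ℝ | ∀ m, ‖u x m‖ ≤ ‖u x n‖} = ⋂ m, {x : ℝ | ‖u x m‖ ≤ ‖u x n‖} := by ext; simp
      change MeasurableSet {x : ℝ | ∀ m, ‖u x m‖ ≤ ‖u x n‖}
      rw [this]
      exact MeasurableSet.iInter fun m => measurableSet_le (hum m).norm (hum n).norm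
    · have : {x : ℝ | ∀ m, m < n → ‖u x m‖ < ‖u x n‖} = ⋂ m, ⋂ (_ : m < n), {x : ℝ | ‖u x m‖ < ‖u x n‖} := by ext; simp
      change MeasurableSet {x : ℝ | ∀ m, m < n → ‖u x m‖ < ‖u x n‖}
      rw [this]
      exact MeasurableSet.iInter fun m => MeasurableSet.iInter fun _ => measurableSet_lt (hum m).norm (hum n).norm
  refine ⟨fun x => WithLp.toLp 1 (fun n => if |x| ≤ R ∧ fam (u x) n then sgp q (u x n) else 0), ?_, fun x => ?_⟩
  · refine nice_mk 1 (f := fun n x => if |x| ≤ R ∧ fam (u x) n then sgp q (u x n) else 0) fun n => ?_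
    refine nice_cpt (R := R) (D := D ^ (q-1)) (Measurable.ite (hset n) ((sgp_meas q).comp (hum n)) measurable_const) fun x => ?_
    by_cases h1 : |x| ≤ R
    · by_cases h2 : fam (u x) n
      · simp only [h1, h2, and_self, if_true]
        rw [sgp_norm hq]
        gcongr
        exact (norm_le_pi_norm _ _).trans (hD x)
      · simp only [h1, h2, and_false, if_true, if_false, norm_zero]; positivity
    · simp [h1]
  · rw [PiLp.norm_eq_sum (p := 1) (by norm_num)]
    simp only [toReal_one, Real.rpow_one, one_div, inv_one]
    by_cases h1 : |x| ≤ R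
    · simp only [h1, true_and, if_true]
      rcases isEmpty_or_nonempty (Fin N) with hN | hN
      · have : ‖u x‖ = 0 := by rw [Subsingleton.elim (u x) 0, norm_zero]
        simp only [Finset.univ_eq_empty, Finset.sum_empty, this]
        rw [Real.zero_rpow (by linarith)]
        exact ⟨by simp, by positivity⟩
      · obtain ⟨n, hn⟩ := fam_exists (u x) hN
        have hoth : ∀ m, m ≠ n → ¬ fam (u x) m := fun m hm h => hm (fam_unique hn h)
        rw [Finset.sum_eq_single n, Finset.sum_eq_single n]
        · simp only [hn, if_true]
          rw [sgp_mul hq, sgp_norm hq, fam_norm hn]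
          exact ⟨rfl, le_rfl⟩
        · intro m _ hm; simp [hoth m hm]
        · simp
        · intro m _ hm; simp [hoth m hm]
        · simp
    · simp [h1]
end norming

lemma norming_ls {L : ℕ} {s s' : ℝ} (hss : s'.HolderConjugate s) [Fact (1 ≤ ENNReal.ofReal s)] [Fact (1 ≤ ENNReal.ofReal s')]
    (u : ℝ → PiLp (ENNReal.ofReal s') (fun _ : Fin L => ℂ)) (hu : Nice u) (R : ℝ) :
    ∃ w : ℝ → PiLp (ENNReal.ofReal s) (fun _ : Fin L => ℂ), Nice w ∧
      ∀ x, ∑ n, u x n * w x n = ((if |x| ≤ R then ‖u x‖ ^ s' else 0 : ℝ) : ℂ) ∧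
        ‖w x‖ ≤ if |x| ≤ R then ‖u x‖ ^ (s' - 1) else 0 := by
  have hs' : 1 < s' := hss.lt
  have hs : 1 < s := hss.symm.lt
  obtain ⟨D, hD0, hD⟩ := hu.bdd'
  have hum : ∀ n, Measurable fun x => u x n := fun n => (nice_comp _ hu n).sm.measurable
  refine ⟨fun x => WithLp.toLp _ (fun n => if |x| ≤ R then sgp s' (u x n) else 0), ?_, fun x => ?_⟩
  · refine nice_mk _ (f := fun n x => if |x| ≤ R then sgp s' (u x n) else 0) fun n => ?_
    refine nice_cpt (R := R) (D := D ^ (s'-1)) (Measurable.ite (measurableSet_le (by fun_prop) measurable_const) 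
      ((sgp_meas s').comp (hum n)) measurable_const) fun x => ?_
    by_cases h1 : |x| ≤ R
    · simp only [h1, if_true]
      rw [sgp_norm hs']
      have := PiLp.norm_apply_le (u x) n
      have := hD x
      gcongr
      linarith
    · simp [h1]
  · by_cases h1 : |x| ≤ R
    · simp only [h1, if_true]
      constructor
      · simp_rw [sgp_mul hs']
        rw [norm_PiLp_pow (by linarith)]
        push_cast
        rfl
      · rw [norm_PiLp (by linarith)]
        simp only [sgp_norm hs']
        have e : ∀ j, (‖u x j‖ ^ (s' - 1)) ^ s = ‖u x j‖ ^ s' := fun j => by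
          rw [← Real.rpow_mul (norm_nonneg _)]
          congr 1
          exact hss.sub_one_mul_conj
        simp_rw [e]
        rw [← norm_PiLp_pow (by linarith), ← Real.rpow_mul (norm_nonneg _)]
        refine le_of_eq ?_
        congr 1
        have := hss.sub_one_mul_conj
        rw [mul_one_div, div_eq_iff (by linarith), this]
    · simp only [h1, if_false]
      refine ⟨by simp, le_of_eq ?_⟩
      rw [norm_eq_zero]; rfl

end

section
set_option linter.unusedSectionVars false
variable {Ψ ψ : ℝ → ℂ} {A : ℝ}

lemma Ker.Bs (hk : Ker Ψ ψ A) {s s' : ℝ} (hss : s.HolderConjugate s') (hs2 : s < 2)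
    [Fact (1 ≤ ENNReal.ofReal s)] : ∃ M : ℝ≥0,
    ∀ (j0 : ℤ) (L N : ℕ) (ℓ : Fin N → Fin L → ℂ) (_ : ∀ n, Adm s' (ℓ n)) (hℓ : ∀ n j, ‖ℓ n j‖ ≤ 1)
      (f : ℝ → PiLp (ENNReal.ofReal s) (fun _ : Fin L => ℂ)), Nice f →
      ∫⁻ x, ‖TT (KK ψ j0 (LF _ ℓ hℓ)) f x‖ₑ ^ s ≤ M * ∫⁻ x, ‖f x‖ₑ ^ s := by
  have hs1 : 1 < s := hss.lt
  have hs0 : 0 < s := by linarith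
  have hs'0 : 0 < s' := hss.symm.pos
  obtain ⟨C, hC⟩ := hk.var_s s hs1 hs2
  refine ⟨C, fun j0 L N ℓ hA hℓ f hf => ?_⟩
  set h : ℕ → ℝ → ℂ := fun j x => if hj : j < L then f x ⟨j, hj⟩ else 0 with hh
  have hhn : ∀ j, Nice (h j) := by
    intro j
    by_cases hj : j < L
    · simpa [hh, hj] using nice_comp _ hf ⟨j, hj⟩
    · simpa [hh, hj] using Nice.zero
  obtain ⟨G, hGm, hG1, hG2⟩ := hC j0 h hhn L
  calc ∫⁻ x, ‖TT (KK ψ j0 (LF _ ℓ hℓ)) f x‖ₑ ^ s ≤ ∫⁻ x, G x := by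
        refine lintegral_mono fun x => ?_
        rw [← ENNReal.le_rpow_inv_iff hs0, ← one_div]
        refine enorm_pi_le fun n => ?_
        rw [TTF_apply _ _ hk j0 hℓ hf]
        obtain ⟨K, b, c, hb, hL, hc, hl⟩ := hA n
        have e1 : ∑ j : Fin L, ℓ n j * cv (dil ψ (j0 + (j:ℕ))) (fun y => f y j) x =
            ∑ j : Fin L, ℓ n j * uu ψ j0 h j x := by
          refine Finset.sum_congr rfl fun j _ => ?_
          have : (fun y => f y j) = h j := by ext y; simp [hh]
          rw [this]; rfl
        rw [e1, adm_pair hb hL hl (fun j => uu ψ j0 h j x)]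
        calc ‖∑ k ∈ Finset.range K, c k * (SS ψ j0 h (b (k+1)) x - SS ψ j0 h (b k) x)‖ₑ
            ≤ ∑ k ∈ Finset.range K, ‖c k‖ₑ * ‖SS ψ j0 h (b (k+1)) x - SS ψ j0 h (b k) x‖ₑ := by
              refine (enorm_sum_le _ _).trans (Finset.sum_le_sum fun k _ => ?_)
              rw [enorm_mul]
          _ ≤ (∑ k ∈ Finset.range K, ‖c k‖ₑ ^ s') ^ (1/s') * 
              (∑ k ∈ Finset.range K, ‖SS ψ j0 h (b (k+1)) x - SS ψ j0 h (b k) x‖ₑ ^ s) ^ (1/s) :=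
              ENNReal.inner_le_Lp_mul_Lq _ _ _ hss.symm
          _ ≤ 1 * (G x) ^ (1/s) := by
              refine mul_le_mul' ?_ (ENNReal.rpow_le_rpow (hG2 x b K hb hL) (by positivity))
              refine ENNReal.rpow_le_one ?_ (by positivity)
              simp_rw [← ofReal_norm, ofReal_rpow_of_nonneg (norm_nonneg _) hs'0.le]
              rw [← ofReal_sum_of_nonneg fun _ _ => by positivity]
              exact ofReal_le_one.2 hc
          _ = _ := one_mul _
    _ ≤ C * ∑ j ∈ Finset.range L, ∫⁻ x, ‖h j x‖ₑ ^ s := hG1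
    _ = C * ∫⁻ x, ‖f x‖ₑ ^ s := by
        congr 1
        simp_rw [enorm_PiLp hs0]
        rw [lintegral_finsetSum _ fun j _ => (nice_comp _ hf j).sm.enorm.pow_const s]
        rw [← Fin.sum_univ_eq_sum_range (fun j => ∫⁻ x, ‖h j x‖ₑ ^ s) L]
        refine Finset.sum_congr rfl fun j _ => ?_
        simp [hh]

lemma pair_id (hk : Ker Ψ ψ A) (a b : ℝ≥0∞) [Fact (1 ≤ a)] [Fact (1 ≤ b)] (j0 : ℤ) {L N : ℕ} (ℓ : Fin N → Fin L → ℂ)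
    (hℓ : ∀ n j, ‖ℓ n j‖ ≤ 1) {f : ℝ → PiLp a (fun _ : Fin L => ℂ)} (hf : Nice f)
    {w : ℝ → PiLp 1 (fun _ : Fin N => ℂ)} (hw : Nice w) :
    ∫ x, ∑ n, TT (KK ψ j0 (LF a ℓ hℓ)) f x n * w x n =
      ∫ x, ∑ j, f x j * TT (KK (fun z => ψ (-z)) j0 (LA b ℓ hℓ)) w x j := by
  have hW : ∀ j, Nice (fun y => ∑ n, ℓ n j * w y n) := fun j => Nice.sum _ fun n => by
    simpa [mul_comm] using (nice_comp 1 hw n).smul_const (ℓ n j)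
  have hf' : ∀ j, Nice fun x => f x j := nice_comp a hf
  have hd : ∀ j : ℤ, dil (fun z => ψ (-z)) j = fun z => dil ψ j (-z) := by
    intro j; ext z; unfold dil; rw [mul_neg]
  simp_rw [TTF_apply a ℓ hk j0 hℓ hf, TTA_apply b ℓ hk.refl j0 hℓ hw]
  have e1 : ∀ x, ∑ n, (∑ j : Fin L, ℓ n j * cv (dil ψ (j0 + (j:ℕ))) (fun y => f y j) x) * w x n =
      ∑ j : Fin L, cv (dil ψ (j0 + (j:ℕ))) (fun y => f y j) x * ∑ n, ℓ n j * w x n := by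
    intro x
    simp_rw [Finset.sum_mul, Finset.mul_sum]
    rw [Finset.sum_comm]
    refine Finset.sum_congr rfl fun j _ => Finset.sum_congr rfl fun n _ => by ring
  simp_rw [e1]
  rw [integral_finsetSum, integral_finsetSum]
  · refine Finset.sum_congr rfl fun j _ => ?_
    rw [hd, cv_adj (hk.dnice _) (hf' j) (hW j)]
  · intro j _
    exact ((hf' j).mul (cv_nice (hk.refl.dnice _) (hW j)))
  · intro j _
    exact ((cv_nice (hk.dnice _) (hf' j)).mul (hW j))

theorem Ker.Bq (hk : Ker Ψ ψ A) {s s' q : ℝ} (hss : s.HolderConjugate s') (hs2 : s < 2) (hq : 1 < q)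
    [Fact (1 ≤ ENNReal.ofReal s)] : ∃ M : ℝ≥0,
    ∀ (j0 : ℤ) (L N : ℕ) (ℓ : Fin N → Fin L → ℂ) (_ : ∀ n, Adm s' (ℓ n)) (hℓ : ∀ n j, ‖ℓ n j‖ ≤ 1)
      (f : ℝ → PiLp (ENNReal.ofReal s) (fun _ : Fin L => ℂ)), Nice f →
      ∫⁻ x, ‖TT (KK ψ j0 (LF _ ℓ hℓ)) f x‖ₑ ^ q ≤ M * ∫⁻ x, ‖f x‖ₑ ^ q := by
  obtain ⟨M, hM⟩ := hk.Bs hss hs2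
  have hs1 : 1 < s := hss.lt
  have hs'1 : 1 < s' := hss.symm.lt
  rcases lt_trichotomy q s with hqs | rfl | hqs
  · obtain ⟨C, hC⟩ := hk.czk s q hq hqs M
    refine ⟨C, fun j0 L N ℓ hA hℓ f hf => ?_⟩
    exact hC (PiLp (ENNReal.ofReal s) (fun _ : Fin L => ℂ)) (Fin N → ℂ) j0 L (LF (ENNReal.ofReal s) ℓ hℓ) (LF_norm (ENNReal.ofReal s) ℓ hℓ) (fun f hf => hM j0 L N ℓ hA hℓ f hf) f hf
  · exact ⟨M, hM⟩
  · have : Fact (1 ≤ ENNReal.ofReal s') := ⟨by rw [← ofReal_one]; exact ofReal_le_ofReal hs'1.le⟩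
    set q' := q / (q - 1) with hq'
    have hqq : q.HolderConjugate q' := Real.HolderConjugate.conjExponent hq
    have hq's' : q' < s' := by
      have h1 := hqq.inv_add_inv_eq_one
      have h2 := hss.inv_add_inv_eq_one
      have h3 : q⁻¹ < s⁻¹ := by gcongr
      have h4 : s'⁻¹ < q'⁻¹ := by linarith
      exact (inv_lt_inv₀ (by linarith) hqq.symm.pos).1 h4
    obtain ⟨C, hC⟩ := hk.refl.czk s' q' hqq.symm.lt hq's' (M ^ (s' / s))
    refine ⟨C ^ (q / q'), fun j0 L N ℓ hA hℓ f hf => ?_⟩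
    have hKF := KK_nice hk j0 (LF (ENNReal.ofReal s) ℓ hℓ)
    have hKA := KK_nice hk.refl j0 (LA (ENNReal.ofReal s') ℓ hℓ)
    have b1 : ∀ (e : PiLp (ENNReal.ofReal s) (fun _ : Fin L => ℂ)) (e' : PiLp (ENNReal.ofReal s') (fun _ : Fin L => ℂ)),
        ‖∑ j, e j * e' j‖ ≤ ‖e‖ * ‖e'‖ := by
      intro e e'
      rw [norm_PiLp (by linarith), norm_PiLp (by linarith)]
      refine (norm_sum_le _ _).trans ?_
      simp_rw [norm_mul]
      exact Real.inner_le_Lp_mul_Lq_of_nonneg _ hss (fun _ _ => norm_nonneg _) (fun _ _ => norm_nonneg _)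
    have b2 : ∀ (e : PiLp 1 (fun _ : Fin N => ℂ)) (e' : Fin N → ℂ),
        ‖∑ j, e' j * e j‖ ≤ ‖e‖ * ‖e'‖ := by
      intro e e'
      rw [PiLp.norm_eq_sum (p := 1) (by norm_num)]
      simp only [toReal_one, Real.rpow_one, one_div, inv_one]
      refine (norm_sum_le _ _).trans ?_
      rw [Finset.sum_mul]
      refine Finset.sum_le_sum fun n _ => ?_
      rw [norm_mul, mul_comm]
      gcongr
      exact norm_le_pi_norm _ _
    refine dual (E' := PiLp (ENNReal.ofReal s') (fun _ : Fin L => ℂ)) (F := Fin N → ℂ)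
      (F' := PiLp 1 (fun _ : Fin N => ℂ)) (E := PiLp (ENNReal.ofReal s) (fun _ : Fin L => ℂ)) (q := q) (q' := q')
      (fun e e' => ∑ j, e j * e' j) (fun u w => ∑ n, u n * w n) b1
      (TT (KK ψ j0 (LF _ ℓ hℓ))) (TT (KK (fun z => ψ (-z)) j0 (LA (ENNReal.ofReal s') ℓ hℓ)))
      (fun f hf => TT_nice hKF hf) (fun w hw => TT_nice hKA hw) 
      (fun f w hf hw => pair_id hk _ _ j0 ℓ hℓ hf hw) hqq (fun u hu R => norming_sup hq u hu R) C ?_ f hf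
    refine hC (PiLp 1 (fun _ : Fin N => ℂ)) (PiLp (ENNReal.ofReal s') (fun _ : Fin L => ℂ)) j0 L (LA (ENNReal.ofReal s') ℓ hℓ) (LA_norm (ENNReal.ofReal s') ℓ hℓ) ?_
    intro w hw
    refine dual (E := PiLp 1 (fun _ : Fin N => ℂ)) (F := PiLp (ENNReal.ofReal s') (fun _ : Fin L => ℂ))
      (E' := Fin N → ℂ) (F' := PiLp (ENNReal.ofReal s) (fun _ : Fin L => ℂ)) (q := s') (q' := s)
      (fun e e' => ∑ j, e' j * e j) (fun u w => ∑ n, u n * w n) b2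
      (TT (KK (fun z => ψ (-z)) j0 (LA (ENNReal.ofReal s') ℓ hℓ))) (TT (KK ψ j0 (LF (ENNReal.ofReal s) ℓ hℓ)))
      (fun w hw => TT_nice hKA hw) (fun f hf => TT_nice hKF hf)
      (fun w f hw hf => ?_) hss.symm (fun u hu R => norming_ls hss.symm u hu R) M (fun f hf => hM j0 L N ℓ hA hℓ f hf) w hw
    have hp := pair_id hk (ENNReal.ofReal s) (ENNReal.ofReal s') j0 ℓ hℓ hf hw
    refine Eq.trans ?_ hp.symm
    refine integral_congr_ae (Filter.Eventually.of_forall fun x => ?_)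
    refine Finset.sum_congr rfl fun j _ => mul_comm _ _

end

section
set_option linter.unusedSectionVars false

lemma schwartz_Phi (f : SchwartzMap ℝ ℂ) : ∃ A : ℝ, 0 < A ∧ ∀ x, ‖f x‖ ≤ A * Phi x ^ 2 := by
  obtain ⟨C0, h0, hC0⟩ := f.decay 0 0
  obtain ⟨C4, h4, hC4⟩ := f.decay 4 0
  refine ⟨2 * (C0 + C4), by positivity, fun x => ?_⟩
  have a0 := hC0 x
  have a4 := hC4 x
  simp only [pow_zero, one_mul, norm_iteratedFDeriv_zero] at a0 a4
  have hx : ‖x‖ ^ 4 = x ^ 4 := by rw [Real.norm_eq_abs]; exact Even.pow_abs (by decide) x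
  rw [hx] at a4
  have hp : Phi x ^ 2 = ((1 + x^2)^2)⁻¹ := by unfold Phi; rw [inv_pow]
  rw [hp, ← div_eq_mul_inv, le_div_iff₀ (by positivity)]
  have : (1 + x^2)^2 ≤ 2 * (1 + x^4) := by nlinarith [sq_nonneg (x^2 - 1)]
  calc ‖f x‖ * (1 + x^2)^2 ≤ ‖f x‖ * (2 * (1 + x^4)) := by gcongr
    _ ≤ _ := by nlinarith

lemma schwartz_ker (Ψ : SchwartzMap ℝ ℂ) : ∃ A, Ker Ψ (deriv Ψ) A := by
  set ψ : SchwartzMap ℝ ℂ := SchwartzMap.derivCLM ℂ ℂ Ψ with hψ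
  set ψ' : SchwartzMap ℝ ℂ := SchwartzMap.derivCLM ℂ ℂ ψ with hψ'
  have e1 : deriv Ψ = ψ := by ext x; simp [hψ]
  have e2 : deriv ψ = ψ' := by ext x; simp [hψ']
  obtain ⟨A1, p1, h1⟩ := schwartz_Phi Ψ
  obtain ⟨A2, p2, h2⟩ := schwartz_Phi ψ
  obtain ⟨A3, p3, h3⟩ := schwartz_Phi ψ'
  have hP : ∀ x, 0 ≤ Phi x ^ 2 := fun x => by positivity
  rw [e1]
  refine ⟨A1 + A2 + A3, by positivity, fun x => ?_, fun x => (h1 x).trans ?_, fun x => (h2 x).trans ?_,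
    ψ', fun x => ?_, fun x => (h3 x).trans ?_⟩
  · rw [← e1]; exact (Ψ.differentiable x).hasDerivAt
  · nlinarith [hP x]
  · nlinarith [hP x]
  · rw [← e2]; exact (ψ.differentiable x).hasDerivAt
  · nlinarith [hP x]

lemma schwartz_nice (f : SchwartzMap ℝ ℂ) : Nice f := by
  obtain ⟨A, _, h⟩ := schwartz_Phi f
  exact nice_of_Phi f.continuous h

lemma exists_chi (Nb : ℝ) (hNb : 0 < Nb) : ∃ (χ : ℝ → ℝ) (Θ : SchwartzMap ℝ ℂ),
    (∀ ξ, (2:ℝ) ^ (-Nb) < |ξ| → |ξ| < (2:ℝ) ^ Nb → χ ξ = 1) ∧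
    ∀ ξ : ℝ, (2 * Real.pi * Complex.I * ξ) * Θ ξ = χ ξ := by
  set b1 : ContDiffBump (0:ℝ) := ⟨(2:ℝ)^Nb, 2 * (2:ℝ)^Nb, by positivity, by
    have : (0:ℝ) < (2:ℝ)^Nb := by positivity
    linarith⟩ with hb1
  set b2 : ContDiffBump (0:ℝ) := ⟨(2:ℝ)^(-Nb) / 2, (2:ℝ)^(-Nb), by positivity, by
    have : (0:ℝ) < (2:ℝ)^(-Nb) := by positivity
    linarith⟩ with hb2
  set χ : ℝ → ℝ := fun ξ => b1 ξ * (1 - b2 ξ) with hχ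
  have hχ0 : ∀ ξ, |ξ| ≤ (2:ℝ)^(-Nb) / 2 → χ ξ = 0 := by
    intro ξ h
    have : b2 ξ = 1 := b2.one_of_mem_closedBall (by simpa [hb2] using h)
    simp [hχ, this]
  have hχc : ContDiff ℝ ((⊤ : ℕ∞) : WithTop ℕ∞) χ := (b1.contDiff).mul (contDiff_const.sub b2.contDiff)
  set Θ : ℝ → ℂ := fun ξ => (χ ξ : ℂ) * (2 * Real.pi * Complex.I * ξ)⁻¹ with hΘ
  have hsupp : HasCompactSupport Θ := by
    have h1 : HasCompactSupport χ := b1.hasCompactSupport.mul_right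
    exact (h1.comp_left (g := fun t : ℝ => (t:ℂ)) (by simp)).mul_right
  have hsm : ContDiff ℝ ((⊤ : ℕ∞) : WithTop ℕ∞) Θ := by
    rw [contDiff_iff_contDiffAt]
    intro ξ
    rcases eq_or_ne ξ 0 with rfl | hξ
    · have : Θ =ᶠ[nhds 0] fun _ => 0 := by
        have hn : Metric.ball (0:ℝ) ((2:ℝ)^(-Nb) / 2) ∈ nhds (0:ℝ) := Metric.ball_mem_nhds _ (by positivity)
        filter_upwards [hn] with y hy
        have : |y| < (2:ℝ)^(-Nb) / 2 := by simpa using hy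
        simp [hΘ, hχ0 y this.le]
      exact contDiffAt_const.congr_of_eventuallyEq this
    · refine ContDiffAt.mul ?_ ?_
      · exact (Complex.ofRealCLM.contDiff.comp hχc).contDiffAt
      · refine ContDiffAt.inv ?_ ?_
        · exact (contDiff_const.mul Complex.ofRealCLM.contDiff).contDiffAt
        · simp [hξ, Real.pi_ne_zero]
  refine ⟨χ, hsupp.toSchwartzMap hsm, fun ξ h1 h2 => ?_, fun ξ => ?_⟩
  · have e1 : b1 ξ = 1 := b1.one_of_mem_closedBall (by simpa [hb1] using h2.le)
    have e2 : b2 ξ = 0 := b2.zero_of_le_dist (by simpa [hb2] using h1.le)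
    simp [hχ, e1, e2]
  · show (2 * Real.pi * Complex.I * ξ) * ((χ ξ : ℂ) * (2 * Real.pi * Complex.I * ξ)⁻¹) = χ ξ
    rcases eq_or_ne ξ 0 with rfl | hξ
    · rw [hχ0 0 (by simp; positivity)]; simp
    · have : (2 * Real.pi * Complex.I * ξ : ℂ) ≠ 0 := by simp [hξ, Real.pi_ne_zero]
      rw [mul_comm, mul_assoc, inv_mul_cancel₀ this, mul_one]

lemma fourier_dil (ψ : ℝ → ℂ) (j : ℤ) (ξ : ℝ) : 𝓕 (dil ψ j) ξ = 𝓕 ψ (ξ / (2:ℝ)^j) := by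
  have hp : (0:ℝ) < (2:ℝ)^j := by positivity
  rw [Real.fourier_real_eq, Real.fourier_real_eq]
  have := Measure.integral_comp_mul_left (fun v => Real.fourierChar (-(v * (ξ / (2:ℝ)^j))) • ψ v) ((2:ℝ)^j)
  rw [abs_of_pos (by positivity : (0:ℝ) < ((2:ℝ)^j)⁻¹)] at this
  have h2 : ∫ v, Real.fourierChar (-(v * (ξ / (2:ℝ)^j))) • ψ v = 
    ((2:ℝ)^j) • ∫ x, Real.fourierChar (-((2:ℝ)^j * x * (ξ / (2:ℝ)^j))) • ψ ((2:ℝ)^j * x) := by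
    rw [this, smul_smul, mul_inv_cancel₀ hp.ne', one_smul]
  rw [h2, ← integral_smul]
  congr 1; ext v
  unfold dil
  rw [smul_comm]
  congr 4
  field_simp

theorem exists_kernel (Nb : ℝ) (hNb : 0 < Nb) : ∃ Ψ ψ : ℝ → ℂ, ∃ A, Ker Ψ ψ A ∧
    ∀ (j : ℤ) (g : SchwartzMap ℝ ℂ), (∀ ξ : ℝ, 𝓕 (⇑g) ξ ≠ 0 → (2 : ℝ) ^ ((j : ℝ) - Nb) < |ξ| ∧ |ξ| < (2 : ℝ) ^ ((j : ℝ) + Nb)) →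
      ∀ x, cv (dil ψ j) g x = g x := by
  obtain ⟨χ, Θ, h1, h2⟩ := exists_chi Nb hNb
  set Ψ : SchwartzMap ℝ ℂ := 𝓕⁻ Θ with hΨ
  obtain ⟨A, hk⟩ := schwartz_ker Ψ
  refine ⟨Ψ, deriv Ψ, A, hk, fun j g hg x => ?_⟩
  have hF : ∀ ξ, 𝓕 (deriv Ψ) ξ = χ ξ := by
    intro ξ
    rw [Real.fourier_deriv Ψ.integrable Ψ.differentiable hk.nice.int]
    have e : 𝓕 (⇑Ψ) = Θ := by
      rw [← SchwartzMap.fourier_coe, hΨ, FourierTransform.fourier_fourierInv_eq]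
    rw [e, ← h2 ξ]
    simp
  have hp : (0:ℝ) < (2:ℝ)^j := by positivity
  set ψS : SchwartzMap ℝ ℂ := SchwartzMap.derivCLM ℂ ℂ Ψ with hψS
  have eS : deriv Ψ = ψS := by ext x; simp [hψS]
  set D : SchwartzMap ℝ ℂ := ((2:ℝ)^j) • SchwartzMap.compCLMOfContinuousLinearEquiv ℂ 
    (ContinuousLinearEquiv.unitsEquivAut ℝ (Units.mk0 ((2:ℝ)^j) hp.ne')) ψS with hD
  have eD : ⇑D = dil (deriv Ψ) j := by
    ext y
    rw [eS]
    simp [hD, dil, mul_comm]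
  have hconv : SchwartzMap.convolution (ContinuousLinearMap.mul ℂ ℂ) g D = g := by
    have hinj : 𝓕 (SchwartzMap.convolution (ContinuousLinearMap.mul ℂ ℂ) g D) = 𝓕 g := by
      ext ξ
      rw [SchwartzMap.fourier_convolution_apply, Real.fourier_mul_convolution_eq g.integrable D.integrable, eD, fourier_dil, hF,
        SchwartzMap.fourier_coe]
      by_cases h : 𝓕 (⇑g) ξ = 0
      · rw [h, zero_mul]
      · obtain ⟨h3, h4⟩ := hg ξ h
        rw [h1, Complex.ofReal_one, mul_one]
        · rw [abs_div, abs_of_pos hp, lt_div_iff₀ hp, ← Real.rpow_intCast, ← Real.rpow_add two_pos]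
          rwa [add_comm, ← sub_eq_add_neg]
        · rw [abs_div, abs_of_pos hp, div_lt_iff₀ hp, ← Real.rpow_intCast, ← Real.rpow_add two_pos]
          rwa [add_comm]
    have := congrArg (fun F => 𝓕⁻ F) hinj
    simpa using this
  have h5 := SchwartzMap.convolution_apply (ContinuousLinearMap.mul ℂ ℂ) g D x
  rw [hconv] at h5
  rw [h5, ← eD]
  rfl

end

section
set_option linter.unusedSectionVars false

lemma adm_sup {Ψ ψ : ℝ → ℂ} {A : ℝ} (hk : Ker Ψ ψ A) {s s' q : ℝ} (hss : s.HolderConjugate s') (hs2 : s < 2) (hq : 1 < q) :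
    ∃ C : ℝ≥0, ∀ g : ℤ → SchwartzMap ℝ ℂ, (∀ j x, cv (dil ψ j) (g j) x = g j x) → ∀ M : ℕ,
      ∃ V : ℝ → ℝ≥0∞, Measurable V ∧
        ∫⁻ x, V x ^ q ≤ C * ∫⁻ x, (∑' j : ℤ, ‖g j x‖ₑ ^ s) ^ (q / s) ∧
        ∀ x (ℓ : Fin (2 * M) → ℂ), Adm s' ℓ → ‖∑ j : Fin (2*M), ℓ j * g (-(M:ℤ) + (j:ℕ)) x‖ₑ ≤ V x := by
  have hs1 : 1 < s := hss.lt
  have hs0 : 0 < s := by linarith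
  have hq0 : 0 < q := by linarith
  have hs'0 : 0 < s' := hss.symm.pos
  have : Fact (1 ≤ ENNReal.ofReal s) := ⟨by rw [← ofReal_one]; exact ofReal_le_ofReal hs1.le⟩
  obtain ⟨C, hC⟩ := hk.Bq hss hs2 hq
  refine ⟨C, fun g hg M => ?_⟩
  set S : Set (Fin (2*M) → ℂ) := {ℓ | Adm s' ℓ} with hS
  have hne : Nonempty S := ⟨⟨fun _ => 0, 0, fun _ => 0, fun _ => 0, monotone_const, by simp, by simp, by simp⟩⟩
  set d : ℕ → S := TopologicalSpace.denseSeq S with hd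
  set P : (Fin (2*M) → ℂ) → ℝ → ℂ := fun ℓ x => ∑ j : Fin (2*M), ℓ j * g (-(M:ℤ) + (j:ℕ)) x with hP
  have hPm : ∀ ℓ, Measurable (P ℓ) := fun ℓ => by
    refine Finset.measurable_fun_sum _ fun j _ => ?_
    exact ((g _).continuous.measurable).const_mul _
  have hPc : ∀ x, Continuous fun ℓ => P ℓ x := fun x => by
    simp only [hP]; fun_prop
  refine ⟨fun x => ⨆ n, ‖P (d n) x‖ₑ, Measurable.iSup fun n => (hPm _).enorm, ?_, fun x ℓ hℓ => ?_⟩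
  · set F : ℕ → ℝ → ℝ≥0∞ := fun N x => ‖(fun n : Fin N => P (d n) x)‖ₑ ^ q with hF
    have hcomp : ∀ N (n : Fin N) x, ‖P (d n) x‖ₑ ^ q ≤ F N x := fun N n x => by
      refine ENNReal.rpow_le_rpow ?_ hq0.le
      rw [← ofReal_norm, ← ofReal_norm]
      exact ofReal_le_ofReal (norm_le_pi_norm (fun n : Fin N => P (d n) x) n)
    have hFm : ∀ N, Measurable (F N) := fun N => by
      have : Measurable fun x => (fun n : Fin N => P (d n) x) := measurable_pi_lambda _ fun n => hPm _
      exact this.enorm.pow_const q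
    have hmono : Monotone F := by
      intro N N' h x
      refine ENNReal.rpow_le_rpow (enorm_pi_le fun n => ?_) hq0.le
      have := hcomp N' ⟨n, by omega⟩ x
      exact (ENNReal.rpow_le_rpow_iff hq0).1 this
    calc ∫⁻ x, (⨆ n, ‖P (d n) x‖ₑ) ^ q ≤ ∫⁻ x, ⨆ N, F N x := by
          refine lintegral_mono fun x => ?_
          rw [← ENNReal.le_rpow_inv_iff hq0]
          refine iSup_le fun n => ?_
          rw [ENNReal.le_rpow_inv_iff hq0]
          exact (hcomp (n+1) ⟨n, by omega⟩ x).trans (le_iSup (fun N => F N x) (n+1))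
      _ = ⨆ N, ∫⁻ x, F N x := lintegral_iSup hFm hmono
      _ ≤ _ := by
          refine iSup_le fun N => ?_
          set f : ℝ → PiLp (ENNReal.ofReal s) (fun _ : Fin (2*M) => ℂ) := 
            fun x => WithLp.toLp _ (fun j : Fin (2*M) => g (-(M:ℤ) + (j:ℕ)) x) with hf
          have hfn : Nice f := nice_mk _ fun j => schwartz_nice (g _)
          have hAd : ∀ n : Fin N, Adm s' ((d n : Fin (2*M) → ℂ)) := fun n => (d n).2
          have h1 := hC (-(M:ℤ)) (2*M) N (fun n => d n) hAd (fun n j => (hAd n).le_one hs'0 j) f hfn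
          refine le_trans (le_of_eq ?_) (h1.trans (mul_le_mul' le_rfl ?_))
          · refine lintegral_congr fun x => ?_
            simp only [hF]
            congr 2
            ext n
            rw [TTF_apply _ _ hk _ _ hfn]
            refine Finset.sum_congr rfl fun j _ => ?_
            have := hg (-(M:ℤ) + (j:ℕ)) x
            rw [← this]
          · refine lintegral_mono fun x => ?_
            have e : ‖f x‖ₑ ^ q = (‖f x‖ₑ ^ s) ^ (q/s) := by
              rw [← ENNReal.rpow_mul, mul_div_cancel₀ _ hs0.ne']
            rw [e, enorm_PiLp hs0]
            refine ENNReal.rpow_le_rpow ?_ (by positivity)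
            have hinj : Function.Injective (fun j : Fin (2*M) => -(M:ℤ) + ((j:ℕ):ℤ)) := by
              intro a b hab
              dsimp only at hab
              exact Fin.ext (by omega)
            rw [← tsum_fintype (L := .unconditional _)]
            exact ENNReal.tsum_comp_le_tsum_of_injective hinj (fun j : ℤ => ‖g j x‖ₑ ^ s)
  · have hcl : IsClosed {ℓ : S | ‖P ℓ x‖ₑ ≤ ⨆ n, ‖P (d n) x‖ₑ} :=
      isClosed_le ((hPc x).comp continuous_subtype_val).enorm continuous_const
    have hsub : Set.range d ⊆ {ℓ : S | ‖P ℓ x‖ₑ ≤ ⨆ n, ‖P (d n) x‖ₑ} := by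
      rintro _ ⟨n, rfl⟩
      exact le_iSup (fun n => ‖P (d n) x‖ₑ) n
    have hall := closure_minimal hsub hcl
    rw [(TopologicalSpace.denseRange_denseSeq S).closure_range] at hall
    exact hall (Set.mem_univ (⟨ℓ, hℓ⟩ : S))

lemma norming_fin {s s' : ℝ} (hss : s.HolderConjugate s') (K : ℕ) (D : ℕ → ℂ) : ∃ c : ℕ → ℂ,
    ∑ k ∈ Finset.range K, ‖c k‖ ^ s' ≤ 1 ∧
    ∑ k ∈ Finset.range K, ‖D k‖ₑ ^ s ≤ ‖∑ k ∈ Finset.range K, c k * D k‖ₑ ^ s := by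
  have hs1 : 1 < s := hss.lt
  have hs0 : 0 < s := by linarith
  have hs'0 : 0 < s' := hss.symm.pos
  set Z := ∑ k ∈ Finset.range K, ‖D k‖ ^ s with hZ
  have hZ0 : 0 ≤ Z := Finset.sum_nonneg fun _ _ => by positivity
  have hZe : ∑ k ∈ Finset.range K, ‖D k‖ₑ ^ s = ENNReal.ofReal Z := by
    rw [hZ, ofReal_sum_of_nonneg fun _ _ => by positivity]
    refine Finset.sum_congr rfl fun k _ => ?_
    rw [← ofReal_norm, ofReal_rpow_of_nonneg (norm_nonneg _) hs0.le]
  rw [hZe]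
  rcases hZ0.eq_or_lt with h0 | hpos
  · refine ⟨fun _ => 0, ?_, ?_⟩
    · simp [Real.zero_rpow hs'0.ne']
    · rw [← h0]; simp
  · refine ⟨fun k => sgp s (D k) * ((Z ^ (-(1/s')) : ℝ) : ℂ), ?_, ?_⟩
    · have e : ∀ k, ‖sgp s (D k) * ((Z ^ (-(1/s')) : ℝ) : ℂ)‖ ^ s' = ‖D k‖ ^ s * Z⁻¹ := by
        intro k
        rw [norm_mul, sgp_norm hs1, Complex.norm_real, Real.norm_of_nonneg (by positivity),
          Real.mul_rpow (by positivity) (by positivity), ← Real.rpow_mul (norm_nonneg _), ← Real.rpow_mul hZ0,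
          hss.sub_one_mul_conj, neg_mul, one_div_mul_cancel hs'0.ne', Real.rpow_neg_one]
      simp_rw [e]
      rw [← Finset.sum_mul, ← hZ, mul_inv_cancel₀ hpos.ne']
    · have e : ∑ k ∈ Finset.range K, sgp s (D k) * ((Z ^ (-(1/s')) : ℝ) : ℂ) * D k = ((Z ^ (1/s) : ℝ) : ℂ) := by
        have : ∀ k, sgp s (D k) * ((Z ^ (-(1/s')) : ℝ) : ℂ) * D k = ((‖D k‖ ^ s * Z ^ (-(1/s')) : ℝ) : ℂ) := by
          intro k
          rw [Complex.ofReal_mul, ← sgp_mul hs1]; ring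
        simp_rw [this]
        rw [← Complex.ofReal_sum, ← Finset.sum_mul, ← hZ]
        congr 1
        nth_rw 1 [← Real.rpow_one Z]
        rw [← Real.rpow_add hpos]
        congr 1
        have := hss.inv_add_inv_eq_one
        rw [one_div, one_div]; linarith
      rw [e, ← ofReal_norm, Complex.norm_real, Real.norm_of_nonneg (by positivity),
        ofReal_rpow_of_nonneg (by positivity) hs0.le, ← Real.rpow_mul hZ0, one_div_mul_cancel hs0.ne', Real.rpow_one]

lemma var_pt {s s' : ℝ} (hss : s.HolderConjugate s') (M : ℕ) (G : ℤ → ℂ) (v : ℝ≥0∞)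
    (hv : ∀ (ℓ : Fin (2 * M) → ℂ), Adm s' ℓ → ‖∑ j : Fin (2*M), ℓ j * G (-(M:ℤ) + (j:ℕ))‖ₑ ≤ v)
    (e : ℕ → ℤ) (he : Monotone e) (K : ℕ) (h0 : -(M:ℤ) - 1 ≤ e 0) (hK : e K ≤ M - 1) :
    ∑ i ∈ Finset.range K, ‖∑ j ∈ Finset.Ioc (e i) (e (i+1)), G j‖ₑ ^ s ≤ v ^ s := by
  have hs0 : 0 < s := by linarith [hss.lt]
  set D : ℕ → ℂ := fun i => ∑ j ∈ Finset.Ioc (e i) (e (i+1)), G j with hD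
  obtain ⟨c, hc1, hc2⟩ := norming_fin hss K D
  refine hc2.trans (ENNReal.rpow_le_rpow ?_ hs0.le)
  set n : ℕ → ℕ := fun i => (min (e i + 1 + M) (2 * M)).toNat with hn
  have hnm : Monotone n := by
    intro a b hab
    have := he hab
    simp only [hn]; omega
  have hnL : ∀ k, n k ≤ 2 * M := fun k => by simp only [hn]; omega
  have h1 := hv (fun j => ∑ k ∈ Finset.range K, if n k ≤ (j:ℕ) ∧ (j:ℕ) < n (k+1) then c k else 0)
    ⟨K, n, c, hnm, hnL, hc1, fun j => rfl⟩
  rw [adm_pair hnm hnL (fun j => rfl) (fun j : ℕ => G (-(M:ℤ) + (j:ℕ)))] at h1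
  refine le_trans (le_of_eq ?_) h1
  congr 1
  refine Finset.sum_congr rfl fun k hk => ?_
  have hk' := Finset.mem_range.1 hk
  have a1 : e 0 ≤ e k := he (Nat.zero_le k)
  have a2 : e (k+1) ≤ e K := he (by omega)
  have a3 : e k ≤ e (k+1) := he (by omega)
  congr 1
  rw [← Finset.sum_Ico_eq_sub _ (hnm (show k ≤ k + 1 by omega))]
  simp only [hD]
  refine Finset.sum_nbij' (fun j : ℤ => (j + M).toNat) (fun j : ℕ => -(M:ℤ) + j) ?_ ?_ ?_ ?_ ?_
  · intro j hj
    simp only [Finset.mem_Ioc, Finset.mem_Ico, hn] at hj ⊢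
    omega
  · intro j hj
    simp only [Finset.mem_Ioc, Finset.mem_Ico, hn] at hj ⊢
    omega
  · intro j hj
    simp only [Finset.mem_Ioc] at hj
    omega
  · intro j hj
    omega
  · intro j hj
    simp only [Finset.mem_Ioc] at hj
    congr 1
    omega

theorem linear_est {Ψ ψ : ℝ → ℂ} {A : ℝ} (hk : Ker Ψ ψ A) {s q : ℝ} (hs1 : 1 < s) (hs2 : s < 2) (hq : 1 < q) :
    ∃ C : ℝ≥0, ∀ g : ℤ → SchwartzMap ℝ ℂ, (∀ j x, cv (dil ψ j) (g j) x = g j x) → 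
      ∃ W : ℝ → ℝ≥0∞, Measurable W ∧
        ∫⁻ x, W x ^ q ≤ C * ∫⁻ x, (∑' j : ℤ, ‖g j x‖ₑ ^ s) ^ (q / s) ∧
        ∀ x (e : ℕ → ℤ), Monotone e → ∀ K, ∑ i ∈ Finset.range K, ‖∑ j ∈ Finset.Ioc (e i) (e (i+1)), g j x‖ₑ ^ s ≤ W x ^ s := by
  have hss : s.HolderConjugate (s / (s - 1)) := Real.HolderConjugate.conjExponent hs1
  have hs0 : 0 < s := by linarith
  have hq0 : 0 < q := by linarith
  obtain ⟨C, hC⟩ := adm_sup hk hss hs2 hq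
  refine ⟨C, fun g hg => ?_⟩
  choose V hVm hV1 hV2 using hC g hg
  have hlm : Measurable fun x => Filter.liminf (fun M => V M x ^ q) Filter.atTop :=
    Measurable.liminf fun M => (hVm M).pow_const q
  refine ⟨fun x => (Filter.liminf (fun M => V M x ^ q) Filter.atTop) ^ (1/q), hlm.pow_const _, ?_, fun x e he K => ?_⟩
  · calc _ = ∫⁻ x, Filter.liminf (fun M => V M x ^ q) Filter.atTop := by
          refine lintegral_congr fun x => ?_
          rw [← ENNReal.rpow_mul, one_div_mul_cancel hq0.ne', ENNReal.rpow_one]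
      _ ≤ Filter.liminf (fun M => ∫⁻ x, V M x ^ q) Filter.atTop := lintegral_liminf_le fun M => (hVm M).pow_const q
      _ ≤ _ := by
          refine (Filter.liminf_le_liminf (Filter.Eventually.of_forall hV1)).trans ?_
          rw [Filter.liminf_const]
  · set Y := ∑ i ∈ Finset.range K, ‖∑ j ∈ Finset.Ioc (e i) (e (i+1)), g j x‖ₑ ^ s with hY
    have hYM : Y ^ (q/s) ≤ Filter.liminf (fun M => V M x ^ q) Filter.atTop := by
      refine Filter.le_liminf_of_le (by isBoundedDefault) ?_
      filter_upwards [Filter.eventually_ge_atTop ((e 0).natAbs + (e K).natAbs + 1)] with M hM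
      have h1 := var_pt hss M (fun j => g j x) (V M x) (fun ℓ hℓ => hV2 M x ℓ hℓ) e he K (by omega) (by omega)
      calc Y ^ (q/s) ≤ (V M x ^ s) ^ (q/s) := ENNReal.rpow_le_rpow h1 (by positivity)
        _ = _ := by rw [← ENNReal.rpow_mul, mul_div_cancel₀ _ hs0.ne']
    calc Y = (Y ^ (q/s)) ^ (1/q * s) := by
          rw [← ENNReal.rpow_mul]
          have : q / s * (1/q*s) = 1 := by field_simp
          rw [this, ENNReal.rpow_one]
      _ ≤ _ := ENNReal.rpow_le_rpow hYM (by positivity)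
      _ = _ := by rw [ENNReal.rpow_mul]

end

section
set_option linter.unusedSectionVars false

lemma sum_swap_pair (f g : ℤ → ℂ) (N N' : ℤ) :
    ∑ j ∈ Finset.Ioc N N', ∑ i ∈ Finset.Ioo N j, f i * g j =
      ∑ i ∈ Finset.Ioc N N', f i * ∑ j ∈ Finset.Ioc i N', g j := by
  simp_rw [Finset.mul_sum]
  apply Finset.sum_comm'
  intro x y
  simp only [Finset.mem_Ioc, Finset.mem_Ioo]
  omega

lemma sum_even_le (F : ℕ → ℝ≥0∞) (K : ℕ) :
    ∑ k ∈ Finset.range K, F (2 * k) ≤ ∑ i ∈ Finset.range (2 * K), F i := by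
  induction K with
  | zero => simp
  | succ K ih =>
    rw [Finset.sum_range_succ, show 2 * (K + 1) = 2 * K + 1 + 1 by ring, Finset.sum_range_succ,
      Finset.sum_range_succ]
    exact (add_le_add ih le_rfl).trans le_self_add

lemma sum_blocks (a : ℤ → ℝ≥0∞) (n : ℕ → ℤ) (hn : Monotone n) (K : ℕ) :
    ∑ k ∈ Finset.range K, ∑ i ∈ Finset.Ioc (n k) (n (k + 1)), a i
      = ∑ i ∈ Finset.Ioc (n 0) (n K), a i := by
  induction K with
  | zero => simp
  | succ K ih =>
    rw [Finset.sum_range_succ, ih, ← Finset.Ioc_union_Ioc_eq_Ioc (hn (Nat.zero_le K))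
      (hn (Nat.le_succ K)), Finset.sum_union]
    rw [Finset.disjoint_left]
    intro x
    simp only [Finset.mem_Ioc]
    omega

lemma pointwise_bound {s t : ℝ} (hs1 : 1 < s) (ht : t = s / (1 + s)) (f g : ℤ → ℂ) (n : ℕ → ℤ)
    (hn : Monotone n) (W : ℝ≥0∞)
    (hW : ∀ e : ℕ → ℤ, Monotone e → ∀ K,
      ∑ i ∈ Finset.range K, ‖∑ j ∈ Finset.Ioc (e i) (e (i + 1)), g j‖ₑ ^ s ≤ W ^ s) :
    (∑' k : ℕ, ‖∑ j ∈ Finset.Ioc (n k) (n (k + 1)), ∑ i ∈ Finset.Ioo (n k) j, f i * g j‖ₑ ^ t) ^ (1 / t)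
      ≤ (∑' i : ℤ, ‖f i‖ₑ) * W := by
  have hs0 : 0 < s := by linarith
  have ht0 : 0 < t := by rw [ht]; positivity
  have hnn : ∀ k, n k ≤ n (k + 1) := fun k => hn (Nat.le_succ k)
  have hex : ∀ k, ∃ i ∈ Finset.Icc (n k) (n (k + 1)), ∀ i' ∈ Finset.Icc (n k) (n (k + 1)),
      ‖∑ j ∈ Finset.Ioc i' (n (k + 1)), g j‖ₑ ≤ ‖∑ j ∈ Finset.Ioc i (n (k + 1)), g j‖ₑ := fun k =>
    Finset.exists_max_image _ (fun i => ‖∑ j ∈ Finset.Ioc i (n (k + 1)), g j‖ₑ)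
      ⟨n k, Finset.mem_Icc.2 ⟨le_rfl, hnn k⟩⟩
  choose m hm hmax using hex
  set B : ℕ → ℝ≥0∞ := fun k => ‖∑ j ∈ Finset.Ioc (m k) (n (k + 1)), g j‖ₑ with hB
  set A : ℕ → ℝ≥0∞ := fun k => ∑ i ∈ Finset.Ioc (n k) (n (k + 1)), ‖f i‖ₑ with hA
  have hS : ∀ k, ‖∑ j ∈ Finset.Ioc (n k) (n (k + 1)), ∑ i ∈ Finset.Ioo (n k) j, f i * g j‖ₑ
      ≤ A k * B k := by
    intro k
    rw [sum_swap_pair]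
    refine (enorm_sum_le _ _).trans ?_
    rw [hA, Finset.sum_mul]
    refine Finset.sum_le_sum fun i hi => ?_
    rw [enorm_mul]
    refine mul_le_mul' le_rfl (hmax k i ?_)
    rw [Finset.mem_Ioc] at hi
    exact Finset.mem_Icc.2 ⟨hi.1.le, hi.2⟩
  set e : ℕ → ℤ := fun i => if i % 2 = 0 then m (i / 2) else n (i / 2 + 1) with he
  have he0 : ∀ k, e (2 * k) = m k := fun k => by
    have h1 : (2 * k) % 2 = 0 := by omega
    have h2 : (2 * k) / 2 = k := by omega
    simp [he]
  have he1 : ∀ k, e (2 * k + 1) = n (k + 1) := fun k => by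
    have h1 : ¬ ((2 * k + 1) % 2 = 0) := by omega
    have h2 : (2 * k + 1) / 2 = k := by omega
    simp only [he, h1, h2, if_false]
  have hem : Monotone e := by
    apply monotone_nat_of_le_succ
    intro i
    rcases Nat.even_or_odd' i with ⟨k, rfl | rfl⟩
    · rw [he0, he1]; exact (Finset.mem_Icc.1 (hm k)).2
    · rw [he1, show 2 * k + 1 + 1 = 2 * (k + 1) by ring, he0]
      exact (Finset.mem_Icc.1 (hm (k + 1))).1
  have hBs : ∀ K, ∑ k ∈ Finset.range K, B k ^ s ≤ W ^ s := by
    intro K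
    refine le_trans ?_ (hW e hem (2 * K))
    refine le_trans (le_of_eq ?_) (sum_even_le _ K)
    refine Finset.sum_congr rfl fun k _ => ?_
    rw [he0, he1]
  have hAs : ∀ K, ∑ k ∈ Finset.range K, A k ≤ ∑' i : ℤ, ‖f i‖ₑ := by
    intro K
    rw [hA, sum_blocks _ n hn K]
    exact ENNReal.sum_le_tsum _
  have hconj : (1 / t).HolderConjugate (1 + s) := by
    rw [Real.holderConjugate_iff]
    constructor
    · rw [ht]; rw [one_div_div, lt_div_iff₀ hs0]; linarith
    · rw [ht]; field_simp; ring
  have hts : t * (1 + s) = s := by rw [ht]; field_simp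
  have hfin : ∑' k : ℕ, ‖∑ j ∈ Finset.Ioc (n k) (n (k + 1)), ∑ i ∈ Finset.Ioo (n k) j, f i * g j‖ₑ ^ t
      ≤ ((∑' i : ℤ, ‖f i‖ₑ) * W) ^ t := by
    refine ENNReal.tsum_le_of_sum_range_le fun K => ?_
    calc ∑ k ∈ Finset.range K, ‖∑ j ∈ Finset.Ioc (n k) (n (k + 1)), ∑ i ∈ Finset.Ioo (n k) j, f i * g j‖ₑ ^ t
        ≤ ∑ k ∈ Finset.range K, A k ^ t * B k ^ t := Finset.sum_le_sum fun k _ => by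
          rw [← ENNReal.mul_rpow_of_nonneg _ _ ht0.le]
          exact ENNReal.rpow_le_rpow (hS k) ht0.le
      _ ≤ (∑ k ∈ Finset.range K, (A k ^ t) ^ (1 / t)) ^ (1 / (1 / t)) *
          (∑ k ∈ Finset.range K, (B k ^ t) ^ (1 + s)) ^ (1 / (1 + s)) :=
          ENNReal.inner_le_Lp_mul_Lq _ _ _ hconj
      _ = (∑ k ∈ Finset.range K, A k) ^ t * (∑ k ∈ Finset.range K, B k ^ s) ^ (1 / (1 + s)) := by
          simp_rw [← ENNReal.rpow_mul, hts]
          rw [mul_one_div_cancel ht0.ne', one_div_one_div]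
          simp
      _ ≤ (∑' i : ℤ, ‖f i‖ₑ) ^ t * (W ^ s) ^ (1 / (1 + s)) :=
          mul_le_mul' (ENNReal.rpow_le_rpow (hAs K) ht0.le)
            (ENNReal.rpow_le_rpow (hBs K) (by positivity))
      _ = _ := by
          rw [← ENNReal.rpow_mul, ENNReal.mul_rpow_of_nonneg _ _ ht0.le, ht, mul_one_div]
  calc _ ≤ (((∑' i : ℤ, ‖f i‖ₑ) * W) ^ t) ^ (1 / t) := ENNReal.rpow_le_rpow hfin (by positivity)
    _ = _ := by rw [← ENNReal.rpow_mul, mul_one_div_cancel ht0.ne', ENNReal.rpow_one]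


lemma eNorm_holder (p : ℝ≥0∞) (q : ℝ) (hp : 0 < p) (hq1 : 1 < q) (F W H : ℝ → ℝ≥0∞)
    (hF : Measurable F) (hW : Measurable W) (hH : ∀ x, H x ≤ F x * W x) :
    eNorm ((1 / p + 1 / ENNReal.ofReal q)⁻¹) H
      ≤ eNorm p F * (∫⁻ x, W x ^ q) ^ (1 / q) := by
  have hq0 : 0 < q := by linarith
  have hqn : ENNReal.ofReal q ≠ 0 := by simpa using hq0
  by_cases hpt : p = ⊤
  · subst hpt
    have hu : (1 / (⊤ : ℝ≥0∞) + 1 / ENNReal.ofReal q)⁻¹ = ENNReal.ofReal q := by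
      simp
    rw [hu]
    simp only [eNorm, ENNReal.ofReal_ne_top, if_false, if_true, ENNReal.toReal_ofReal hq0.le]
    calc (∫⁻ x, H x ^ q) ^ (1 / q)
        ≤ (∫⁻ x, (essSup F volume) ^ q * W x ^ q) ^ (1 / q) := by
          refine ENNReal.rpow_le_rpow (lintegral_mono_ae ?_) (by positivity)
          filter_upwards [ENNReal.ae_le_essSup F] with x hx
          rw [← ENNReal.mul_rpow_of_nonneg _ _ hq0.le]
          exact ENNReal.rpow_le_rpow ((hH x).trans (mul_le_mul' hx le_rfl)) hq0.le
      _ = _ := by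
          rw [lintegral_const_mul _ (hW.pow_const q), ENNReal.mul_rpow_of_nonneg _ _ (by positivity),
            ← ENNReal.rpow_mul, mul_one_div_cancel hq0.ne', ENNReal.rpow_one]
  · have hp0 : 0 < p.toReal := ENNReal.toReal_pos hp.ne' hpt
    set P := p.toReal with hP
    have hpe : p = ENNReal.ofReal P := (ENNReal.ofReal_toReal hpt).symm
    set u : ℝ := (1 / P + 1 / q)⁻¹ with hu'
    have hu0 : 0 < u := by positivity
    have hu : (1 / p + 1 / ENNReal.ofReal q)⁻¹ = ENNReal.ofReal u := by
      rw [hpe, hu', ENNReal.ofReal_inv_of_pos (by positivity),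
        ENNReal.ofReal_add (by positivity) (by positivity)]
      simp only [one_div]
      rw [ENNReal.ofReal_inv_of_pos hp0, ENNReal.ofReal_inv_of_pos hq0]
    have h1u : 1 / u = 1 / P + 1 / q := by rw [hu', one_div, inv_inv]
    have hup : u < P := by
      have : 1 / P < 1 / u := by rw [h1u]; linarith [show 0 < 1 / q by positivity]
      exact (one_div_lt_one_div hp0 hu0).1 this
    rw [hu]
    simp only [eNorm, hpt, ENNReal.ofReal_ne_top, if_false, ENNReal.toReal_ofReal hu0.le]
    refine le_trans ?_ (ENNReal.lintegral_Lp_mul_le_Lq_mul_Lr hu0 hup h1u volume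
      hF.aemeasurable hW.aemeasurable)
    refine ENNReal.rpow_le_rpow (lintegral_mono fun x => ?_) (by positivity)
    exact ENNReal.rpow_le_rpow (hH x) hu0.le

lemma final_est
    (p : ℝ≥0∞) (q s t Nb : ℝ) (hp : 0 < p) (hq1 : 1 < q)
    (hs1 : 1 < s) (hs2 : s < 2) (ht : t = s / (1 + s)) (hNb : 0 < Nb) :
    ∃ C : ℝ≥0, 0 < C ∧
      ∀ (Nk : ℕ → ℝ → ℤ), (∀ k x, Nk k x ≤ Nk (k + 1) x) →
      ∀ (f : ℤ → ℝ → ℂ), (∀ i, Measurable (f i)) →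
      ∀ (g : ℤ → SchwartzMap ℝ ℂ), (∀ j : ℤ, ∀ ξ : ℝ, 𝓕 (⇑(g j)) ξ ≠ 0 →
    (2 : ℝ) ^ ((j : ℝ) - Nb) < |ξ| ∧ |ξ| < (2 : ℝ) ^ ((j : ℝ) + Nb)) →
      eNorm ((1 / p + 1 / ENNReal.ofReal q)⁻¹)
          (fun x => (∑' k : ℕ, (ENNReal.ofReal (norm
              (∑ j ∈ Finset.Ioc (Nk k x) (Nk (k + 1) x),
                ∑ i ∈ Finset.Ioo (Nk k x) j, f i x * g j x))) ^ t) ^ (1 / t))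
        ≤ (C : ℝ≥0∞) *
          eNorm p (fun x => ∑' i : ℤ, ENNReal.ofReal (norm (f i x))) *
          eNorm (ENNReal.ofReal q)
            (fun x => (∑' j : ℤ, (ENNReal.ofReal (norm (g j x))) ^ s) ^ (1 / s)) := by
  have hq0 : 0 < q := by linarith
  obtain ⟨Ψ, ψ, A, hk, hrep⟩ := exists_kernel Nb hNb
  obtain ⟨C, hC⟩ := linear_est hk hs1 hs2 hq1
  refine ⟨C ^ (1 / q) + 1, by positivity, fun Nk hN f hf g hg => ?_⟩
  obtain ⟨W, hWm, hWi, hWv⟩ := hC g (fun j x => hrep j (g j) (hg j) x)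
  simp only [ofReal_norm]
  have hFm : Measurable (fun x => ∑' i : ℤ, ‖f i x‖ₑ) :=
    Measurable.tsum fun i => (hf i).enorm
  refine (eNorm_holder p q hp hq1 _ W _ hFm hWm fun x => ?_).trans ?_
  · exact pointwise_bound hs1 ht (fun i => f i x) (fun j => g j x) (fun k => Nk k x)
      (monotone_nat_of_le_succ fun k => hN k x) (W x) (hWv x)
  · rw [mul_comm ((↑(C ^ (1 / q) + 1) : ℝ≥0∞)), mul_assoc]
    refine mul_le_mul' le_rfl ?_
    simp only [eNorm, ENNReal.ofReal_ne_top, if_false, ENNReal.toReal_ofReal hq0.le]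
    calc (∫⁻ x, W x ^ q) ^ (1 / q)
        ≤ (C * ∫⁻ x, (∑' j : ℤ, ‖g j x‖ₑ ^ s) ^ (q / s)) ^ (1 / q) :=
          ENNReal.rpow_le_rpow hWi (by positivity)
      _ = (C : ℝ≥0∞) ^ (1 / q) * (∫⁻ x, (∑' j : ℤ, ‖g j x‖ₑ ^ s) ^ (q / s)) ^ (1 / q) :=
          ENNReal.mul_rpow_of_nonneg _ _ (by positivity)
      _ ≤ _ := by
          refine mul_le_mul' ?_ (le_of_eq ?_)
          · rw [ENNReal.coe_add, ← ENNReal.coe_rpow_of_nonneg _ (by positivity : 0 ≤ 1 / q)]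
            exact le_self_add
          · simp_rw [← ENNReal.rpow_mul, one_div_mul_eq_div]

end

/-- The endpoint `r = 1`, `1 < s < 2` of the bilinear variational paraproduct
estimate: the first family is arbitrary. -/
theorem bilinear_variational_endpoint_r_one
    (p : ℝ≥0∞) (q s t Nb : ℝ) (hp : 0 < p) (hq1 : 1 < q)
    (hs1 : 1 < s) (hs2 : s < 2) (ht : t = s / (1 + s)) (hNb : 0 < Nb) :
    ∃ C : ℝ≥0, 0 < C ∧
      ∀ (Nk : ℕ → ℝ → ℤ), IsJumpCollection Nk →
      ∀ (f : ℤ → ℝ → ℂ), (∀ i, Measurable (f i)) →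
      ∀ (g : ℤ → SchwartzMap ℝ ℂ), IsContLPFamily Nb g →
      eNorm ((1 / p + 1 / ENNReal.ofReal q)⁻¹)
          (fun x => (∑' k : ℕ, (ENNReal.ofReal (norm
              (∑ j ∈ Finset.Ioc (Nk k x) (Nk (k + 1) x),
                ∑ i ∈ Finset.Ioo (Nk k x) j, f i x * g j x))) ^ t) ^ (1 / t))
        ≤ (C : ℝ≥0∞) *
          eNorm p (fun x => ∑' i : ℤ, ENNReal.ofReal (norm (f i x))) *
          eNorm (ENNReal.ofReal q)
            (fun x => (∑' j : ℤ, (ENNReal.ofReal (norm (g j x))) ^ s) ^ (1 / s)) := by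
  obtain ⟨C, hC0, hC⟩ := final_est p q s t Nb hp hq1 hs1 hs2 ht hNb
  exact ⟨C, hC0, fun Nk hN f hf g hg => hC Nk hN.2 f hf g hg⟩

end
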